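/- arXiv:1503.07926 — 4 statements merged into one kernel-verified Lean document; each statement's English description precedes it below -/
import Mathlib

section
/- Let $M_n$ be the $n\times n$ real symmetric matrix with entries $M_n(j,k) = \frac{1}{\sqrt{2\pi}}\,\frac{\Gamma(j+k-3/2)}{\sqrt{\Gamma(2j-1)\Gamma(2k-1)}}$ for $1\le j,k\le n$, and for $0\le k\le n$ let $c_{n,k}$ denote the coefficient of $z^k$ in the polynomial $z \mapsto \det(I_n + (z-1) M_n)$. Let $(k_n)_{n\ge 1}$ be a sequence of non-negative integers with $k_n \le n$ such that $\lim_{n\to\infty} n^{-1/2}\log(n)\, k_n = 0$. Then $\lim_{n\to\infty} \frac{1}{\sqrt{2n}} \log c_{n,k_n} = -\frac{1}{\sqrt{2\pi}}\,\zeta(3/2)$, where $\zeta$ is the Riemann zeta function. -/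
/-- The `n × n` real symmetric matrix with entries
`M_n(j,k) = Γ(j+k-3/2) / (√(2π) √(Γ(2j-1) Γ(2k-1)))` for `1 ≤ j,k ≤ n`. -/
noncomputable def ginibreM (n : ℕ) : Matrix (Fin n) (Fin n) ℝ :=
  Matrix.of fun j k =>
    (1 / Real.sqrt (2 * Real.pi)) *
      Real.Gamma (((j : ℕ) + 1 : ℝ) + ((k : ℕ) + 1 : ℝ) - 3 / 2) /
        Real.sqrt (Real.Gamma (2 * ((j : ℕ) + 1 : ℝ) - 1) *
          Real.Gamma (2 * ((k : ℕ) + 1 : ℝ) - 1))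

/-- The coefficient of `z^k` in the polynomial `z ↦ det(I_n + (z-1) M_n)`. -/
noncomputable def ginibreCoeff (n k : ℕ) : ℝ :=
  (Matrix.det ((1 : Matrix (Fin n) (Fin n) (Polynomial ℝ)) +
    (Polynomial.X - 1 : Polynomial ℝ) • (ginibreM n).map Polynomial.C)).coeff k

namespace GinibreReal

open Real Polynomial MeasureTheory Filter Topology Matrix

/-- The unnormalised Gaussian functional `p ↦ ∫ p(x) exp(-b x² / 2) dx` on real polynomials. -/
noncomputable def gaussInt (b : ℝ) (p : ℝ[X]) : ℝ :=
  ∫ x : ℝ, p.eval x * exp (-b / 2 * x ^ 2)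

lemma integrable_eval_mul_exp {b : ℝ} (hb : 0 < b) (p : ℝ[X]) :
    Integrable fun x : ℝ => p.eval x * exp (-b / 2 * x ^ 2) := by
  induction p using Polynomial.induction_on' with
  | add p q hp hq =>
    simp only [eval_add, add_mul]
    exact hp.add hq
  | monomial n a =>
    have h := integrable_rpow_mul_exp_neg_mul_sq (b := b / 2) (by positivity) (s := n)
      (by have : (0 : ℝ) ≤ n := n.cast_nonneg
          linarith)
    simp only [rpow_natCast] at h
    convert h.const_mul a using 2 with x
    rw [eval_monomial]
    ring_nf

lemma gaussInt_add {b : ℝ} (hb : 0 < b) (p q : ℝ[X]) :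
    gaussInt b (p + q) = gaussInt b p + gaussInt b q := by
  simp only [gaussInt, eval_add, add_mul]
  exact integral_add (integrable_eval_mul_exp hb p) (integrable_eval_mul_exp hb q)

lemma gaussInt_sub {b : ℝ} (hb : 0 < b) (p q : ℝ[X]) :
    gaussInt b (p - q) = gaussInt b p - gaussInt b q := by
  simp only [gaussInt, eval_sub, sub_mul]
  exact integral_sub (integrable_eval_mul_exp hb p) (integrable_eval_mul_exp hb q)

lemma gaussInt_C_mul (b c : ℝ) (p : ℝ[X]) : gaussInt b (C c * p) = c * gaussInt b p := by
  simp only [gaussInt, eval_mul, eval_C, mul_assoc]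
  exact integral_const_mul _ _

lemma gaussInt_natCast_mul (b : ℝ) (n : ℕ) (p : ℝ[X]) :
    gaussInt b ((n : ℝ[X]) * p) = n * gaussInt b p := by
  simpa using gaussInt_C_mul b n p

lemma gaussInt_sum {b : ℝ} (hb : 0 < b) {ι : Type*} (s : Finset ι) (f : ι → ℝ[X]) :
    gaussInt b (∑ i ∈ s, f i) = ∑ i ∈ s, gaussInt b (f i) := by
  simp only [gaussInt, eval_finsetSum, Finset.sum_mul]
  exact integral_finsetSum s fun i _ => integrable_eval_mul_exp hb (f i)

lemma gaussInt_one (b : ℝ) : gaussInt b 1 = √(2 * π / b) := by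
  have h := integral_gaussian (b / 2)
  simp only [gaussInt, eval_one, one_mul]
  rw [show (2 * π / b) = π / (b / 2) by field_simp, ← h]
  congr 1 with x
  ring_nf

lemma gaussInt_derivative {b : ℝ} (hb : 0 < b) (p : ℝ[X]) :
    gaussInt b (derivative p) = b * gaussInt b (X * p) := by
  have key := integral_eq_zero_of_hasDerivAt_of_integrable
    (f := fun x : ℝ => p.eval x * exp (-b / 2 * x ^ 2))
    (f' := fun x : ℝ => (derivative p - C b * (X * p)).eval x * exp (-b / 2 * x ^ 2))
    (fun x => by
      have h1 := p.hasDerivAt x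
      have h2 : HasDerivAt (fun x : ℝ => exp (-b / 2 * x ^ 2))
          (exp (-b / 2 * x ^ 2) * (-b / 2 * (2 * x))) x := by
        have := (((hasDerivAt_id x).pow 2).const_mul (-b / 2)).exp
        simpa using this
      refine (h1.mul h2).congr_deriv ?_
      simp only [eval_sub, eval_mul, eval_C, eval_X]
      ring)
    (integrable_eval_mul_exp hb _) (integrable_eval_mul_exp hb _)
  have h : gaussInt b (derivative p - C b * (X * p)) = 0 := key
  rw [gaussInt_sub hb, gaussInt_C_mul] at h
  linarith

/-- The probabilists' Hermite polynomials with real coefficients. -/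
noncomputable def herm (n : ℕ) : ℝ[X] := (hermite n).map (Int.castRingHom ℝ)

lemma herm_zero : herm 0 = 1 := by simp [herm, hermite_zero]

lemma herm_succ (n : ℕ) : herm (n + 1) = X * herm n - derivative (herm n) := by
  simp [herm, hermite_succ, derivative_map]

lemma derivative_herm_succ (n : ℕ) : derivative (herm (n + 1)) = ((n + 1 : ℕ) : ℝ[X]) * herm n := by
  induction n with
  | zero => simp [herm_succ, herm_zero]
  | succ n ih =>
    rw [herm_succ (n + 1), derivative_sub, derivative_mul, derivative_X, ih, derivative_natCast_mul]
    rw [herm_succ n]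
    push_cast
    ring

lemma derivative_herm (n : ℕ) : derivative (herm n) = (n : ℝ[X]) * herm (n - 1) := by
  cases n with
  | zero => simp [herm_zero]
  | succ n => simpa using derivative_herm_succ n

/-- The Gaussian pairing of two Hermite polynomials. -/
noncomputable def hermPair (b : ℝ) (j k : ℕ) : ℝ := gaussInt b (herm j * herm k)

lemma hermPair_comm (b : ℝ) (j k : ℕ) : hermPair b j k = hermPair b k j := by
  rw [hermPair, hermPair, mul_comm]

lemma hermPair_succ {b : ℝ} (hb : 0 < b) (j k : ℕ) :
    b * hermPair b (j + 1) k = k * hermPair b j (k - 1) - (b - 1) * j * hermPair b (j - 1) k := by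
  have h := gaussInt_derivative hb (herm j * herm k)
  have e1 : derivative (herm j * herm k)
      = (j : ℝ[X]) * (herm (j - 1) * herm k) + (k : ℝ[X]) * (herm j * herm (k - 1)) := by
    rw [derivative_mul, derivative_herm, derivative_herm]; ring
  have e2 : X * (herm j * herm k)
      = herm (j + 1) * herm k + (j : ℝ[X]) * (herm (j - 1) * herm k) := by
    rw [herm_succ, derivative_herm]; ring
  rw [e1, e2, gaussInt_add hb, gaussInt_add hb, gaussInt_natCast_mul, gaussInt_natCast_mul] at h
  simp only [hermPair]
  linarith

lemma hermPair_zero_zero (b : ℝ) : hermPair b 0 0 = √(2 * π / b) := by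
  simp [hermPair, herm_zero, gaussInt_one]

/-- A doubly indexed sequence is determined by the Hermite pairing recursion. -/
lemma eq_of_pair_recursion {K : Type*} [CommRing K] (α β : K) (F G : ℕ → ℕ → K)
    (hF : ∀ j k, F (j + 1) k = β * k * F j (k - 1) + α * j * F (j - 1) k)
    (hG : ∀ j k, G (j + 1) k = β * k * G j (k - 1) + α * j * G (j - 1) k)
    (hF0 : ∀ k, F 0 (k + 1) = α * k * F 0 (k - 1))
    (hG0 : ∀ k, G 0 (k + 1) = α * k * G 0 (k - 1))
    (h00 : F 0 0 = G 0 0) (j k : ℕ) : F j k = G j k := by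
  have h0 : ∀ k, F 0 k = G 0 k := by
    intro k
    induction k using Nat.strong_induction_on with
    | _ k ih =>
      cases k with
      | zero => exact h00
      | succ k => rw [hF0, hG0, ih (k - 1) (by omega)]
  induction j using Nat.strong_induction_on generalizing k with
  | _ j ih =>
    cases j with
    | zero => exact h0 k
    | succ j => rw [hF, hG, ih j (by omega), ih (j - 1) (by omega)]

lemma hermPair_one (j k : ℕ) :
    hermPair 1 j k = if j = k then √(2 * π) * (j.factorial : ℝ) else 0 := by
  refine eq_of_pair_recursion (K := ℝ) 0 1 (hermPair 1)
    (fun j k => if j = k then √(2 * π) * (j.factorial : ℝ) else 0) ?_ ?_ ?_ ?_ ?_ j k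
  · intro j k
    have := hermPair_succ one_pos j k
    linarith
  · intro j k
    cases k with
    | zero => simp
    | succ k =>
      simp only [add_left_inj, add_tsub_cancel_right, zero_mul, add_zero, one_mul]
      by_cases h : j = k
      · subst h; rw [if_pos rfl, if_pos rfl, Nat.factorial_succ]; push_cast; ring
      · simp [h]
  · intro k
    have := hermPair_succ one_pos k 0
    rw [hermPair_comm]
    simp at this ⊢
    exact this
  · intro k; simp
  · simp [hermPair_zero_zero]

/-- Mixed moments over the circle of the linear forms with coefficients `a` and `b`. -/
noncomputable def circleMoment (a b : ℂ × ℂ) (j k : ℕ) : ℂ :=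
  ∫ θ in (0 : ℝ)..(2 * π), (a.1 * (cos θ : ℝ) + a.2 * (sin θ : ℝ)) ^ j *
    (b.1 * (cos θ : ℝ) + b.2 * (sin θ : ℝ)) ^ k

lemma circleMoment_comm (a b : ℂ × ℂ) (j k : ℕ) : circleMoment a b j k = circleMoment b a k j := by
  simp only [circleMoment, mul_comm]

lemma hasDerivAt_linear_form (a : ℂ × ℂ) (θ : ℝ) :
    HasDerivAt (fun θ : ℝ => a.1 * (cos θ : ℝ) + a.2 * (sin θ : ℝ))
      (a.2 * (cos θ : ℝ) + (-a.1) * (sin θ : ℝ)) θ := by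
  have h1 := (hasDerivAt_cos θ).ofReal_comp.const_mul a.1
  have h2 := (hasDerivAt_sin θ).ofReal_comp.const_mul a.2
  refine (h1.add h2).congr_deriv ?_
  push_cast
  ring

lemma circleMoment_succ (a b : ℂ × ℂ) (j k : ℕ) :
    (j + k + 1 : ℂ) * circleMoment a b (j + 1) k =
      (a.1 ^ 2 + a.2 ^ 2) * j * circleMoment a b (j - 1) k +
      (a.1 * b.1 + a.2 * b.2) * k * circleMoment a b j (k - 1) := by
  set U : ℝ → ℂ := fun θ => a.1 * (cos θ : ℝ) + a.2 * (sin θ : ℝ) with hU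
  set V : ℝ → ℂ := fun θ => b.1 * (cos θ : ℝ) + b.2 * (sin θ : ℝ) with hV
  set Ud : ℝ → ℂ := fun θ => a.2 * (cos θ : ℝ) + (-a.1) * (sin θ : ℝ) with hUd
  set Vd : ℝ → ℂ := fun θ => b.2 * (cos θ : ℝ) + (-b.1) * (sin θ : ℝ) with hVd
  have dU : ∀ θ, HasDerivAt U (Ud θ) θ := hasDerivAt_linear_form a
  have dV : ∀ θ, HasDerivAt V (Vd θ) θ := hasDerivAt_linear_form b
  have dUd : ∀ θ, HasDerivAt Ud (-U θ) θ := fun θ => by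
    refine (hasDerivAt_linear_form (a.2, -a.1) θ).congr_deriv ?_
    simp only [hU]
    ring
  have cU : Continuous U := by fun_prop
  have cV : Continuous V := by fun_prop
  have sq : ∀ θ : ℝ, ((cos θ : ℝ) : ℂ) ^ 2 + ((sin θ : ℝ) : ℂ) ^ 2 = 1 := fun θ => by
    exact_mod_cast cos_sq_add_sin_sq θ
  have hUU : ∀ θ, Ud θ ^ 2 = a.1 ^ 2 + a.2 ^ 2 - U θ ^ 2 := fun θ => by
    simp only [hU, hUd]
    linear_combination (a.1 ^ 2 + a.2 ^ 2) * sq θ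
  have hUV : ∀ θ, Ud θ * Vd θ = a.1 * b.1 + a.2 * b.2 - U θ * V θ := fun θ => by
    simp only [hU, hUd, hV, hVd]
    linear_combination (a.1 * b.1 + a.2 * b.2) * sq θ
  have key : ∀ θ, HasDerivAt (fun θ => Ud θ * (U θ ^ j * V θ ^ k))
      ((a.1 ^ 2 + a.2 ^ 2) * j * (U θ ^ (j - 1) * V θ ^ k) +
      (a.1 * b.1 + a.2 * b.2) * k * (U θ ^ j * V θ ^ (k - 1)) -
      (j + k + 1 : ℂ) * (U θ ^ (j + 1) * V θ ^ k)) θ := fun θ => by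
    refine ((dUd θ).mul (((dU θ).fun_pow j).mul ((dV θ).fun_pow k))).congr_deriv ?_
    have e1 : (j : ℂ) * (U θ ^ (j - 1) * U θ) = j * U θ ^ j := by
      cases j with
      | zero => simp
      | succ j => simp [pow_succ]
    have e2 : (k : ℂ) * (V θ ^ (k - 1) * V θ) = k * V θ ^ k := by
      cases k with
      | zero => simp
      | succ k => simp [pow_succ]
    simp only [Pi.mul_apply]
    linear_combination (j * U θ ^ (j - 1) * V θ ^ k) * hUU θ
      + (k * U θ ^ j * V θ ^ (k - 1)) * hUV θ - U θ * V θ ^ k * e1 - U θ ^ (j + 1) * e2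
  have hint := intervalIntegral.integral_eq_sub_of_hasDerivAt (a := 0) (b := 2 * π)
    (fun θ _ => key θ) (Continuous.intervalIntegrable (by fun_prop) _ _)
  rw [intervalIntegral.integral_sub (Continuous.intervalIntegrable (by fun_prop) _ _)
      (Continuous.intervalIntegrable (by fun_prop) _ _),
    intervalIntegral.integral_add (Continuous.intervalIntegrable (by fun_prop) _ _)
      (Continuous.intervalIntegrable (by fun_prop) _ _),
    intervalIntegral.integral_const_mul, intervalIntegral.integral_const_mul,
    intervalIntegral.integral_const_mul] at hint
  have hb : Ud (2 * π) * (U (2 * π) ^ j * V (2 * π) ^ k) - Ud 0 * (U 0 ^ j * V 0 ^ k) = 0 := by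
    simp [hU, hUd, hV]
  rw [hb] at hint
  simp only [circleMoment]
  linear_combination -hint

/-- The Gamma-weighted circle moments obey the Hermite pairing recursion. -/
lemma gamma_mul_circleMoment_succ (a b : ℂ × ℂ) (j k : ℕ) :
    (Gamma (((j + 1 : ℕ) + k : ℝ) / 2 + 1) : ℂ) * circleMoment a b (j + 1) k =
      (a.1 * b.1 + a.2 * b.2) / 2 * k *
        ((Gamma ((j + (k - 1 : ℕ) : ℝ) / 2 + 1) : ℂ) * circleMoment a b j (k - 1)) +
      (a.1 ^ 2 + a.2 ^ 2) / 2 * j *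
        ((Gamma (((j - 1 : ℕ) + k : ℝ) / 2 + 1) : ℂ) * circleMoment a b (j - 1) k) := by
  have h := circleMoment_succ a b j k
  have h0 : (Gamma (((j + 1 : ℕ) + k : ℝ) / 2 + 1) : ℝ)
      = (j + k + 1 : ℝ) / 2 * Gamma ((j + k + 1 : ℝ) / 2) := by
    rw [← Gamma_add_one (by positivity)]
    congr 1
    push_cast
    ring
  have h1 : (k : ℂ) * (Gamma ((j + (k - 1 : ℕ) : ℝ) / 2 + 1) : ℂ)
      = k * (Gamma ((j + k + 1 : ℝ) / 2) : ℂ) := by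
    cases k with
    | zero => simp
    | succ k =>
      congr 3
      push_cast [add_tsub_cancel_right]
      ring
  have h2 : (j : ℂ) * (Gamma (((j - 1 : ℕ) + k : ℝ) / 2 + 1) : ℂ)
      = j * (Gamma ((j + k + 1 : ℝ) / 2) : ℂ) := by
    cases j with
    | zero => simp
    | succ j =>
      congr 3
      push_cast [add_tsub_cancel_right]
      ring
  rw [h0]
  push_cast
  linear_combination (Gamma ((j + k + 1 : ℝ) / 2) : ℂ) / 2 * h
    - (a.1 * b.1 + a.2 * b.2) / 2 * circleMoment a b j (k - 1) * h1
    - (a.1 ^ 2 + a.2 ^ 2) / 2 * circleMoment a b (j - 1) k * h2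

lemma hermPair_succ' {b : ℝ} (hb : 0 < b) (j k : ℕ) :
    hermPair b (j + 1) k =
      1 / b * k * hermPair b j (k - 1) + -(1 - 1 / b) * j * hermPair b (j - 1) k := by
  have := hermPair_succ hb j k
  field_simp
  linarith

lemma hermPair_zero_succ {b : ℝ} (hb : 0 < b) (k : ℕ) :
    hermPair b 0 (k + 1) = -(1 - 1 / b) * k * hermPair b 0 (k - 1) := by
  rw [hermPair_comm, hermPair_succ' hb, hermPair_comm b (k - 1) 0]
  simp

lemma hermPair_eq_circleMoment {b : ℝ} (hb : 0 < b) {σ : ℂ} (hσ : σ ^ 2 = 1 - 2 / b) (j k : ℕ) :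
    (hermPair b j k : ℂ) = √(2 * π / b) / (2 * π) *
      ((Gamma ((j + k : ℝ) / 2 + 1) : ℂ) *
        circleMoment (Complex.I, Complex.I * σ) (-Complex.I, Complex.I * σ) j k) := by
  have hb' : (b : ℂ) ≠ 0 := by exact_mod_cast hb.ne'
  have hI := Complex.I_sq
  refine eq_of_pair_recursion (K := ℂ) (-(1 - 1 / b)) (1 / b) (fun j k => (hermPair b j k : ℂ))
    (fun j k => √(2 * π / b) / (2 * π) * ((Gamma ((j + k : ℝ) / 2 + 1) : ℂ) *
        circleMoment (Complex.I, Complex.I * σ) (-Complex.I, Complex.I * σ) j k)) ?_ ?_ ?_ ?_ ?_ j k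
  · intro j k
    simp only [hermPair_succ' hb j k]
    push_cast
    ring
  · intro j k
    simp only [gamma_mul_circleMoment_succ]
    have e1 : (Complex.I * -Complex.I + Complex.I * σ * (Complex.I * σ)) / 2 = 1 / b := by
      linear_combination hσ * Complex.I ^ 2 / 2 + hI * (-(1 / b))
    have e2 : (Complex.I ^ 2 + (Complex.I * σ) ^ 2) / 2 = -(1 - 1 / (b : ℂ)) := by
      linear_combination hσ * Complex.I ^ 2 / 2 + hI * (1 - 1 / b)
    rw [e1, e2]
    ring
  · intro k
    simp only [hermPair_zero_succ hb k]
    push_cast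
    ring
  · intro k
    have := gamma_mul_circleMoment_succ (-Complex.I, Complex.I * σ) (Complex.I, Complex.I * σ) k 0
    rw [circleMoment_comm (Complex.I, Complex.I * σ), circleMoment_comm (Complex.I, Complex.I * σ),
      add_comm ((0 : ℕ) : ℝ), add_comm ((0 : ℕ) : ℝ), this]
    have e2 : ((-Complex.I) ^ 2 + (Complex.I * σ) ^ 2) / 2 = -(1 - 1 / (b : ℂ)) := by
      linear_combination hσ * Complex.I ^ 2 / 2 + hI * (1 - 1 / b)
    simp only [e2, Nat.cast_zero]
    ring
  · simp only [hermPair_zero_zero, circleMoment]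
    simp

/-- Diagonal Hermite pairings as integrals over the circle. -/
lemma hermPair_self {b : ℝ} (hb : 0 < b) (j : ℕ) :
    hermPair b j j = √(2 * π / b) / (2 * π) * j.factorial *
      ∫ θ in (0 : ℝ)..(2 * π), (1 - (2 - 2 / b) * sin θ ^ 2) ^ j := by
  obtain ⟨σ, hσ⟩ := IsAlgClosed.exists_pow_nat_eq (1 - 2 / (b : ℂ)) (n := 2) (by norm_num)
  have h := hermPair_eq_circleMoment hb hσ j j
  have e : circleMoment (Complex.I, Complex.I * σ) (-Complex.I, Complex.I * σ) j j
      = ((∫ θ in (0 : ℝ)..(2 * π), (1 - (2 - 2 / b) * sin θ ^ 2) ^ j : ℝ) : ℂ) := by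
    rw [circleMoment, ← intervalIntegral.integral_ofReal]
    congr 1 with θ
    rw [← mul_pow]
    push_cast
    congr 1
    have sq : ((cos θ : ℝ) : ℂ) ^ 2 + ((sin θ : ℝ) : ℂ) ^ 2 = 1 := by
      exact_mod_cast cos_sq_add_sin_sq θ
    push_cast at sq
    linear_combination (-((Complex.cos θ) ^ 2) + σ ^ 2 * Complex.sin θ ^ 2) * Complex.I_sq
      - hσ * Complex.sin θ ^ 2 + sq
  rw [e, show ((j + j : ℝ) / 2 + 1) = (j : ℝ) + 1 by ring, Gamma_nat_eq_factorial] at h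
  have h2 : hermPair b j j = √(2 * π / b) / (2 * π) * (j.factorial *
      ∫ θ in (0 : ℝ)..(2 * π), (1 - (2 - 2 / b) * sin θ ^ 2) ^ j) := by
    exact_mod_cast h
  rw [h2, mul_assoc]

lemma hermPair_two (j k : ℕ) :
    (hermPair 2 j k : ℂ) = Complex.I ^ j * (-Complex.I) ^ k * (Gamma ((j + k + 1 : ℝ) / 2) : ℂ) *
      ((1 + (-1) ^ (j + k)) / 2) := by
  refine eq_of_pair_recursion (K := ℂ) (-(1 / 2)) (1 / 2) (fun j k => (hermPair 2 j k : ℂ))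
    (fun j k => Complex.I ^ j * (-Complex.I) ^ k * (Gamma ((j + k + 1 : ℝ) / 2) : ℂ) *
      ((1 + (-1) ^ (j + k)) / 2)) ?_ ?_ ?_ ?_ ?_ j k
  · intro j k
    simp only [hermPair_succ' two_pos j k]
    push_cast
    ring
  · have hI : Complex.I * Complex.I = -1 := Complex.I_mul_I
    intro j k
    have hG : ∀ x : ℝ, 0 < x → (Gamma (x + 1) : ℂ) = x * (Gamma x : ℂ) := fun x hx => by
      rw [Gamma_add_one hx.ne']; push_cast; ring
    rcases j with _ | j <;> rcases k with _ | k
    · simp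
    · have e := hG ((k + 1 : ℝ) / 2) (by positivity)
      rw [show (((0 + 1 : ℕ) + (k + 1 : ℕ) + 1 : ℝ) / 2) = (k + 1 : ℝ) / 2 + 1 by
        push_cast; ring, e]
      simp only [add_tsub_cancel_right]
      rw [show (((0 : ℕ) + (k : ℕ) + 1 : ℝ) / 2) = (k + 1 : ℝ) / 2 by push_cast; ring]
      push_cast
      ring_nf
      simp
      ring
    · have e := hG ((j + 1 : ℝ) / 2) (by positivity)
      rw [show (((j + 1 + 1 : ℕ) + (0 : ℕ) + 1 : ℝ) / 2) = (j + 1 : ℝ) / 2 + 1 by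
        push_cast; ring, e]
      simp only [add_tsub_cancel_right]
      rw [show (((j : ℕ) + (0 : ℕ) + 1 : ℝ) / 2) = (j + 1 : ℝ) / 2 by push_cast; ring]
      push_cast
      simp only [pow_succ, pow_zero, add_zero]
      linear_combination (Complex.I ^ j * (1 + (-1) ^ j) * (j + 1) / 4 *
        (Gamma ((j + 1 : ℝ) / 2) : ℂ)) * hI
    · have e := hG ((j + k + 2 : ℝ) / 2) (by positivity)
      rw [show (((j + 1 + 1 : ℕ) + (k + 1 : ℕ) + 1 : ℝ) / 2) = (j + k + 2 : ℝ) / 2 + 1 by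
        push_cast; ring, e]
      simp only [add_tsub_cancel_right]
      rw [show (((j : ℕ) + (k + 1 : ℕ) + 1 : ℝ) / 2) = (j + k + 2 : ℝ) / 2 by push_cast; ring,
        show (((j + 1 : ℕ) + (k : ℕ) + 1 : ℝ) / 2) = (j + k + 2 : ℝ) / 2 by push_cast; ring]
      push_cast
      simp only [pow_succ, pow_add]
      linear_combination (-(Complex.I ^ j * (-Complex.I) ^ k * (Gamma ((j + k + 2 : ℝ) / 2) : ℂ) *
        ((1 - (-1) ^ j * (-1) ^ k) / 2) * ((j + k + 2) / 2) * Complex.I)) * hI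
  · intro k
    simp only [hermPair_zero_succ two_pos k]
    push_cast
    ring
  · have hI : Complex.I * Complex.I = -1 := Complex.I_mul_I
    intro k
    rcases k with _ | k
    · simp
    · have hG : (Gamma ((k + 1 : ℝ) / 2 + 1) : ℂ) =
          ((k + 1 : ℝ) / 2 : ℝ) * Gamma ((k + 1 : ℝ) / 2) := by
        rw [Gamma_add_one (by positivity)]; push_cast; ring
      rw [show (((0 : ℕ) + (k + 1 + 1 : ℕ) + 1 : ℝ) / 2) = (k + 1 : ℝ) / 2 + 1 by
        push_cast; ring, hG]
      simp only [add_tsub_cancel_right]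
      rw [show (((0 : ℕ) + (k : ℕ) + 1 : ℝ) / 2) = (k + 1 : ℝ) / 2 by push_cast; ring]
      push_cast
      simp only [pow_succ, pow_zero, zero_add]
      linear_combination ((-Complex.I) ^ k * (1 + (-1) ^ k) * (k + 1) / 4 *
        (Gamma ((k + 1 : ℝ) / 2) : ℂ)) * hI
  · simp only [hermPair_zero_zero, Nat.cast_zero, zero_add, Gamma_one_half_eq]
    norm_num

/-- Compression of multiplication by `exp(-m x² / 2)` to the first `n` even Hermite functions. -/
noncomputable def hermMat (n m : ℕ) : Matrix (Fin n) (Fin n) ℝ :=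
  Matrix.of fun j k => (-1) ^ (j + k : ℕ) * hermPair (m + 1) (2 * j) (2 * k) /
    (√(2 * π) * √((2 * j : ℕ).factorial * (2 * k : ℕ).factorial))

lemma hermMat_zero (n : ℕ) : hermMat n 0 = 1 := by
  ext j k
  simp only [hermMat, Matrix.of_apply, Nat.cast_zero, zero_add, hermPair_one]
  by_cases h : j = k
  · subst h
    have h1 : √(2 * π) ≠ 0 := by positivity
    have h2 : ((2 * (j : ℕ)).factorial : ℝ) ≠ 0 := by positivity
    rw [if_pos rfl, sqrt_mul_self (by positivity), Matrix.one_apply_eq,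
      Even.neg_one_pow ⟨(j : ℕ), rfl⟩]
    field_simp
  · have : ¬ (2 * (j : ℕ) = 2 * (k : ℕ)) := fun h' => h (Fin.ext (by omega))
    rw [if_neg this, Matrix.one_apply_ne h]
    simp

lemma hermPair_two_even (j k : ℕ) :
    hermPair 2 (2 * j) (2 * k) = (-1) ^ (j + k) * Gamma (j + k + 1 / 2 : ℝ) := by
  have h := hermPair_two (2 * j) (2 * k)
  rw [pow_mul, pow_mul, neg_sq, Complex.I_sq, ← mul_add 2 j k, pow_mul (-1 : ℂ) 2, neg_one_sq,
    one_pow] at h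
  have e : (((2 * j : ℕ) + (2 * k : ℕ) + 1 : ℝ) / 2) = (j + k + 1 / 2 : ℝ) := by
    push_cast; ring
  rw [e] at h
  have h' : ((hermPair 2 (2 * j) (2 * k) : ℝ) : ℂ)
      = (((-1) ^ (j + k) * Gamma (j + k + 1 / 2 : ℝ) : ℝ) : ℂ) := by
    rw [h]; push_cast; ring
  exact_mod_cast h'

lemma ginibreM_apply (n : ℕ) (j k : Fin n) :
    ginibreM n j k = Gamma (j + k + 1 / 2 : ℝ) /
      (√(2 * π) * √((2 * j : ℕ).factorial * (2 * k : ℕ).factorial)) := by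
  have h : ∀ j : ℕ, Gamma (2 * ((j : ℕ) + 1 : ℝ) - 1) = ((2 * j : ℕ).factorial : ℝ) := fun j => by
    rw [← Gamma_nat_eq_factorial]; congr 1; push_cast; ring
  simp only [ginibreM, Matrix.of_apply, h]
  rw [show (((j : ℕ) + 1 : ℝ) + ((k : ℕ) + 1 : ℝ) - 3 / 2) = (j + k + 1 / 2 : ℝ) by ring]
  field_simp

lemma hermMat_one (n : ℕ) : hermMat n 1 = ginibreM n := by
  ext j k
  rw [ginibreM_apply, hermMat, Matrix.of_apply, Nat.cast_one, show (1 : ℝ) + 1 = 2 by norm_num,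
    hermPair_two_even, ← mul_assoc, ← mul_pow]
  simp

lemma ginibreM_isHermitian (n : ℕ) : (ginibreM n).IsHermitian := by
  ext j k
  simp only [conjTranspose_apply, star_trivial, ginibreM_apply, add_comm (j : ℝ), mul_comm]

/-- The Hermite expansion with coefficient vector `v`. -/
noncomputable def hermPoly {n : ℕ} (v : Fin n → ℝ) : ℝ[X] :=
  ∑ j, C (v j * (-1) ^ (j : ℕ) / √((2 * j : ℕ).factorial)) * herm (2 * j)

lemma dotProduct_hermMat {n : ℕ} (m : ℕ) (v : Fin n → ℝ) :
    v ⬝ᵥ hermMat n m *ᵥ v = gaussInt (m + 1) (hermPoly v ^ 2) / √(2 * π) := by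
  have hb : (0 : ℝ) < m + 1 := by positivity
  rw [pow_two, hermPoly, Finset.sum_mul_sum, gaussInt_sum hb, Finset.sum_div, dotProduct]
  refine Finset.sum_congr rfl fun j _ => ?_
  rw [gaussInt_sum hb, Finset.sum_div, mulVec, dotProduct, Finset.mul_sum]
  refine Finset.sum_congr rfl fun k _ => ?_
  have : ∀ a b : ℝ, ∀ p q : ℝ[X], C a * p * (C b * q) = C (a * b) * (p * q) := fun a b p q => by
    rw [C_mul]; ring
  rw [this, gaussInt_C_mul, hermMat, Matrix.of_apply, hermPair,
    sqrt_mul (Nat.cast_nonneg (2 * (j : ℕ)).factorial), pow_add]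
  field_simp

/-- Nonnegative polynomials in `exp(-x² / 2)` have nonnegative Gaussian weighted integral. -/
lemma sum_mul_gaussInt_sq_nonneg {ι : Type*} (s : Finset ι) (c : ι → ℝ) (e : ι → ℕ)
    (h : ∀ w : ℝ, 0 ≤ w → w ≤ 1 → 0 ≤ ∑ i ∈ s, c i * w ^ e i) (p : ℝ[X]) :
    0 ≤ ∑ i ∈ s, c i * gaussInt (e i + 1) (p ^ 2) := by
  have : ∑ i ∈ s, c i * gaussInt (e i + 1) (p ^ 2) = ∫ x : ℝ, ∑ i ∈ s,
      c i * ((p ^ 2).eval x * exp (-(e i + 1 : ℝ) / 2 * x ^ 2)) := by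
    rw [integral_finsetSum s fun i _ =>
      (integrable_eval_mul_exp (by positivity) (p ^ 2)).const_mul (c i)]
    refine Finset.sum_congr rfl fun i _ => ?_
    rw [integral_const_mul, gaussInt]
  rw [this]
  refine integral_nonneg fun x => ?_
  have h1 := h (exp (-x ^ 2 / 2)) (exp_pos _).le (by
    rw [exp_le_one_iff]; nlinarith [sq_nonneg x])
  have h2 : ∑ i ∈ s, c i * ((p ^ 2).eval x * exp (-(e i + 1 : ℝ) / 2 * x ^ 2))
      = (p ^ 2).eval x * exp (-x ^ 2 / 2) * ∑ i ∈ s, c i * exp (-x ^ 2 / 2) ^ e i := by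
    rw [Finset.mul_sum]
    refine Finset.sum_congr rfl fun i _ => ?_
    rw [← exp_nat_mul, show (-(e i + 1 : ℝ) / 2 * x ^ 2) = -x ^ 2 / 2 + e i * (-x ^ 2 / 2) by ring,
      exp_add]
    ring
  simp only [h2, Pi.zero_apply]
  have : 0 ≤ (p ^ 2).eval x := by rw [eval_pow]; positivity
  positivity

lemma sum_mul_dotProduct_hermMat_nonneg {ι : Type*} (s : Finset ι) (c : ι → ℝ) (e : ι → ℕ)
    (h : ∀ w : ℝ, 0 ≤ w → w ≤ 1 → 0 ≤ ∑ i ∈ s, c i * w ^ e i) {n : ℕ} (v : Fin n → ℝ) :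
    0 ≤ ∑ i ∈ s, c i * (v ⬝ᵥ hermMat n (e i) *ᵥ v) := by
  simp only [dotProduct_hermMat, ← mul_div_assoc, ← Finset.sum_div]
  exact div_nonneg (sum_mul_gaussInt_sq_nonneg s c e h _) (sqrt_nonneg _)

lemma pow_taylor_bounds {w l : ℝ} (hw : 0 ≤ w) (hw1 : w ≤ 1) (hl : 0 ≤ l) (hl1 : l ≤ 1) (m : ℕ) :
    0 ≤ w ^ m - l ^ m - m * l ^ (m - 1) * (w - l) ∧
      w ^ m - l ^ m - m * l ^ (m - 1) * (w - l) ≤ m ^ 2 * (w - l) ^ 2 := by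
  induction m with
  | zero => simp
  | succ m ih =>
    have e : w ^ (m + 1) - l ^ (m + 1) - (m + 1 : ℕ) * l ^ (m + 1 - 1) * (w - l)
        = w * (w ^ m - l ^ m - m * l ^ (m - 1) * (w - l)) + m * l ^ (m - 1) * (w - l) ^ 2 := by
      rcases m with _ | m
      · simp
      · simp only [add_tsub_cancel_right]; push_cast; ring
    rw [e]
    have h1 : 0 ≤ m * l ^ (m - 1) * (w - l) ^ 2 := by positivity
    have h2 : m * l ^ (m - 1) * (w - l) ^ 2 ≤ m * (w - l) ^ 2 := by
      have : l ^ (m - 1) ≤ 1 := pow_le_one₀ hl hl1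
      have : m * l ^ (m - 1) ≤ m := mul_le_of_le_one_right (by positivity) this
      exact mul_le_mul_of_nonneg_right this (sq_nonneg _)
    have h3 := mul_nonneg hw ih.1
    have h4 := mul_le_mul_of_nonneg_right hw1 ih.1
    refine ⟨by linarith, ?_⟩
    have : 0 ≤ (m + 1 : ℝ) * (w - l) ^ 2 := by positivity
    push_cast
    nlinarith [ih.2]

section Spectrum

/-- The eigenvalues of `ginibreM n`. -/
noncomputable def eig (n : ℕ) : Fin n → ℝ := (ginibreM_isHermitian n).eigenvalues

/-- The orthonormal eigenvectors of `ginibreM n`. -/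
noncomputable def eigVec (n : ℕ) (i : Fin n) : Fin n → ℝ :=
  ⇑((ginibreM_isHermitian n).eigenvectorBasis i)

lemma ginibreM_mulVec_eigVec (n : ℕ) (i : Fin n) :
    ginibreM n *ᵥ eigVec n i = eig n i • eigVec n i :=
  (ginibreM_isHermitian n).mulVec_eigenvectorBasis i

lemma sum_dotProduct_eigVec (n : ℕ) (A : Matrix (Fin n) (Fin n) ℝ) :
    ∑ i, eigVec n i ⬝ᵥ A *ᵥ eigVec n i = A.trace := by
  set U := (ginibreM_isHermitian n).eigenvectorUnitary
  have h : (star (U : Matrix (Fin n) (Fin n) ℝ) * A * U).trace = A.trace := by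
    have hU : (U : Matrix (Fin n) (Fin n) ℝ) * star (U : Matrix (Fin n) (Fin n) ℝ) = 1 :=
      Unitary.coe_mul_star_self U
    rw [trace_mul_cycle, hU, one_mul]
  rw [← h, trace]
  refine Finset.sum_congr rfl fun i _ => ?_
  rw [diag_apply, mul_assoc, mul_apply, dotProduct]
  rfl

lemma eigVec_dotProduct_self (n : ℕ) (i : Fin n) : eigVec n i ⬝ᵥ eigVec n i = 1 := by
  have h := (ginibreM_isHermitian n).eigenvectorBasis.orthonormal.1 i
  have h2 := EuclideanSpace.real_norm_sq_eq ((ginibreM_isHermitian n).eigenvectorBasis i)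
  rw [h, one_pow] at h2
  rw [h2, dotProduct]
  exact Finset.sum_congr rfl fun j _ => (sq _).symm

lemma dotProduct_hermMat_zero_eigVec (n : ℕ) (i : Fin n) :
    eigVec n i ⬝ᵥ hermMat n 0 *ᵥ eigVec n i = 1 := by
  rw [hermMat_zero, one_mulVec, eigVec_dotProduct_self]

lemma dotProduct_hermMat_one_eigVec (n : ℕ) (i : Fin n) :
    eigVec n i ⬝ᵥ hermMat n 1 *ᵥ eigVec n i = eig n i := by
  rw [hermMat_one, ginibreM_mulVec_eigVec, dotProduct_smul, eigVec_dotProduct_self]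
  simp

lemma eig_nonneg (n : ℕ) (i : Fin n) : 0 ≤ eig n i := by
  have := sum_mul_dotProduct_hermMat_nonneg (Finset.univ : Finset (Fin 1)) ![1] ![1]
    (fun w h0 h1 => by simpa using h0) (eigVec n i)
  simpa [dotProduct_hermMat_one_eigVec] using this

lemma eig_le_one (n : ℕ) (i : Fin n) : eig n i ≤ 1 := by
  have := sum_mul_dotProduct_hermMat_nonneg (Finset.univ : Finset (Fin 2)) ![1, -1] ![0, 1]
    (fun w h0 h1 => by simpa using h1) (eigVec n i)
  simpa [Fin.sum_univ_two, dotProduct_hermMat_one_eigVec, dotProduct_hermMat_zero_eigVec] using this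

lemma eig_pow_le (n m : ℕ) (i : Fin n) :
    eig n i ^ m ≤ eigVec n i ⬝ᵥ hermMat n m *ᵥ eigVec n i := by
  set l := eig n i with hl
  have := sum_mul_dotProduct_hermMat_nonneg (Finset.univ : Finset (Fin 3))
    ![1, -(m * l ^ (m - 1)), m * l ^ (m - 1) * l - l ^ m] ![m, 1, 0]
    (fun w h0 h1 => by
      have := (pow_taylor_bounds h0 h1 (eig_nonneg n i) (eig_le_one n i) m).1
      simp [Fin.sum_univ_three]
      linarith) (eigVec n i)
  simp [Fin.sum_univ_three, dotProduct_hermMat_one_eigVec, dotProduct_hermMat_zero_eigVec] at this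
  linarith

lemma dotProduct_hermMat_eigVec_le (n m : ℕ) (i : Fin n) :
    eigVec n i ⬝ᵥ hermMat n m *ᵥ eigVec n i ≤
      eig n i ^ m + m ^ 2 * (eigVec n i ⬝ᵥ hermMat n 2 *ᵥ eigVec n i - eig n i ^ 2) := by
  set l := eig n i with hl
  have := sum_mul_dotProduct_hermMat_nonneg (Finset.univ : Finset (Fin 4))
    ![-1, m * l ^ (m - 1) - 2 * m ^ 2 * l, l ^ m - m * l ^ (m - 1) * l + m ^ 2 * l ^ 2, (m : ℝ) ^ 2]
    ![m, 1, 0, 2]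
    (fun w h0 h1 => by
      have := (pow_taylor_bounds h0 h1 (eig_nonneg n i) (eig_le_one n i) m).2
      simp [Fin.sum_univ_four]
      linarith) (eigVec n i)
  simp [Fin.sum_univ_four, dotProduct_hermMat_one_eigVec, dotProduct_hermMat_zero_eigVec] at this
  linarith

lemma sum_eig_pow_le (n m : ℕ) : ∑ i, eig n i ^ m ≤ (hermMat n m).trace := by
  rw [← sum_dotProduct_eigVec]
  exact Finset.sum_le_sum fun i _ => eig_pow_le n m i

lemma trace_hermMat_le (n m : ℕ) : (hermMat n m).trace ≤
    ∑ i, eig n i ^ m + m ^ 2 * ((hermMat n 2).trace - ∑ i, eig n i ^ 2) := by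
  rw [← sum_dotProduct_eigVec, ← sum_dotProduct_eigVec, ← Finset.sum_sub_distrib, Finset.mul_sum,
    ← Finset.sum_add_distrib]
  exact Finset.sum_le_sum fun i _ => dotProduct_hermMat_eigVec_le n m i

lemma sum_eig_sq (n : ℕ) : ∑ i, eig n i ^ 2 = ∑ j, ∑ k, ginibreM n j k ^ 2 := by
  have h := sum_dotProduct_eigVec n (ginibreM n * ginibreM n)
  have h1 : ∀ i, eigVec n i ⬝ᵥ (ginibreM n * ginibreM n) *ᵥ eigVec n i = eig n i ^ 2 := fun i => by
    rw [← mulVec_mulVec, ginibreM_mulVec_eigVec, mulVec_smul, ginibreM_mulVec_eigVec,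
      dotProduct_smul, dotProduct_smul, eigVec_dotProduct_self]
    simp [sq]
  simp only [h1] at h
  rw [h, trace]
  refine Finset.sum_congr rfl fun j _ => ?_
  rw [diag_apply, mul_apply]
  refine Finset.sum_congr rfl fun k _ => ?_
  rw [sq, ← (ginibreM_isHermitian n).apply k j]
  simp

lemma det_one_add_smul_ginibreM (n : ℕ) :
    Matrix.det ((1 : Matrix (Fin n) (Fin n) ℝ[X]) + (X - 1 : ℝ[X]) • (ginibreM n).map C) =
      ∏ i, (1 + (X - 1) * C (eig n i)) := by
  refine Polynomial.funext fun z => ?_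
  have h0 : Polynomial.eval z (Matrix.det ((1 : Matrix (Fin n) (Fin n) ℝ[X]) +
      (X - 1 : ℝ[X]) • (ginibreM n).map C)) = Matrix.det (1 + (z - 1) • ginibreM n) := by
    rw [← coe_evalRingHom, RingHom.map_det]
    congr 1
    ext j k
    by_cases h : j = k
    · subst h; simp
    · simp [h]
  rw [h0, eval_prod]
  set U := (ginibreM_isHermitian n).eigenvectorUnitary
  have hs : ginibreM n = U * diagonal (eig n) * star (U : Matrix (Fin n) (Fin n) ℝ) := by
    have := (ginibreM_isHermitian n).spectral_theorem
    rw [Unitary.conjStarAlgAut_apply] at this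
    exact this
  have hU : (U : Matrix (Fin n) (Fin n) ℝ) * star (U : Matrix (Fin n) (Fin n) ℝ) = 1 :=
    Unitary.coe_mul_star_self U
  have h1 : 1 + (z - 1) • ginibreM n
      = U * diagonal (fun i => 1 + (z - 1) * eig n i) * star (U : Matrix (Fin n) (Fin n) ℝ) := by
    have : diagonal (fun i => 1 + (z - 1) * eig n i) = 1 + (z - 1) • diagonal (eig n) := by
      ext j k
      by_cases h : j = k
      · subst h; simp
      · simp [h]
    rw [this, mul_add, add_mul, mul_one, hU, Matrix.mul_smul, Matrix.smul_mul, ← hs]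
  rw [h1, det_mul_right_comm, hU, one_mul, det_diagonal]
  simp

end Spectrum

lemma integral_sin_sq_eq {f : ℝ → ℝ} (hf : Continuous f) :
    ∫ θ in (0 : ℝ)..(2 * π), f (sin θ ^ 2) = 2 * ∫ θ in (-(π / 2))..(π / 2), f (sin θ ^ 2) := by
  have hp : Function.Periodic (fun θ => f (sin θ ^ 2)) π := fun θ => by simp
  have hi : ∀ a b, IntervalIntegrable (fun θ => f (sin θ ^ 2)) volume a b :=
    fun a b => Continuous.intervalIntegrable (by fun_prop) a b
  rw [← intervalIntegral.integral_add_adjacent_intervals (hi 0 π) (hi π (2 * π))]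
  have h1 := hp.intervalIntegral_add_eq 0 (-(π / 2))
  have h2 := hp.intervalIntegral_add_eq π (-(π / 2))
  rw [show -(π / 2) + π = π / 2 by ring] at h1 h2
  rw [zero_add] at h1
  rw [← two_mul] at h2
  rw [h1, h2]; ring

lemma integral_cos_sq_eq (f : ℝ → ℝ) :
    ∫ θ in (0 : ℝ)..(2 * π), f (cos θ ^ 2) = ∫ θ in (0 : ℝ)..(2 * π), f (sin θ ^ 2) := by
  have hp : Function.Periodic (fun θ => f (sin θ ^ 2)) (2 * π) := fun θ => by simp
  have h := hp.intervalIntegral_add_eq 0 (π / 2)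
  rw [zero_add] at h
  rw [h, ← zero_add (π / 2), add_right_comm, ← intervalIntegral.integral_comp_add_right]
  simp [sin_add_pi_div_two]

lemma sq_le_sin_sq {x : ℝ} (h : |x| ≤ π / 2) : 4 / π ^ 2 * x ^ 2 ≤ sin x ^ 2 := by
  have := mul_abs_le_abs_sin h
  have h2 := pow_le_pow_left₀ (by positivity) this 2
  rw [sq_abs, mul_pow, sq_abs, div_pow] at h2
  norm_num at h2 ⊢
  exact h2

lemma integral_exp_sin_sq_le {a : ℝ} (ha : 0 < a) :
    ∫ θ in (0 : ℝ)..(2 * π), exp (-a * sin θ ^ 2) ≤ π ^ 2 / √a := by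
  rw [integral_sin_sq_eq (f := fun y => exp (-a * y)) (by fun_prop)]
  have hb : 0 < a * (4 / π ^ 2) := by positivity
  have h1 : ∫ θ in (-(π / 2))..(π / 2), exp (-a * sin θ ^ 2) ≤
      ∫ θ in (-(π / 2))..(π / 2), exp (-(a * (4 / π ^ 2)) * θ ^ 2) := by
    refine intervalIntegral.integral_mono_on (by linarith [pi_pos])
      (Continuous.intervalIntegrable (by fun_prop) _ _)
      (Continuous.intervalIntegrable (by fun_prop) _ _) fun x hx => exp_le_exp.2 ?_
    have := sq_le_sin_sq (abs_le.2 hx)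
    nlinarith
  have h2 : ∫ θ in (-(π / 2))..(π / 2), exp (-(a * (4 / π ^ 2)) * θ ^ 2) ≤
      √(π / (a * (4 / π ^ 2))) := by
    rw [← integral_gaussian, intervalIntegral.integral_of_le (by linarith [pi_pos])]
    exact setIntegral_le_integral (integrable_exp_neg_mul_sq hb)
      (Eventually.of_forall fun x => (exp_pos _).le)
  have h3 : √(π / (a * (4 / π ^ 2))) ≤ π ^ 2 / (2 * √a) := by
    rw [show π / (a * (4 / π ^ 2)) = π ^ 3 / (4 * a) by field_simp]
    refine sqrt_le_iff.2 ⟨by positivity, ?_⟩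
    rw [div_pow, mul_pow, sq_sqrt ha.le]
    norm_num
    gcongr
    rw [← pow_mul]
    exact pow_le_pow_right₀ (by linarith [pi_gt_three]) (by norm_num)
  calc _ ≤ 2 * (π ^ 2 / (2 * √a)) := by linarith
    _ = _ := by field_simp

lemma integral_pow_sin_sq_le {q : ℝ} (h1 : 1 ≤ q) (h2 : q ≤ 2) (j : ℕ) :
    ∫ θ in (0 : ℝ)..(2 * π), (1 - q * sin θ ^ 2) ^ (2 * j) ≤ 4 * exp 2 * π ^ 2 / √(j + 1) := by
  have hj : (0 : ℝ) < 2 * (j + 1) := by positivity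
  have key : ∀ θ : ℝ, (1 - q * sin θ ^ 2) ^ (2 * j) ≤
      exp 2 * (exp (-(2 * (j + 1)) * sin θ ^ 2) + exp (-(2 * (j + 1)) * cos θ ^ 2)) := fun θ => by
    have hs := sin_sq_add_cos_sq θ
    set y := sin θ ^ 2
    set z := cos θ ^ 2
    have hy : 0 ≤ y := sq_nonneg _
    have hz : 0 ≤ z := sq_nonneg _
    have aux : ∀ u t : ℝ, 0 ≤ t → t ≤ 1 → |u| ≤ 1 - t →
        u ^ (2 * j) ≤ exp 2 * exp (-(2 * (j + 1)) * t) := fun u t ht ht1 hu => by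
      rw [← (even_two_mul j).pow_abs]
      have h3 : |u| ≤ exp (-t) := hu.trans (by linarith [add_one_le_exp (-t)])
      refine (pow_le_pow_left₀ (abs_nonneg _) h3 _).trans ?_
      rw [← exp_nat_mul, ← exp_add]
      refine exp_le_exp.2 ?_
      push_cast
      nlinarith
    rw [mul_add]
    have p1 := mul_pos (exp_pos 2) (exp_pos (-(2 * (j + 1)) * y))
    have p2 := mul_pos (exp_pos 2) (exp_pos (-(2 * (j + 1)) * z))
    rcases le_total 0 (1 - q * y) with h | h
    · have := aux (1 - q * y) y hy (by linarith) (by rw [abs_of_nonneg h]; nlinarith)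
      linarith
    · have := aux (1 - q * y) z hz (by linarith) (by rw [abs_of_nonpos h]; nlinarith)
      linarith
  have hI := integral_exp_sin_sq_le hj
  have hc := integral_cos_sq_eq fun y => exp (-(2 * (j + 1)) * y)
  calc _ ≤ ∫ θ in (0 : ℝ)..(2 * π),
        exp 2 * (exp (-(2 * (j + 1)) * sin θ ^ 2) + exp (-(2 * (j + 1)) * cos θ ^ 2)) :=
      intervalIntegral.integral_mono_on (by positivity)
        (Continuous.intervalIntegrable (by fun_prop) _ _)
        (Continuous.intervalIntegrable (by fun_prop) _ _) fun θ _ => key θ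
    _ = exp 2 * (2 * ∫ θ in (0 : ℝ)..(2 * π), exp (-(2 * (j + 1)) * sin θ ^ 2)) := by
      rw [intervalIntegral.integral_const_mul, intervalIntegral.integral_add
        (Continuous.intervalIntegrable (by fun_prop) _ _)
        (Continuous.intervalIntegrable (by fun_prop) _ _), hc]
      ring
    _ ≤ exp 2 * (2 * (π ^ 2 / √(2 * (j + 1)))) := by gcongr
    _ ≤ exp 2 * (2 * (π ^ 2 / √(j + 1))) := by
      gcongr
      linarith
    _ ≤ _ := by
      have : 0 ≤ exp 2 * π ^ 2 / √(j + 1) := by positivity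
      calc _ = 2 * (exp 2 * π ^ 2 / √(j + 1)) := by ring
        _ ≤ 4 * (exp 2 * π ^ 2 / √(j + 1)) := by linarith
        _ = _ := by ring

/-- Laplace asymptotics of the circular integrals, from the two maxima `θ = 0, π`. -/
lemma tendsto_sqrt_mul_integral_pow_sin_sq {q : ℝ} (h1 : 1 ≤ q) (h2 : q < 2) :
    Tendsto (fun N : ℕ => √N * ∫ θ in (0 : ℝ)..(2 * π), (1 - q * sin θ ^ 2) ^ N) atTop
      (𝓝 (2 * √(π / q))) := by
  have hpi := pi_pos
  set F : ℕ → ℝ → ℝ := fun N => Set.indicator (Set.Ioc (-(π / 2) * √N) (π / 2 * √N))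
    fun x => (1 - q * sin (x / √N) ^ 2) ^ N with hF
  have hFi : ∀ N : ℕ, N ≠ 0 →
      √N * ∫ θ in (0 : ℝ)..(2 * π), (1 - q * sin θ ^ 2) ^ N = 2 * ∫ x, F N x := fun N hN => by
    have hN' : 0 < √(N : ℝ) := sqrt_pos.2 (by positivity)
    rw [integral_sin_sq_eq (f := fun y => (1 - q * y) ^ N) (by fun_prop), hF]
    simp only
    rw [integral_indicator measurableSet_Ioc, ← intervalIntegral.integral_of_le (by nlinarith),
      intervalIntegral.integral_comp_div (fun θ => (1 - q * sin θ ^ 2) ^ N) hN'.ne']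
    rw [mul_div_cancel_right₀ _ hN'.ne', mul_div_cancel_right₀ _ hN'.ne', smul_eq_mul]
    ring
  have hlim : Tendsto (fun N => ∫ x, F N x) atTop (𝓝 (∫ x : ℝ, exp (-q * x ^ 2))) := by
    refine tendsto_integral_of_dominated_convergence
      (fun x => exp (-((2 - q) * (4 / π ^ 2)) * x ^ 2)) (fun N => ?_) ?_ (fun N => ?_) ?_
    · exact (Continuous.measurable (by fun_prop)).aestronglyMeasurable.indicator measurableSet_Ioc
    · exact integrable_exp_neg_mul_sq (mul_pos (by linarith) (by positivity))
    · refine Eventually.of_forall fun x => ?_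
      by_cases hx : x ∈ Set.Ioc (-(π / 2) * √N) (π / 2 * √N)
      · have hN : 0 < √(N : ℝ) := by
          by_contra h
          have h0 : √(N : ℝ) = 0 := le_antisymm (not_lt.1 h) (sqrt_nonneg _)
          rw [h0] at hx
          obtain ⟨ha, hb⟩ := hx
          linarith
        have hxx : |x / √N| ≤ π / 2 := by
          rw [abs_le, le_div_iff₀ hN, div_le_iff₀ hN]
          exact ⟨by linarith [hx.1], hx.2⟩
        have hsin := sq_le_sin_sq hxx
        simp only [hF]
        rw [Set.indicator_of_mem hx, norm_pow, Real.norm_eq_abs]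
        set y := sin (x / √N) ^ 2
        have hy0 : 0 ≤ y := sq_nonneg _
        have hy1 : y ≤ 1 := sin_sq_le_one _
        have hb : |1 - q * y| ≤ exp (-((2 - q) * y)) := by
          have := add_one_le_exp (-((2 - q) * y))
          rw [abs_le]
          constructor <;> nlinarith
        refine (pow_le_pow_left₀ (abs_nonneg _) hb N).trans ?_
        rw [← exp_nat_mul]
        refine exp_le_exp.2 ?_
        have hN2 : √(N : ℝ) ^ 2 = N := sq_sqrt (Nat.cast_nonneg N)
        have : 4 / π ^ 2 * x ^ 2 ≤ N * y := by
          rw [div_pow, hN2] at hsin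
          have hN3 : (0 : ℝ) < N := by rw [← hN2]; positivity
          calc _ = N * (4 / π ^ 2 * (x ^ 2 / N)) := by field_simp
            _ ≤ _ := by gcongr
        nlinarith
      · simp only [hF]
        rw [Set.indicator_of_notMem hx, norm_zero]
        exact (exp_pos _).le
    · refine Eventually.of_forall fun x => ?_
      have hsq : Tendsto (fun N : ℕ => √(N : ℝ)) atTop atTop :=
        tendsto_sqrt_atTop.comp tendsto_natCast_atTop_atTop
      have hev : ∀ᶠ N : ℕ in atTop, (1 + -(q * sin (x / √N) ^ 2)) ^ N = F N x := by
        have : ∀ᶠ N : ℕ in atTop, |x| < π / 2 * √(N : ℝ) :=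
          (hsq.const_mul_atTop (by positivity : 0 < π / 2)).eventually_gt_atTop _
        filter_upwards [this] with N hN
        rw [abs_lt] at hN
        have hx : x ∈ Set.Ioc (-(π / 2) * √N) (π / 2 * √N) := ⟨by linarith [hN.1], hN.2.le⟩
        simp only [hF]
        rw [Set.indicator_of_mem hx, sub_eq_add_neg]
      refine Tendsto.congr' hev (tendsto_one_add_pow_exp_of_tendsto ?_)
      have h0 : Tendsto (fun N : ℕ => sinc (x / √N)) atTop (𝓝 1) := by
        have := (continuous_sinc.tendsto 0).comp (hsq.const_div_atTop x)
        rwa [sinc_zero] at this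
      have := (h0.pow 2).const_mul (-q * x ^ 2)
      rw [one_pow, mul_one] at this
      refine this.congr' ?_
      filter_upwards [eventually_gt_atTop 0] with N hN
      have hN' : 0 < √(N : ℝ) := sqrt_pos.2 (by positivity)
      by_cases hx : x = 0
      · simp [hx]
      · rw [sinc_of_ne_zero (by positivity)]
        have hN2 : √(N : ℝ) ^ 2 = N := sq_sqrt (Nat.cast_nonneg N)
        rw [div_pow, div_pow, hN2]
        field_simp
  rw [integral_gaussian] at hlim
  refine (hlim.const_mul 2).congr' ?_
  filter_upwards [eventually_ne_atTop 0] with N hN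
  rw [hFi N hN]

lemma sqrt_succ_sub_sqrt (j : ℕ) : √(j + 1 : ℝ) - √j = 1 / (√(j + 1 : ℝ) + √j) := by
  have h1 : 0 < √(j + 1 : ℝ) := by positivity
  have h2 := sqrt_nonneg (j : ℝ)
  rw [eq_div_iff (by positivity)]
  have h3 : √(j + 1 : ℝ) ^ 2 = j + 1 := sq_sqrt (by positivity)
  have h4 : √(j : ℝ) ^ 2 = j := sq_sqrt (by positivity)
  linear_combination h3 - h4

lemma sum_sqrt_succ_sub_sqrt (n : ℕ) : ∑ j ∈ Finset.range n, (√(j + 1 : ℝ) - √j) = √n := by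
  have := Finset.sum_range_sub (fun j : ℕ => √(j : ℝ)) n
  simpa using this

lemma tendsto_sqrt_mul_sqrt_succ_sub_sqrt :
    Tendsto (fun j : ℕ => √(j : ℝ) * (√(j + 1 : ℝ) - √j)) atTop (𝓝 (1 / 2)) := by
  have h : Tendsto (fun j : ℕ => 1 / (√(1 + 1 / (j : ℝ)) + 1)) atTop (𝓝 (1 / 2)) := by
    have h1 : Tendsto (fun j : ℕ => √(1 + 1 / (j : ℝ))) atTop (𝓝 1) := by
      have := (tendsto_one_div_atTop_nhds_zero_nat (𝕜 := ℝ)).const_add 1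
      simpa [Function.comp_def] using (continuous_sqrt.tendsto _).comp this
    have := (h1.add_const 1).inv₀ (by norm_num)
    simpa [one_add_one_eq_two] using this
  refine h.congr' ?_
  filter_upwards [eventually_gt_atTop 0] with j hj
  have hj' : (0 : ℝ) < j := by positivity
  have h1 : 0 < √(j : ℝ) := sqrt_pos.2 hj'
  rw [sqrt_succ_sub_sqrt, show (j + 1 : ℝ) = j * (1 + 1 / j) by field_simp, sqrt_mul hj'.le]
  have : 0 ≤ √(1 + 1 / (j : ℝ)) := sqrt_nonneg _
  field_simp

/-- If `√j * a j` converges then so do the partial sums of `a` divided by `√n`. -/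
lemma tendsto_sum_div_sqrt {a : ℕ → ℝ} {c : ℝ}
    (ha : Tendsto (fun j : ℕ => √(j : ℝ) * a j) atTop (𝓝 c)) :
    Tendsto (fun n : ℕ => (∑ j ∈ Finset.range n, a j) / √n) atTop (𝓝 (2 * c)) := by
  set g : ℕ → ℝ := fun j => √(j + 1 : ℝ) - √j with hg
  have hgpos : ∀ j, 0 < g j := fun j => by
    rw [hg]; simp only; rw [sqrt_succ_sub_sqrt]; positivity
  have hsum : ∀ n, ∑ j ∈ Finset.range n, g j = √n := sum_sqrt_succ_sub_sqrt
  have hlim := tendsto_sqrt_mul_sqrt_succ_sub_sqrt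
  have ho : (fun j => a j - 2 * c * g j) =o[atTop] g := by
    rw [Asymptotics.isLittleO_iff_tendsto fun j h => absurd h (hgpos j).ne']
    have := (ha.div hlim (by norm_num)).sub_const (2 * c)
    rw [show c / (1 / 2) - 2 * c = 0 by ring] at this
    refine this.congr' ?_
    filter_upwards [eventually_gt_atTop 0] with j hj
    have hj' : √(j : ℝ) ≠ 0 := (sqrt_pos.2 (by positivity)).ne'
    have := (hgpos j).ne'
    simp only [Pi.div_apply]
    rw [show √(j + 1 : ℝ) - √j = g j from rfl]
    field_simp
  have h := ho.sum_range (fun j => (hgpos j).le) (by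
    simp only [hsum]
    exact tendsto_sqrt_atTop.comp tendsto_natCast_atTop_atTop)
  simp only [hsum] at h
  have h2 := h.tendsto_div_nhds_zero.add_const (2 * c)
  rw [zero_add] at h2
  refine h2.congr' ?_
  filter_upwards [eventually_gt_atTop 0] with n hn
  have hn' : √(n : ℝ) ≠ 0 := (sqrt_pos.2 (by positivity)).ne'
  rw [Finset.sum_sub_distrib, ← Finset.mul_sum, hsum]
  field_simp
  ring

lemma hermMat_diag (n m : ℕ) (j : Fin n) : hermMat n m j j =
    1 / (2 * π * √(m + 1)) *
      ∫ θ in (0 : ℝ)..(2 * π), (1 - (2 - 2 / (m + 1)) * sin θ ^ 2) ^ (2 * (j : ℕ)) := by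
  have hm : (0 : ℝ) < m + 1 := by positivity
  rw [hermMat, Matrix.of_apply, hermPair_self hm, Even.neg_one_pow ⟨(j : ℕ), rfl⟩,
    sqrt_mul_self (by positivity), sqrt_div (by positivity)]
  have h1 : √(2 * π) ≠ 0 := by positivity
  have h2 : ((2 * (j : ℕ)).factorial : ℝ) ≠ 0 := by positivity
  have h3 : √(m + 1 : ℝ) ≠ 0 := by positivity
  field_simp

lemma trace_hermMat (n m : ℕ) : (hermMat n m).trace = ∑ j ∈ Finset.range n,
    1 / (2 * π * √(m + 1)) *
      ∫ θ in (0 : ℝ)..(2 * π), (1 - (2 - 2 / (m + 1)) * sin θ ^ 2) ^ (2 * j) := by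
  rw [Finset.sum_range, trace]
  exact Finset.sum_congr rfl fun j _ => by rw [diag_apply, hermMat_diag]

lemma one_le_two_sub {m : ℕ} (hm : 1 ≤ m) : (1 : ℝ) ≤ 2 - 2 / (m + 1) := by
  have hm' : (1 : ℝ) ≤ m := by exact_mod_cast hm
  have : 2 / (m + 1 : ℝ) ≤ 1 := by rw [div_le_one (by positivity)]; linarith
  linarith

lemma two_sub_lt (m : ℕ) : (2 : ℝ) - 2 / (m + 1) < 2 := by
  have : 0 < 2 / (m + 1 : ℝ) := by positivity
  linarith

lemma trace_hermMat_le_sqrt {m : ℕ} (hm : 1 ≤ m) (n : ℕ) :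
    (hermMat n m).trace ≤ 4 * exp 2 * π * √n / √m := by
  rw [trace_hermMat, ← sum_sqrt_succ_sub_sqrt n, Finset.mul_sum, Finset.sum_div]
  refine Finset.sum_le_sum fun j _ => ?_
  have hI := integral_pow_sin_sq_le (one_le_two_sub hm) (two_sub_lt m).le j
  have hm' : 0 < √(m : ℝ) := sqrt_pos.2 (by positivity)
  have h1 : 1 / (2 * √(j + 1 : ℝ)) ≤ √(j + 1 : ℝ) - √j := by
    rw [sqrt_succ_sub_sqrt, two_mul]
    gcongr
    linarith
  calc _ ≤ 1 / (2 * π * √(m + 1)) * (4 * exp 2 * π ^ 2 / √(j + 1)) := by gcongr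
    _ ≤ 1 / (2 * π * √m) * (4 * exp 2 * π ^ 2 / √(j + 1)) := by
      gcongr
      linarith
    _ = 4 * exp 2 * π * (1 / (2 * √(j + 1 : ℝ))) / √m := by field_simp
    _ ≤ _ := by gcongr

lemma tendsto_trace_hermMat {m : ℕ} (hm : 1 ≤ m) :
    Tendsto (fun n : ℕ => (hermMat n m).trace / √n) atTop (𝓝 (1 / √(π * m))) := by
  have hm0 : (0 : ℝ) < m := by positivity
  have h2 : Tendsto (fun j : ℕ => 2 * j) atTop atTop := tendsto_id.const_mul_atTop' two_pos
  have h := (tendsto_sqrt_mul_integral_pow_sin_sq (one_le_two_sub hm) (two_sub_lt m)).comp h2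
  have h' := h.const_mul (1 / √2 * (1 / (2 * π * √(m + 1))))
  have key := tendsto_sum_div_sqrt (a := fun j : ℕ => 1 / (2 * π * √(m + 1)) *
      ∫ θ in (0 : ℝ)..(2 * π), (1 - (2 - 2 / (m + 1)) * sin θ ^ 2) ^ (2 * j)) (h'.congr fun j => by
    simp only [Function.comp_apply]
    push_cast
    rw [sqrt_mul zero_le_two]
    field_simp)
  simp only [trace_hermMat]
  convert key using 2
  rw [show (2 : ℝ) - 2 / (m + 1) = 2 * m / (m + 1) by field_simp; ring,
    show π / (2 * m / (m + 1)) = π * (m + 1) / (2 * m) by field_simp, sqrt_div (by positivity),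
    sqrt_mul pi_pos.le, sqrt_mul zero_le_two, sqrt_mul pi_pos.le]
  have h3 : √2 * √2 = (2 : ℝ) := mul_self_sqrt zero_le_two
  have h4 : √π * √π = π := mul_self_sqrt pi_pos.le
  have h5 : √(m : ℝ) ≠ 0 := by positivity
  have h6 : √(m + 1 : ℝ) ≠ 0 := by positivity
  have h7 : √π ≠ 0 := by positivity
  field_simp
  rw [sq_sqrt zero_le_two, sq_sqrt pi_pos.le]
  ring

lemma sum_range_even {f : ℕ → ℝ} (s : ℕ) :
    ∑ i ∈ Finset.range (2 * s + 1), (1 + (-1) ^ i) / 2 * f i =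
      ∑ j ∈ Finset.range (s + 1), f (2 * j) := by
  induction s with
  | zero => simp
  | succ s ih =>
    rw [show 2 * (s + 1) + 1 = 2 * s + 1 + 1 + 1 by ring, Finset.sum_range_succ,
      Finset.sum_range_succ, ih, Finset.sum_range_succ _ (s + 1)]
    have h1 : (-1 : ℝ) ^ (2 * s + 1) = -1 := Odd.neg_one_pow ⟨s, rfl⟩
    have h2 : (-1 : ℝ) ^ (2 * s + 1 + 1) = 1 := Even.neg_one_pow ⟨s + 1, by ring⟩
    rw [h1, h2, mul_add 2 s 1]
    ring

lemma sum_choose_even {s : ℕ} (hs : s ≠ 0) :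
    ∑ j ∈ Finset.range (s + 1), ((2 * s).choose (2 * j) : ℝ) = 4 ^ s / 2 := by
  rw [← sum_range_even (f := fun i => ((2 * s).choose i : ℝ))]
  have h1 : ∑ i ∈ Finset.range (2 * s + 1), ((2 * s).choose i : ℝ) = 4 ^ s := by
    have := Nat.sum_range_choose (2 * s)
    rw [pow_mul] at this
    exact_mod_cast this
  have h2 : ∑ i ∈ Finset.range (2 * s + 1), (-1 : ℝ) ^ i * ((2 * s).choose i : ℝ) = 0 := by
    have := Int.alternating_sum_range_choose_of_ne (n := 2 * s) (by omega)
    exact_mod_cast this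
  calc _ = ∑ i ∈ Finset.range (2 * s + 1), (((2 * s).choose i : ℝ) / 2
        + (-1 : ℝ) ^ i * ((2 * s).choose i : ℝ) / 2) :=
      Finset.sum_congr rfl fun i _ => by ring
    _ = _ := by
      rw [Finset.sum_add_distrib, ← Finset.sum_div, ← Finset.sum_div, h1, h2]; ring

lemma sum_choose_mul_sq (s : ℕ) :
    ∑ i ∈ Finset.range (2 * s + 1), ((2 * s).choose i : ℝ) * (i - s) ^ 2 = 4 ^ s * (s / 2) := by
  have h := congrArg (Polynomial.eval (1 / 2 : ℝ)) (bernsteinPolynomial.variance ℝ (2 * s))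
  simp only [Polynomial.eval_finsetSum, bernsteinPolynomial, Polynomial.eval_mul,
    Polynomial.eval_pow, Polynomial.eval_sub, Polynomial.eval_X,
    Polynomial.eval_natCast, Polynomial.eval_one, nsmul_eq_mul] at h
  have h2 : (4 : ℝ) ^ s * (s / 2) = 4 ^ s * (((2 * s : ℕ) : ℝ) * (1 / 2) * (1 - 1 / 2)) := by
    push_cast; ring
  rw [h2, ← h, Finset.mul_sum]
  refine Finset.sum_congr rfl fun i hi => ?_
  have hi' : i ≤ 2 * s := by simpa [Nat.lt_succ_iff] using hi
  have h3 : (1 / 2 : ℝ) ^ i * (1 - 1 / 2) ^ (2 * s - i) * 4 ^ s = 1 := by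
    rw [show (1 - 1 / 2 : ℝ) = 1 / 2 by norm_num, ← pow_add, Nat.add_sub_cancel' hi', pow_mul,
      ← mul_pow]
    norm_num
  push_cast
  linear_combination (-((2 * s).choose i : ℝ) * (i - s) ^ 2) * h3

lemma sum_choose_even_mul_sq_le (s : ℕ) :
    ∑ j ∈ Finset.range (s + 1), ((2 * s).choose (2 * j) : ℝ) * (2 * j - s : ℝ) ^ 2 ≤
      4 ^ s * (s / 2 : ℝ) := by
  have h := sum_range_even (f := fun i => ((2 * s).choose i : ℝ) * (i - s) ^ 2) s
  push_cast at h
  rw [← h, ← sum_choose_mul_sq]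
  refine Finset.sum_le_sum fun i _ => mul_le_of_le_one_left (by positivity) ?_
  rcases neg_one_pow_eq_or ℝ i with h | h <;> rw [h] <;> norm_num

/-- The binomial mass of the antidiagonal `j + k = s` in the square `j, k < n`. -/
lemma le_sum_choose_fiber {n s : ℕ} (hs : s ≠ 0) (hn : s < 2 * n) :
    4 ^ s * (1 / 2 - s / (2 * (2 * n - s : ℝ) ^ 2)) ≤
      ∑ p ∈ Finset.range n ×ˢ Finset.range n with p.1 + p.2 = s,
        ((2 * s).choose (2 * p.1) : ℝ) := by
  have hd : (0 : ℝ) < 2 * n - s := by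
    have : (s : ℝ) < 2 * n := by exact_mod_cast hn
    linarith
  have h1 : ∑ p ∈ Finset.range n ×ˢ Finset.range n with p.1 + p.2 = s,
        ((2 * s).choose (2 * p.1) : ℝ) =
      ∑ j ∈ Finset.range (s + 1) with j < n ∧ s - j < n, ((2 * s).choose (2 * j) : ℝ) := by
    refine Finset.sum_nbij' (fun p => p.1) (fun j => (j, s - j)) ?_ ?_ ?_ ?_ ?_
    · intro p hp; simp at hp ⊢; omega
    · intro p hp; simp at hp ⊢; omega
    · intro p hp; simp at hp ⊢; ext <;> simp; omega
    · intro p hp; simp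
    · intro p hp; simp
  rw [h1, Finset.sum_filter]
  calc _ ≤ ∑ j ∈ Finset.range (s + 1), ((2 * s).choose (2 * j) : ℝ) -
        (∑ j ∈ Finset.range (s + 1), ((2 * s).choose (2 * j) : ℝ) * (2 * j - s) ^ 2) /
          (2 * n - s : ℝ) ^ 2 := by
        have := div_le_div_of_nonneg_right (sum_choose_even_mul_sq_le s)
          (by positivity : 0 ≤ (2 * n - s : ℝ) ^ 2)
        rw [sum_choose_even hs]
        have e : (4 : ℝ) ^ s * (1 / 2 - s / (2 * (2 * n - s : ℝ) ^ 2))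
          = 4 ^ s / 2 - 4 ^ s * (s / 2) / (2 * n - s : ℝ) ^ 2 := by field_simp
        linarith
    _ ≤ _ := by
      rw [Finset.sum_div, ← Finset.sum_sub_distrib]
      refine Finset.sum_le_sum fun j hj => ?_
      split_ifs with h
      · have : 0 ≤ ((2 * s).choose (2 * j) : ℝ) * (2 * j - s) ^ 2 / (2 * n - s : ℝ) ^ 2 := by
          positivity
        linarith
      · have h3 : (2 * n - s : ℝ) ^ 2 ≤ (2 * j - s) ^ 2 := by
          rw [sq_le_sq, abs_of_pos hd, le_abs]
          have hj' : j ≤ s := by simpa [Nat.lt_succ_iff] using hj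
          by_cases h4 : j < n
          · right
            have : n + j ≤ s := by omega
            have : (n + j : ℝ) ≤ s := by exact_mod_cast this
            linarith
          · left
            have : (n : ℝ) ≤ j := by exact_mod_cast not_lt.1 h4
            linarith
        rw [sub_nonpos, le_div_iff₀ (by positivity)]
        gcongr

/-- The central binomial probabilities `choose (2 s) s / 4 ^ s`. -/
noncomputable def centralProb (s : ℕ) : ℝ := Gamma (s + 1 / 2 : ℝ) / (√π * s.factorial)

lemma centralProb_pos (s : ℕ) : 0 < centralProb s := by
  have := Gamma_pos_of_pos (by positivity : (0 : ℝ) < s + 1 / 2)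
  rw [centralProb]; positivity

lemma Gamma_add_half_mul (s : ℕ) :
    Gamma (s + 1 / 2 : ℝ) * (4 ^ s * s.factorial) = √π * (2 * s).factorial := by
  induction s with
  | zero => simp [← Gamma_one_half_eq]
  | succ s ih =>
    rw [show ((s + 1 : ℕ) + 1 / 2 : ℝ) = (s + 1 / 2) + 1 by push_cast; ring,
      Gamma_add_one (by positivity), show 2 * (s + 1) = 2 * s + 1 + 1 by ring, Nat.factorial_succ,
      Nat.factorial_succ, Nat.factorial_succ]
    push_cast
    linear_combination (2 * s + 1) * (2 * s + 1 + 1) * ih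

lemma ginibreM_apply_sq (n : ℕ) (j k : Fin n) : ginibreM n j k ^ 2 =
    centralProb (j + k) / 2 * ((2 * (j + k : ℕ)).choose (2 * j) / 4 ^ (j + k : ℕ)) := by
  have h := Gamma_add_half_mul (j + k)
  rw [ginibreM_apply, div_pow, mul_pow, sq_sqrt (by positivity), sq_sqrt (by positivity),
    centralProb, Nat.cast_choose ℝ (by omega : 2 * (j : ℕ) ≤ 2 * (j + k)),
    show 2 * ((j : ℕ) + k) - 2 * j = 2 * k by omega]
  push_cast at h ⊢
  generalize Gamma ((j : ℕ) + (k : ℕ) + 1 / 2 : ℝ) = G at h ⊢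
  have h2 : √π * √π = π := mul_self_sqrt pi_pos.le
  have h3 : √π ≠ 0 := by positivity
  have h4 : (((j : ℕ) + k).factorial : ℝ) ≠ 0 := by positivity
  have h5 : ((2 * (j : ℕ)).factorial : ℝ) ≠ 0 := by positivity
  have h6 : ((2 * (k : ℕ)).factorial : ℝ) ≠ 0 := by positivity
  field_simp
  linear_combination √π * G * h + G * (2 * (j + k : ℕ)).factorial * h2

lemma centralProb_eq_integral (s : ℕ) :
    centralProb s = 1 / (2 * π) * ∫ θ in (0 : ℝ)..(2 * π), (1 - 1 * sin θ ^ 2) ^ s := by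
  have h1 := hermPair_self (b := 2) two_pos s
  have h2 := hermPair_two s s
  rw [← mul_pow, ← two_mul, ← two_mul, pow_mul] at h2
  have h3 : hermPair 2 s s = Gamma (s + 1 / 2 : ℝ) := by
    have : ((hermPair 2 s s : ℝ) : ℂ) = (Gamma (s + 1 / 2 : ℝ) : ℝ) := by
      rw [h2]
      simp
      congr 1; ring
    exact_mod_cast this
  rw [centralProb, ← h3, h1, mul_div_cancel_left₀ _ two_ne_zero]
  norm_num
  have h3 : √π ≠ 0 := by positivity
  field_simp

lemma tendsto_sqrt_mul_centralProb :
    Tendsto (fun s : ℕ => √s * centralProb s) atTop (𝓝 (1 / √π)) := by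
  have h := (tendsto_sqrt_mul_integral_pow_sin_sq le_rfl one_lt_two).const_mul (1 / (2 * π))
  have e : 1 / (2 * π) * (2 * √(π / 1)) = 1 / √π := by
    rw [div_one]
    have : √π ≠ 0 := by positivity
    field_simp
    exact sq_sqrt pi_pos.le
  rw [e] at h
  refine h.congr fun s => ?_
  rw [centralProb_eq_integral]; ring

lemma le_sum_eig_sq {n L : ℕ} {δ : ℝ} (hL : L ≤ 2 * n)
    (hδ : ∀ s < L, s / (2 * (2 * n - s : ℝ) ^ 2) ≤ δ) :
    (1 / 2 - δ) / 2 * ∑ s ∈ Finset.Ico 1 L, centralProb s ≤ ∑ i, eig n i ^ 2 := by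
  have h1 : ∑ i, eig n i ^ 2 = ∑ p ∈ Finset.range n ×ˢ Finset.range n,
      centralProb (p.1 + p.2) / 2 * ((2 * (p.1 + p.2)).choose (2 * p.1) / 4 ^ (p.1 + p.2)) := by
    rw [sum_eig_sq, Finset.sum_product, Finset.sum_range]
    refine Finset.sum_congr rfl fun j _ => ?_
    rw [Finset.sum_range]
    exact Finset.sum_congr rfl fun k _ => ginibreM_apply_sq n j k
  rw [h1, Finset.mul_sum]
  refine le_trans ?_ (Finset.sum_fiberwise_le_sum_of_sum_fiber_nonneg (t := Finset.Ico 1 L)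
    (g := fun p : ℕ × ℕ => p.1 + p.2) fun s _ => Finset.sum_nonneg fun p _ => by
      have := centralProb_pos (p.1 + p.2)
      positivity)
  refine Finset.sum_le_sum fun s hs => ?_
  rw [Finset.mem_Ico] at hs
  have h2 := le_sum_choose_fiber (n := n) (s := s) (by omega) (by omega)
  have h3 : ∑ p ∈ Finset.range n ×ˢ Finset.range n with p.1 + p.2 = s,
      centralProb (p.1 + p.2) / 2 * ((2 * (p.1 + p.2)).choose (2 * p.1) / 4 ^ (p.1 + p.2) : ℝ)
      = centralProb s / 2 / 4 ^ s * ∑ p ∈ Finset.range n ×ˢ Finset.range n with p.1 + p.2 = s,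
        ((2 * s).choose (2 * p.1) : ℝ) := by
    rw [Finset.mul_sum]
    refine Finset.sum_congr rfl fun p hp => ?_
    rw [(Finset.mem_filter.1 hp).2]
    ring
  rw [h3]
  have h4 := centralProb_pos s
  calc _ = centralProb s / 2 / 4 ^ s * (4 ^ s * (1 / 2 - δ)) := by field_simp
    _ ≤ centralProb s / 2 / 4 ^ s * (4 ^ s * (1 / 2 - s / (2 * (2 * n - s : ℝ) ^ 2))) := by
      have := hδ s hs.2
      gcongr
    _ ≤ _ := by gcongr

lemma tendsto_natCast_sqrt : Tendsto (fun n : ℕ => √(n : ℝ)) atTop atTop :=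
  tendsto_sqrt_atTop.comp tendsto_natCast_atTop_atTop

lemma tendsto_sum_eig_sq :
    Tendsto (fun n : ℕ => (∑ i, eig n i ^ 2) / √n) atTop (𝓝 (1 / √(π * 2))) := by
  set r : ℕ → ℕ := fun n => ⌈√(n : ℝ) * √√(n : ℝ)⌉₊ with hr
  set L : ℕ → ℕ := fun n => 2 * n - r n with hL
  have hrn : Tendsto (fun n : ℕ => (r n : ℝ) / n) atTop (𝓝 0) := by
    have h1 : Tendsto (fun n : ℕ => 1 / √√(n : ℝ) + 1 / (n : ℝ)) atTop (𝓝 0) := by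
      simpa using ((tendsto_sqrt_atTop.comp tendsto_natCast_sqrt).const_div_atTop 1).add
        tendsto_one_div_atTop_nhds_zero_nat
    refine squeeze_zero' (Eventually.of_forall fun n => by positivity) ?_ h1
    filter_upwards [eventually_gt_atTop 0] with n hn
    have hn' : (0 : ℝ) < n := by positivity
    have h2 : 0 < √(n : ℝ) := sqrt_pos.2 hn'
    have h3 : 0 < √√(n : ℝ) := sqrt_pos.2 h2
    have h4 : √(n : ℝ) ^ 2 = n := sq_sqrt hn'.le
    have h5 : √√(n : ℝ) ^ 2 = √(n : ℝ) := sq_sqrt h2.le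
    have h6 := (Nat.ceil_lt_add_one (by positivity : 0 ≤ √(n : ℝ) * √√(n : ℝ))).le
    rw [div_le_iff₀ hn']
    refine h6.trans (le_of_eq ?_)
    rw [add_mul, one_div_mul_cancel hn'.ne', add_left_inj, one_div, inv_mul_eq_div,
      eq_div_iff h3.ne', mul_assoc, ← sq, h5, ← sq, h4]
  have hLn : Tendsto (fun n : ℕ => (L n : ℝ) / n) atTop (𝓝 2) := by
    have h1 := hrn.const_sub 2
    rw [sub_zero] at h1
    refine h1.congr' ?_
    filter_upwards [hrn.eventually_lt_const two_pos, eventually_gt_atTop 0] with n hn hn0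
    have hn' : (0 : ℝ) < n := by positivity
    rw [div_lt_iff₀ hn'] at hn
    have : r n ≤ 2 * n := by exact_mod_cast hn.le
    rw [hL]
    push_cast [Nat.cast_sub this]
    field_simp
  have hLtop : Tendsto L atTop atTop := by
    have h1 := hLn.pos_mul_atTop two_pos tendsto_natCast_atTop_atTop
    refine tendsto_natCast_atTop_iff.1 (h1.congr' ?_)
    filter_upwards [eventually_gt_atTop 0] with n hn
    have hn' : (n : ℝ) ≠ 0 := by positivity
    field_simp
  have hsum := (tendsto_sum_div_sqrt tendsto_sqrt_mul_centralProb).comp hLtop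
  have hP : Tendsto (fun n : ℕ => (∑ s ∈ Finset.range (L n), centralProb s - centralProb 0) / √n)
      atTop (𝓝 (2 * (1 / √π) * √2)) := by
    have h1 := (hsum.mul ((continuous_sqrt.tendsto _).comp hLn)).sub
      (tendsto_natCast_sqrt.const_div_atTop (centralProb 0))
    rw [sub_zero] at h1
    refine h1.congr' ?_
    filter_upwards [eventually_gt_atTop 0, hLtop.eventually_gt_atTop 0] with n hn hLn
    have h2 : √(n : ℝ) ≠ 0 := (sqrt_pos.2 (by positivity)).ne'
    have h3 : √(L n : ℝ) ≠ 0 := (sqrt_pos.2 (by positivity)).ne'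
    simp only [Function.comp_apply]
    rw [sqrt_div (by positivity)]
    field_simp
  have hδ : Tendsto (fun n : ℕ => (1 / 2 - 1 / √(n : ℝ)) / 2) atTop (𝓝 (1 / 4)) := by
    have := ((tendsto_natCast_sqrt.const_div_atTop 1).const_sub (1 / 2)).div_const 2
    convert this using 2
    norm_num
  have hlow := hδ.mul hP
  have hlim : 1 / 4 * (2 * (1 / √π) * √2) = 1 / √(π * 2) := by
    rw [sqrt_mul pi_pos.le]
    have h1 : √π ≠ 0 := by positivity
    have h3 : √2 ^ 2 = (2 : ℝ) := sq_sqrt zero_le_two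
    field_simp
    rw [h3]; norm_num
  rw [hlim] at hlow
  have hup := tendsto_trace_hermMat one_le_two
  push_cast at hup
  refine tendsto_of_tendsto_of_tendsto_of_le_of_le' hlow hup ?_
    (Eventually.of_forall fun n => div_le_div_of_nonneg_right (sum_eig_pow_le n 2) (sqrt_nonneg _))
  filter_upwards [eventually_ge_atTop 4, hLtop.eventually_gt_atTop 0] with n hn hLpos
  have hn' : (0 : ℝ) < n := by positivity
  have h2 : 0 < √(n : ℝ) := sqrt_pos.2 hn'
  have h4 : √(n : ℝ) ^ 2 = n := sq_sqrt hn'.le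
  have h5 : √√(n : ℝ) ^ 2 = √(n : ℝ) := sq_sqrt h2.le
  have key := le_sum_eig_sq (n := n) (L := L n) (δ := 1 / √n) (Nat.sub_le _ _) fun s hs => by
    have hLr : L n = 2 * n - r n := rfl
    have hs' : s + r n ≤ 2 * n := by omega
    have hs2 : (s + r n : ℝ) ≤ 2 * n := by exact_mod_cast hs'
    have h6 : √(n : ℝ) * √√(n : ℝ) ≤ r n := Nat.le_ceil _
    have h7 : (n : ℝ) * √n ≤ (2 * n - s : ℝ) ^ 2 := by
      calc _ = (√(n : ℝ) * √√(n : ℝ)) ^ 2 := by rw [mul_pow, h4, h5]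
        _ ≤ _ := pow_le_pow_left₀ (by positivity) (by linarith) 2
    have h8 : (s : ℝ) ≤ 2 * n := by
      have : (0 : ℝ) ≤ r n := by positivity
      linarith
    calc _ ≤ 2 * n / (2 * (n * √n)) := by gcongr
      _ = _ := by field_simp
  rw [← mul_div_assoc]
  refine div_le_div_of_nonneg_right (le_trans (mul_le_mul_of_nonneg_left ?_ ?_) key) h2.le
  · rw [Finset.range_eq_Ico, Finset.sum_eq_sum_Ico_succ_bot hLpos]
    simp
  · have : 2 ≤ √(n : ℝ) := by
      refine le_sqrt_of_sq_le ?_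
      norm_num
      exact_mod_cast hn
    have : 1 / √(n : ℝ) ≤ 1 / 2 := one_div_le_one_div_of_le two_pos this
    linarith

lemma tendsto_sum_eig_pow {m : ℕ} (hm : 1 ≤ m) :
    Tendsto (fun n : ℕ => (∑ i, eig n i ^ m) / √n) atTop (𝓝 (1 / √(π * m))) := by
  have h2 := tendsto_trace_hermMat one_le_two
  push_cast at h2
  have h3 := (tendsto_trace_hermMat hm).sub ((h2.sub tendsto_sum_eig_sq).const_mul ((m : ℝ) ^ 2))
  rw [sub_self, mul_zero, sub_zero] at h3
  refine tendsto_of_tendsto_of_tendsto_of_le_of_le h3 (tendsto_trace_hermMat hm) (fun n => ?_)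
    fun n => div_le_div_of_nonneg_right (sum_eig_pow_le n m) (sqrt_nonneg _)
  simp only
  rw [← sub_div, ← mul_div_assoc, ← sub_div]
  refine div_le_div_of_nonneg_right ?_ (sqrt_nonneg _)
  linarith [trace_hermMat_le n m]

lemma sum_eig_pow_le_sqrt {m : ℕ} (hm : 1 ≤ m) (n : ℕ) :
    ∑ i, eig n i ^ m ≤ 4 * exp 2 * π * √n / √m :=
  (sum_eig_pow_le n m).trans (trace_hermMat_le_sqrt hm n)

lemma exists_le_one_sub_eig : ∃ C : ℝ, 0 < C ∧ ∀ n (i : Fin n), 1 ≤ C * n * (1 - eig n i) := by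
  set K : ℝ := 4 * exp 2 * π with hK
  have hKpos : 0 < K := by positivity
  refine ⟨2 * (4 * K ^ 2 + 1), by positivity, fun n i => ?_⟩
  have hn : 1 ≤ n := Nat.one_le_iff_ne_zero.2 (by rintro rfl; exact i.elim0)
  have hn' : (1 : ℝ) ≤ n := by exact_mod_cast hn
  set m : ℕ := ⌈4 * K ^ 2 * n⌉₊ with hm
  have hm1 : 4 * K ^ 2 * n ≤ m := Nat.le_ceil _
  have hm2 : (m : ℝ) ≤ 4 * K ^ 2 * n + 1 := (Nat.ceil_lt_add_one (by positivity)).le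
  have hm0 : 1 ≤ m := Nat.one_le_ceil_iff.2 (by positivity)
  have h1 : eig n i ^ m ≤ 1 / 2 := by
    refine (Finset.single_le_sum (f := fun i => eig n i ^ m)
      (fun i _ => pow_nonneg (eig_nonneg n i) m) (Finset.mem_univ i)).trans
      ((sum_eig_pow_le_sqrt hm0 n).trans ?_)
    have hs : 2 * K * √n ≤ √m := by
      refine le_sqrt_of_sq_le ?_
      rw [mul_pow, sq_sqrt (by positivity)]
      linarith
    rw [div_le_iff₀ (sqrt_pos.2 (by positivity))]
    linarith
  have h2 := one_add_mul_le_pow (a := eig n i - 1) (by linarith [eig_nonneg n i]) m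
  rw [add_sub_cancel] at h2
  have h3 := eig_le_one n i
  have h4 : (m : ℝ) * (1 - eig n i) ≤ (4 * K ^ 2 + 1) * n * (1 - eig n i) :=
    mul_le_mul_of_nonneg_right (by linarith) (by linarith)
  linarith

lemma eig_lt_one (n : ℕ) (i : Fin n) : eig n i < 1 := by
  obtain ⟨C, hC, h⟩ := exists_le_one_sub_eig
  have h1 := h n i
  by_contra hlt
  have : C * n * (1 - eig n i) ≤ 0 :=
    mul_nonpos_of_nonneg_of_nonpos (by positivity) (by linarith [not_lt.1 hlt])
  linarith

lemma hasSum_log_prod_one_sub_eig (n : ℕ) :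
    HasSum (fun m : ℕ => (∑ i, eig n i ^ (m + 1)) / (m + 1)) (-log (∏ i, (1 - eig n i))) := by
  rw [log_prod fun i _ => (sub_pos.2 (eig_lt_one n i)).ne', ← Finset.sum_neg_distrib]
  simp only [Finset.sum_div]
  refine hasSum_sum fun i _ => hasSum_pow_div_log_of_abs_lt_one ?_
  rw [abs_of_nonneg (eig_nonneg n i)]
  exact eig_lt_one n i

lemma one_div_sqrt_div (m : ℕ) :
    1 / √(m + 1 : ℝ) / (m + 1) = ((m + 1 : ℕ) : ℝ) ^ (-(3 / 2) : ℝ) := by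
  have h : (0 : ℝ) < m + 1 := by positivity
  push_cast
  rw [show (-(3 / 2) : ℝ) = -(1 / 2) - 1 by norm_num, rpow_sub_one h.ne', rpow_neg h.le,
    ← sqrt_eq_rpow, one_div]

lemma tendsto_log_prod_one_sub_eig :
    Tendsto (fun n : ℕ => log (∏ i, (1 - eig n i)) / √n) atTop
      (𝓝 (-(1 / √π * ∑' m : ℕ+, (m : ℝ) ^ (-(3 / 2) : ℝ)))) := by
  have hsum : Summable fun m : ℕ => ((m + 1 : ℕ) : ℝ) ^ (-(3 / 2) : ℝ) :=
    (summable_nat_add_iff 1).2 (summable_nat_rpow.2 (by norm_num))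
  have h := tendsto_tsum_of_dominated_convergence (𝓕 := atTop)
    (f := fun (n : ℕ) (m : ℕ) => (∑ i, eig n i ^ (m + 1)) / (m + 1) / √(n : ℝ))
    (g := fun m : ℕ => 1 / √π * ((m + 1 : ℕ) : ℝ) ^ (-(3 / 2) : ℝ))
    (bound := fun m : ℕ => 4 * exp 2 * π * ((m + 1 : ℕ) : ℝ) ^ (-(3 / 2) : ℝ))
    (hsum.mul_left _) (fun m => ?_) (Eventually.of_forall fun n m => ?_)
  · rw [tsum_mul_left] at h
    rw [tsum_pnat_eq_tsum_succ (f := fun m : ℕ => (m : ℝ) ^ (-(3 / 2) : ℝ))]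
    refine h.neg.congr fun n => ?_
    rw [tsum_div_const, (hasSum_log_prod_one_sub_eig n).tsum_eq, neg_div, neg_neg]
  · have := (tendsto_sum_eig_pow (m := m + 1) (by omega)).div_const (m + 1 : ℝ)
    rw [← one_div_sqrt_div]
    rw [sqrt_mul pi_pos.le] at this
    push_cast at this
    convert this using 2
    · ring
    · field_simp
  · have h0 : 0 ≤ ∑ i, eig n i ^ (m + 1) :=
      Finset.sum_nonneg fun i _ => pow_nonneg (eig_nonneg n i) _
    rw [norm_of_nonneg (by positivity), ← one_div_sqrt_div]
    refine div_le_of_le_mul₀ (sqrt_nonneg _) (by positivity) ?_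
    have := sum_eig_pow_le_sqrt (m := m + 1) (by omega) n
    push_cast at this
    calc _ ≤ (4 * exp 2 * π * √n / √(m + 1)) / (m + 1) := by gcongr
      _ = _ := by ring

lemma ginibreCoeff_eq (n k : ℕ) : ginibreCoeff n k =
    ∑ t ∈ Finset.powersetCard k Finset.univ,
      (∏ i ∈ t, eig n i) * ∏ i ∈ Finset.univ \ t, (1 - eig n i) := by
  have h : ∀ i : Fin n, 1 + (X - 1) * C (eig n i) = X * C (eig n i) + C (1 - eig n i) :=
    fun i => by rw [C_sub, C_1]; ring
  rw [ginibreCoeff, det_one_add_smul_ginibreM]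
  simp only [h]
  rw [Finset.prod_add, finsetSum_coeff, ← Finset.sum_filter_add_sum_filter_not _
    fun t : Finset (Fin n) => t.card = k]
  have h1 : ∀ t : Finset (Fin n), ((∏ i ∈ t, X * C (eig n i)) *
      ∏ i ∈ Finset.univ \ t, C (1 - eig n i)).coeff k =
      if k = t.card then (∏ i ∈ t, eig n i) * ∏ i ∈ Finset.univ \ t, (1 - eig n i) else 0 :=
    fun t => by
      rw [Finset.prod_mul_distrib, Finset.prod_const, ← map_prod, ← map_prod, mul_assoc, ← C_mul,
        mul_comm, coeff_C_mul_X_pow]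
  simp only [h1]
  rw [Finset.sum_eq_zero (s := Finset.filter (fun t : Finset (Fin n) => ¬t.card = k) _)
    fun t ht => if_neg fun hk => (Finset.mem_filter.1 ht).2 hk.symm, add_zero,
    Finset.powersetCard_eq_filter]
  exact Finset.sum_congr rfl fun t ht => if_pos (Finset.mem_filter.1 ht).2.symm

lemma prod_one_sub_eig_pos (n : ℕ) : 0 < ∏ i, (1 - eig n i) :=
  Finset.prod_pos fun i _ => sub_pos.2 (eig_lt_one n i)

lemma ginibreCoeff_le {C : ℝ} (hC : 0 < C) {n : ℕ}
    (h : ∀ i : Fin n, 1 ≤ C * n * (1 - eig n i)) (k : ℕ) :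
    ginibreCoeff n k ≤ (C * n ^ 2) ^ k * ∏ i, (1 - eig n i) := by
  have key : ∀ t ∈ Finset.powersetCard k (Finset.univ : Finset (Fin n)),
      (∏ i ∈ t, eig n i) * ∏ i ∈ Finset.univ \ t, (1 - eig n i) ≤
        (C * n) ^ k * ∏ i, (1 - eig n i) := fun t ht => by
    rw [← Finset.prod_sdiff (Finset.subset_univ t), mul_left_comm, mul_comm,
      ← (Finset.mem_powersetCard.1 ht).2, ← Finset.prod_const, ← Finset.prod_mul_distrib]
    refine mul_le_mul_of_nonneg_left (Finset.prod_le_prod (fun i _ => eig_nonneg n i)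
      fun i _ => (eig_le_one n i).trans (h i))
      (Finset.prod_nonneg fun i _ => (sub_pos.2 (eig_lt_one n i)).le)
  have hD := prod_one_sub_eig_pos n
  rw [ginibreCoeff_eq]
  refine (Finset.sum_le_card_nsmul _ _ _ key).trans ?_
  rw [Finset.card_powersetCard, Finset.card_univ, Fintype.card_fin, nsmul_eq_mul]
  have : (n.choose k : ℝ) ≤ n ^ k := by exact_mod_cast Nat.choose_le_pow n k
  calc _ ≤ (n : ℝ) ^ k * ((C * n) ^ k * ∏ i, (1 - eig n i)) := by gcongr
    _ = _ := by rw [← mul_assoc, ← mul_pow]; ring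

lemma le_ginibreCoeff {n k : ℕ} (hk : (k : ℝ) + 1 ≤ ∑ i, eig n i) :
    (1 / n : ℝ) ^ k * ∏ i, (1 - eig n i) ≤ ginibreCoeff n k := by
  have hn : (0 : ℝ) < n := by
    rcases Nat.eq_zero_or_pos n with rfl | h
    · simp at hk; linarith
    · exact_mod_cast h
  set S : Finset (Fin n) := {i | 1 / (n : ℝ) ≤ eig n i}
  have hS : k ≤ S.card := by
    have h1 : ∑ i, eig n i ≤ S.card + 1 := by
      rw [← Finset.sum_filter_add_sum_filter_not Finset.univ fun i => 1 / (n : ℝ) ≤ eig n i]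
      refine add_le_add ?_ ?_
      · refine (Finset.sum_le_card_nsmul S (eig n) 1 fun i _ => eig_le_one n i).trans_eq ?_
        rw [nsmul_eq_mul, mul_one]
      · refine (Finset.sum_le_card_nsmul _ (eig n) (1 / n : ℝ)
          fun i hi => (not_le.1 (Finset.mem_filter.1 hi).2).le).trans ?_
        rw [nsmul_eq_mul, mul_one_div, div_le_one hn]
        exact_mod_cast (Finset.card_le_univ _).trans_eq (Fintype.card_fin n)
    exact_mod_cast (by linarith : (k : ℝ) ≤ S.card)
  obtain ⟨t, hts, htk⟩ := Finset.exists_subset_card_eq hS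
  rw [ginibreCoeff_eq]
  have hmem : t ∈ Finset.powersetCard k (Finset.univ : Finset (Fin n)) :=
    Finset.mem_powersetCard.2 ⟨Finset.subset_univ t, htk⟩
  refine le_trans ?_ (Finset.single_le_sum (fun s _ => mul_nonneg
    (Finset.prod_nonneg fun i _ => eig_nonneg n i)
    (Finset.prod_nonneg fun i _ => (sub_pos.2 (eig_lt_one n i)).le)) hmem)
  rw [← Finset.prod_sdiff (Finset.subset_univ t), mul_left_comm, mul_comm, ← htk,
    ← Finset.prod_const, ← Finset.prod_mul_distrib]
  refine mul_le_mul_of_nonneg_right (Finset.prod_le_prod (fun i _ => ?_) fun i hi => ?_)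
    (Finset.prod_nonneg fun i _ => (sub_pos.2 (eig_lt_one n i)).le)
  · exact mul_nonneg (by positivity) (sub_pos.2 (eig_lt_one n i)).le
  · have h1 : 1 / (n : ℝ) ≤ eig n i := (Finset.mem_filter.1 (hts hi)).2
    have h2 := eig_nonneg n i
    nlinarith [one_div_pos.2 hn]

lemma abs_log_ginibreCoeff_sub_le {C : ℝ} (hC : 0 < C) {n k : ℕ}
    (h : ∀ i : Fin n, 1 ≤ C * n * (1 - eig n i)) (hCn : C ≤ n) (hn : 1 ≤ n)
    (hk : (k : ℝ) + 1 ≤ ∑ i, eig n i) :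
    |log (ginibreCoeff n k) - log (∏ i, (1 - eig n i))| ≤ 3 * (k * log n) := by
  have hn' : (1 : ℝ) ≤ n := by exact_mod_cast hn
  have hn0 : (0 : ℝ) < n := by linarith
  have hlog : 0 ≤ log n := log_nonneg hn'
  have hD := prod_one_sub_eig_pos n
  have hlow := le_ginibreCoeff hk
  have hup := ginibreCoeff_le hC h k
  have hc : 0 < ginibreCoeff n k := lt_of_lt_of_le (by positivity) hlow
  have l1 := log_le_log (by positivity) hlow
  have l2 := log_le_log hc hup
  rw [log_mul (by positivity) hD.ne', log_pow] at l1 l2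
  rw [one_div, log_inv] at l1
  rw [log_mul hC.ne' (by positivity), log_pow] at l2
  have l3 := log_le_log hC hCn
  have hkn : 0 ≤ k * log n := by positivity
  have l4 : (k : ℝ) * (log C + (2 : ℕ) * log n) ≤ k * (3 * log n) := by
    refine mul_le_mul_of_nonneg_left ?_ (Nat.cast_nonneg k)
    push_cast
    linarith
  rw [abs_le]
  constructor <;> linarith

end GinibreReal

open GinibreReal Filter in
theorem stmt2 (k : ℕ → ℕ) (hkn : ∀ n : ℕ, 1 ≤ n → k n ≤ n)
    (hk : Filter.Tendsto
      (fun n : ℕ => (n : ℝ) ^ (-(1 / 2) : ℝ) * Real.log n * (k n : ℝ))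
      Filter.atTop (nhds 0)) :
    Filter.Tendsto
      (fun n : ℕ => (1 / Real.sqrt (2 * n)) * Real.log (ginibreCoeff n (k n)))
      Filter.atTop
      (nhds (-(1 / Real.sqrt (2 * Real.pi)) * ∑' m : ℕ+, (m : ℝ) ^ (-(3 / 2) : ℝ))) := by
  obtain ⟨C, hC, hbound⟩ := exists_le_one_sub_eig
  have hk' : Tendsto (fun n : ℕ => k n * Real.log n / Real.sqrt n) atTop (nhds 0) := by
    refine hk.congr fun n => ?_
    rw [Real.rpow_neg (Nat.cast_nonneg n), ← Real.sqrt_eq_rpow]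
    ring
  have hsmall : ∀ᶠ n : ℕ in atTop, (k n : ℝ) + 1 ≤ ∑ i, eig n i := by
    have h1 := tendsto_sum_eig_pow le_rfl
    simp only [pow_one, Nat.cast_one, mul_one] at h1
    have h2 : Tendsto (fun n : ℕ => k n * Real.log n / Real.sqrt n + 1 / Real.sqrt n) atTop
        (nhds 0) := by
      simpa using hk'.add (tendsto_natCast_sqrt.const_div_atTop 1)
    have hpos : 0 < 1 / Real.sqrt Real.pi := by positivity
    filter_upwards [h2.eventually_lt h1 hpos, eventually_ge_atTop 3] with n hn hn3
    have hs : 0 < Real.sqrt n := Real.sqrt_pos.2 (by positivity)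
    have hlog : 1 ≤ Real.log n := by
      rw [Real.le_log_iff_exp_le (by positivity)]
      have : (3 : ℝ) ≤ n := by exact_mod_cast hn3
      linarith [Real.exp_one_lt_d9]
    rw [← add_div, div_lt_div_iff_of_pos_right hs] at hn
    have : (k n : ℝ) ≤ k n * Real.log n := le_mul_of_one_le_right (Nat.cast_nonneg _) hlog
    linarith
  have herr : Tendsto (fun n : ℕ => (Real.log (ginibreCoeff n (k n)) -
      Real.log (∏ i, (1 - eig n i))) / Real.sqrt n) atTop (nhds 0) := by
    have h3 := hk'.const_mul 3
    rw [mul_zero] at h3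
    refine squeeze_zero_norm' ?_ h3
    filter_upwards [hsmall, eventually_ge_atTop 1,
      tendsto_natCast_atTop_atTop.eventually_ge_atTop C] with n hn hn1 hnC
    rw [norm_div, Real.norm_eq_abs, Real.norm_of_nonneg (Real.sqrt_nonneg _), ← mul_div_assoc]
    exact div_le_div_of_nonneg_right
      (abs_log_ginibreCoeff_sub_le hC (hbound n) hnC hn1 hn) (Real.sqrt_nonneg _)
  have h := (herr.add tendsto_log_prod_one_sub_eig).const_mul (1 / Real.sqrt 2)
  have e : 1 / Real.sqrt 2 * (0 + -(1 / Real.sqrt Real.pi * ∑' m : ℕ+, (m : ℝ) ^ (-(3 / 2) : ℝ))) =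
      -(1 / Real.sqrt (2 * Real.pi)) * ∑' m : ℕ+, (m : ℝ) ^ (-(3 / 2) : ℝ) := by
    rw [Real.sqrt_mul zero_le_two]
    field_simp
    ring
  rw [e] at h
  refine h.congr fun n => ?_
  rw [← add_div, sub_add_cancel, Real.sqrt_mul zero_le_two]
  field_simp
end

section
/- Let $M_n$ be the $n\times n$ real symmetric matrix with entries $M_n(j,k) = \frac{1}{\sqrt{2\pi}}\,\frac{\Gamma(j+k-3/2)}{\sqrt{\Gamma(2j-1)\Gamma(2k-1)}}$ for $1\le j,k\le n$. Then for every fixed positive integer $m$, $\lim_{n\to\infty} \frac{1}{\sqrt{2n}}\,\mathrm{Tr}(M_n^m) = \frac{1}{\sqrt{2\pi m}}$. -/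
/-- The mass at `k` of the negative binomial law with parameters `j + 1/2` and `1/2`. -/
noncomputable def negBinKernel (j k : ℕ) : ℝ :=
  Real.Gamma (j + k + 1 / 2) / (Real.Gamma (j + 1 / 2) * k.factorial) / 2 ^ (j + k) / √2

lemma negBinKernel_pos (j k : ℕ) : 0 < negBinKernel j k := by
  have h1 : 0 < Real.Gamma (j + k + 1 / 2) := Real.Gamma_pos_of_pos (by positivity)
  have h2 : 0 < Real.Gamma (j + 1 / 2) := Real.Gamma_pos_of_pos (by positivity)
  unfold negBinKernel
  positivity

lemma Gamma_add_natCast_div {r : ℝ} (hr : 0 < r) (k : ℕ) :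
    Real.Gamma (r + k) / (Real.Gamma r * k.factorial) = Ring.choose (r + k - 1) k := by
  have hG : ∀ k : ℕ, Real.Gamma (r + k) = Real.Gamma r * (ascPochhammer ℝ k).eval r := by
    intro k
    induction k with
    | zero => simp
    | succ k ih =>
      have : r + (k + 1 : ℕ) = (r + k) + 1 := by push_cast; ring
      rw [this, Real.Gamma_add_one (by positivity), ih, ascPochhammer_succ_eval]
      ring
  have hc := Ring.factorial_nsmul_multichoose_eq_ascPochhammer r k
  rw [Polynomial.ascPochhammer_smeval_eq_eval, Ring.multichoose_eq, nsmul_eq_mul] at hc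
  have : Real.Gamma r ≠ 0 := (Real.Gamma_pos_of_pos hr).ne'
  rw [hG, ← hc]
  field_simp

lemma mul_cpow_of_re_pos {x y : ℂ} (hx : 0 < x.re) (hy : 0 < y.re) (c : ℂ) :
    (x * y) ^ c = x ^ c * y ^ c := by
  have hx0 : x ≠ 0 := by rintro rfl; simp at hx
  have hy0 : y ≠ 0 := by rintro rfl; simp at hy
  have h1 := abs_lt.1 (Complex.abs_arg_lt_pi_div_two_iff.2 (Or.inl hx))
  have h2 := abs_lt.1 (Complex.abs_arg_lt_pi_div_two_iff.2 (Or.inl hy))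
  rw [Complex.cpow_def_of_ne_zero (mul_ne_zero hx0 hy0), Complex.cpow_def_of_ne_zero hx0,
    Complex.cpow_def_of_ne_zero hy0, ← Complex.exp_add,
    (Complex.log_mul_eq_add_log_iff hx0 hy0).2 ⟨by linarith, by linarith⟩, add_mul]

lemma hasSum_negBinKernel_mul_pow (j : ℕ) {z : ℂ} (hz : ‖z‖ ≤ 1) :
    HasSum (fun k => (negBinKernel j k : ℂ) * z ^ k)
      (((2 - z)⁻¹) ^ j * (2 - z) ^ (-(1 / 2) : ℂ)) := by
  have hz2 : ‖z / 2‖ < 1 := by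
    rw [norm_div]; norm_num; linarith
  have h := (Complex.one_div_one_sub_cpow_hasFPowerSeriesOnBall_zero
    ((j : ℂ) + 1 / 2)).hasSum (y := z / 2) (by
      simpa [← ofReal_norm] using hz2)
  have hre : 0 < (1 - z / 2).re := by
    have := Complex.re_le_norm (z / 2)
    simp only [Complex.sub_re, Complex.one_re]
    linarith
  have hne : (1 - z / 2) ≠ 0 := by
    intro h0; rw [h0] at hre; simp at hre
  have h2 := h.mul_left ((1 / 2 ^ j / √2 : ℝ) : ℂ)
  convert! h2 using 1
  · funext k
    have hk := Gamma_add_natCast_div (r := (j : ℝ) + 1 / 2) (by positivity) k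
    have hk' : (Ring.choose ((j : ℂ) + 1 / 2 + k - 1) k) =
        ((Ring.choose ((j : ℝ) + 1 / 2 + k - 1) k : ℝ) : ℂ) := by
      rw [Complex.ofReal_choose]; push_cast; rfl
    simp only [FormalMultilinearSeries.ofScalars_apply_eq, hk', ← hk, negBinKernel, smul_eq_mul]
    rw [show (j : ℝ) + 1 / 2 + k = j + k + 1 / 2 by ring, div_pow, pow_add]
    push_cast
    ring
  · have e : (2 - z) = ((2 : ℝ) : ℂ) * (1 - z / 2) := by push_cast; ring
    have hs : ((2 : ℝ) : ℂ) ^ (-(1 / 2) : ℂ) = ((1 / √2 : ℝ) : ℂ) := by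
      rw [show (-(1 / 2) : ℂ) = ((-(1 / 2) : ℝ) : ℂ) by push_cast; rfl,
        ← Complex.ofReal_cpow (by norm_num), Real.rpow_neg (by norm_num), ← Real.sqrt_eq_rpow,
        one_div]
    have hm : (2 - z) ^ (-(1 / 2) : ℂ) =
        ((2 : ℝ) : ℂ) ^ (-(1 / 2) : ℂ) * (1 - z / 2) ^ (-(1 / 2) : ℂ) := by
      rw [e, mul_cpow_of_re_pos (by simp) hre]
    rw [hm, hs, zero_add, Complex.cpow_add _ _ hne, Complex.cpow_natCast, Complex.cpow_neg, e,
      mul_inv, mul_pow, inv_pow, inv_pow]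
    push_cast
    ring

lemma hasSum_negBinKernel (j : ℕ) : HasSum (negBinKernel j) 1 := by
  have h := hasSum_negBinKernel_mul_pow j (z := 1) (by simp)
  have e : (((2 - 1 : ℂ))⁻¹) ^ j * (2 - 1 : ℂ) ^ (-(1 / 2) : ℂ) = ((1 : ℝ) : ℂ) := by norm_num
  rw [e] at h
  simpa using Complex.hasSum_ofReal.1 (by simpa using h)

lemma negBinKernel_succ (j k : ℕ) :
    negBinKernel j (k + 1) * (k + 1) = (j + 1 / 2) * negBinKernel (j + 1) k := by
  have h2 : Real.Gamma ((j : ℝ) + 1 / 2) ≠ 0 := (Real.Gamma_pos_of_pos (by positivity)).ne'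
  have h : Real.Gamma (((j + 1 : ℕ) : ℝ) + 1 / 2) = (j + 1 / 2) * Real.Gamma (j + 1 / 2) := by
    rw [← Real.Gamma_add_one (by positivity)]; congr 1; push_cast; ring
  unfold negBinKernel
  rw [h, Nat.factorial_succ]
  push_cast
  rw [show (j : ℝ) + 1 + k + 1 / 2 = j + (k + 1) + 1 / 2 by ring,
    show j + 1 + k = j + (k + 1) by ring]
  field_simp

lemma hasSum_negBinKernel_mul (j : ℕ) :
    HasSum (fun k => negBinKernel j k * k) (j + 1 / 2) := by
  rw [← hasSum_nat_add_iff' 1]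
  convert! (hasSum_negBinKernel (j + 1)).mul_left ((j : ℝ) + 1 / 2) using 1
  · funext k; rw [← negBinKernel_succ]; push_cast; ring
  · simp

lemma hasSum_negBinKernel_mul_sq (j : ℕ) :
    HasSum (fun k => negBinKernel j k * (k : ℝ) ^ 2) (j ^ 2 + 3 * j + 5 / 4) := by
  rw [← hasSum_nat_add_iff' 1]
  convert! (((hasSum_negBinKernel_mul (j + 1)).add (hasSum_negBinKernel (j + 1))).mul_left
    ((j : ℝ) + 1 / 2)) using 1
  · funext k
    have := negBinKernel_succ j k
    push_cast
    linear_combination ((k : ℝ) + 1) * this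
  · simp; ring

lemma hasSum_negBinKernel_mul_sub_sq (j : ℕ) (c : ℝ) :
    HasSum (fun k => negBinKernel j k * ((k : ℝ) - c) ^ 2)
      ((j - c) ^ 2 + 3 * j - c + 5 / 4) := by
  convert! ((hasSum_negBinKernel_mul_sq j).add
    ((hasSum_negBinKernel_mul j).mul_right (-2 * c))).add
    ((hasSum_negBinKernel j).mul_right (c ^ 2)) using 1
  · funext k; ring
  · ring

/-- The denominator of the `m`-th iterate of the geometric generating function
`z ↦ 1 / (2 - z)`. -/
noncomputable def geomDen (m : ℕ) (z : ℂ) : ℂ := 1 + m * (1 - z)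

/-- The `m`-th iterate of the geometric generating function `z ↦ 1 / (2 - z)`. -/
noncomputable def geomIter (m : ℕ) (z : ℂ) : ℂ := 1 - (1 - z) / geomDen m z

lemma one_le_re_geomDen (m : ℕ) {z : ℂ} (hz : ‖z‖ = 1) : 1 ≤ (geomDen m z).re := by
  have := Complex.re_le_norm z
  have h2 : 0 ≤ (m : ℝ) * (1 - z.re) := mul_nonneg (by positivity) (by linarith)
  simpa [geomDen] using h2

lemma geomDen_ne_zero (m : ℕ) {z : ℂ} (hz : ‖z‖ = 1) : geomDen m z ≠ 0 := by
  have := one_le_re_geomDen m hz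
  intro h
  rw [h] at this
  norm_num at this

lemma two_sub_geomIter (m : ℕ) {z : ℂ} (hz : ‖z‖ = 1) :
    2 - geomIter m z = geomDen (m + 1) z / geomDen m z := by
  have := geomDen_ne_zero m hz
  rw [geomIter, eq_div_iff this, sub_mul, sub_mul, div_mul_cancel₀ _ this]
  simp only [geomDen]
  push_cast
  ring

lemma geomIter_succ (m : ℕ) {z : ℂ} (hz : ‖z‖ = 1) :
    geomIter (m + 1) z = (2 - geomIter m z)⁻¹ := by
  have h1 := geomDen_ne_zero (m + 1) hz
  rw [two_sub_geomIter m hz, inv_div, eq_div_iff h1, geomIter, sub_mul, div_mul_cancel₀ _ h1]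
  simp only [geomDen]
  push_cast
  ring

lemma norm_one_add_mul_one_sub_sq (c : ℝ) {z : ℂ} (hz : ‖z‖ = 1) :
    ‖1 + c * (1 - z)‖ ^ 2 = 1 + (c + c ^ 2) * ‖1 - z‖ ^ 2 := by
  have h : z.re * z.re + z.im * z.im = 1 := by
    rw [← Complex.normSq_apply, Complex.normSq_eq_norm_sq, hz]; norm_num
  rw [← Complex.normSq_eq_norm_sq, ← Complex.normSq_eq_norm_sq, Complex.normSq_apply,
    Complex.normSq_apply]
  simp
  linear_combination (-c) * h

lemma norm_geomIter_sq (m : ℕ) {z : ℂ} (hz : ‖z‖ = 1) :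
    ‖geomIter m z‖ ^ 2 = 1 - 2 * m * ‖1 - z‖ ^ 2 / (1 + (m + m ^ 2) * ‖1 - z‖ ^ 2) := by
  have h0 := geomDen_ne_zero m hz
  have h1 : geomIter m z = (1 + ((m - 1 : ℝ) : ℂ) * (1 - z)) / geomDen m z := by
    rw [geomIter, eq_div_iff h0, sub_mul, div_mul_cancel₀ _ h0]
    simp only [geomDen]
    push_cast
    ring
  have h2 : ‖geomDen m z‖ ^ 2 = 1 + (m + m ^ 2) * ‖1 - z‖ ^ 2 := by
    rw [← norm_one_add_mul_one_sub_sq m hz]; simp [geomDen]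
  have h3 : 1 + ((m : ℝ) + m ^ 2) * ‖1 - z‖ ^ 2 ≠ 0 := by positivity
  rw [h1, norm_div, div_pow, h2, norm_one_add_mul_one_sub_sq _ hz]
  field_simp
  ring

lemma norm_geomIter_le_one (m : ℕ) {z : ℂ} (hz : ‖z‖ = 1) : ‖geomIter m z‖ ≤ 1 := by
  have h := norm_geomIter_sq m hz
  have : 0 ≤ 2 * m * ‖1 - z‖ ^ 2 / (1 + (m + m ^ 2) * ‖1 - z‖ ^ 2) := by positivity
  nlinarith [norm_nonneg (geomIter m z)]

lemma norm_geomDen_cpow_le_one (m : ℕ) {z : ℂ} (hz : ‖z‖ = 1) :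
    ‖geomDen m z ^ (-(1 / 2) : ℂ)‖ ≤ 1 := by
  rw [show (-(1 / 2) : ℂ) = ((-(1 / 2) : ℝ) : ℂ) by push_cast; rfl, Complex.norm_cpow_real]
  exact Real.rpow_le_one_of_one_le_of_nonpos
    ((one_le_re_geomDen m hz).trans (Complex.re_le_norm _)) (by norm_num)

lemma hasSum_negBinKernel_mul_geomIter_pow (m j : ℕ) {z : ℂ} (hz : ‖z‖ = 1) :
    HasSum (fun l => (negBinKernel j l : ℂ) *
        (geomIter m z ^ l * geomDen m z ^ (-(1 / 2) : ℂ)))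
      (geomIter (m + 1) z ^ j * geomDen (m + 1) z ^ (-(1 / 2) : ℂ)) := by
  have h0 := geomDen_ne_zero m hz
  convert! (hasSum_negBinKernel_mul_pow j (norm_geomIter_le_one m hz)).mul_right
    (geomDen m z ^ (-(1 / 2) : ℂ)) using 1
  · funext l; ring
  · have hre : 0 < (2 - geomIter m z).re := by
      have := (Complex.re_le_norm (geomIter m z)).trans (norm_geomIter_le_one m hz)
      simp
      linarith
    rw [geomIter_succ m hz, mul_assoc,
      ← mul_cpow_of_re_pos hre (by linarith [one_le_re_geomDen m hz]), two_sub_geomIter m hz,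
      div_mul_cancel₀ _ h0]

/-- The Fourier integrand whose integral over a period is `2π` times the `m`-step transition
probability from `j` to `k` of `negBinKernel`. -/
noncomputable def fourierIntegrand (m j k : ℕ) (θ : ℝ) : ℂ :=
  geomIter m (Complex.exp (θ * Complex.I)) ^ j *
    geomDen m (Complex.exp (θ * Complex.I)) ^ (-(1 / 2) : ℂ) *
    (Complex.exp (θ * Complex.I))⁻¹ ^ k

/-- The `m`-step transition probability from `j` to `k` of `negBinKernel`. -/
noncomputable def transProb (m j k : ℕ) : ℝ :=
  ((2 * Real.pi : ℂ)⁻¹ * ∫ θ in -Real.pi..Real.pi, fourierIntegrand m j k θ).re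

lemma continuous_fourierIntegrand (m j k : ℕ) : Continuous (fourierIntegrand m j k) := by
  have hc : Continuous fun θ : ℝ => Complex.exp (θ * Complex.I) := by fun_prop
  have hd : Continuous fun θ : ℝ => geomDen m (Complex.exp (θ * Complex.I)) := by
    unfold geomDen; fun_prop
  have hd0 (θ : ℝ) : geomDen m (Complex.exp (θ * Complex.I)) ≠ 0 :=
    geomDen_ne_zero m (Complex.norm_exp_ofReal_mul_I θ)
  refine Continuous.mul (Continuous.mul (Continuous.pow ?_ _) ?_) ?_
  · exact continuous_const.sub ((continuous_const.sub hc).div hd hd0)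
  · refine hd.cpow continuous_const fun θ => Or.inl ?_
    linarith [one_le_re_geomDen m (Complex.norm_exp_ofReal_mul_I θ)]
  · exact (hc.inv₀ fun θ => Complex.exp_ne_zero _).pow _

lemma norm_fourierIntegrand_le (m j k : ℕ) (θ : ℝ) :
    ‖fourierIntegrand m j k θ‖ ≤ ‖geomIter m (Complex.exp (θ * Complex.I))‖ ^ j := by
  have hz := Complex.norm_exp_ofReal_mul_I θ
  rw [fourierIntegrand, norm_mul, norm_mul, norm_pow, norm_pow, norm_inv, hz]
  simpa using mul_le_of_le_one_right (by positivity) (norm_geomDen_cpow_le_one m hz)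

lemma hasSum_negBinKernel_mul_transProb (m j k : ℕ) :
    HasSum (fun l => negBinKernel j l * transProb m l k) (transProb (m + 1) j k) := by
  have h : HasSum (fun l => ∫ θ in -Real.pi..Real.pi,
        (negBinKernel j l : ℂ) * fourierIntegrand m l k θ)
      (∫ θ in -Real.pi..Real.pi, fourierIntegrand (m + 1) j k θ) := by
    refine intervalIntegral.hasSum_integral_of_dominated_convergence
      (fun l _ => negBinKernel j l) (fun l => ?_) (fun l => ?_) ?_ ?_ ?_
    · exact (continuous_const.mul (continuous_fourierIntegrand m l k)).aestronglyMeasurable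
    · refine Filter.Eventually.of_forall fun θ _ => ?_
      rw [norm_mul, Complex.norm_real, Real.norm_of_nonneg (negBinKernel_pos j l).le]
      exact mul_le_of_le_one_right (negBinKernel_pos j l).le
        ((norm_fourierIntegrand_le m l k θ).trans (pow_le_one₀ (norm_nonneg _)
          (norm_geomIter_le_one m (Complex.norm_exp_ofReal_mul_I θ))))
    · exact Filter.Eventually.of_forall fun θ _ => (hasSum_negBinKernel j).summable
    · exact intervalIntegrable_const
    · refine Filter.Eventually.of_forall fun θ _ => ?_
      simpa only [fourierIntegrand, mul_assoc] using
        (hasSum_negBinKernel_mul_geomIter_pow m j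
          (Complex.norm_exp_ofReal_mul_I θ)).mul_right ((Complex.exp (θ * Complex.I))⁻¹ ^ k)
  convert! Complex.hasSum_re (h.mul_left ((2 * Real.pi : ℂ)⁻¹)) using 1
  funext l
  rw [intervalIntegral.integral_const_mul, transProb, ← Complex.re_ofReal_mul]
  congr 1
  ring

lemma transProb_zero (j k : ℕ) : transProb 0 j k = if j = k then 1 else 0 := by
  have hpi : (2 * (Real.pi : ℂ)) ≠ 0 := by
    simp [Real.pi_ne_zero]
  have hF (θ : ℝ) : fourierIntegrand 0 j k θ =
      Complex.exp ((((j : ℤ) - k : ℤ) : ℂ) * Complex.I * θ) := by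
    simp only [fourierIntegrand, geomIter, geomDen]
    rw [← Complex.exp_neg, ← Complex.exp_nat_mul]
    simp only [Nat.cast_zero, zero_mul, add_zero, div_one, sub_sub_cancel, Complex.one_cpow,
      mul_one]
    rw [← Complex.exp_nat_mul, ← Complex.exp_add]
    congr 1
    push_cast
    ring
  simp only [transProb, hF]
  split_ifs with h
  · subst h
    simp
    field_simp
    norm_num
  · have hn : ((j : ℤ) - k) ≠ 0 := by omega
    have hn' : (((j : ℤ) - k : ℤ) : ℂ) * Complex.I ≠ 0 :=
      mul_ne_zero (by exact_mod_cast hn) Complex.I_ne_zero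
    rw [integral_exp_mul_complex hn']
    have : Complex.exp ((((j : ℤ) - k : ℤ) : ℂ) * Complex.I * Real.pi) =
        Complex.exp ((((j : ℤ) - k : ℤ) : ℂ) * Complex.I * (-Real.pi : ℝ)) := by
      rw [Complex.exp_eq_exp_iff_exists_int]
      refine ⟨(j : ℤ) - k, ?_⟩
      push_cast
      ring
    rw [this]
    simp

lemma transProb_nonneg_and_le_one (m j k : ℕ) : 0 ≤ transProb m j k ∧ transProb m j k ≤ 1 := by
  induction m generalizing j with
  | zero => rw [transProb_zero]; split_ifs <;> simp
  | succ m ih =>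
    have h := hasSum_negBinKernel_mul_transProb m j k
    exact ⟨h.nonneg fun l => mul_nonneg (negBinKernel_pos j l).le (ih l).1,
      hasSum_le (fun l => mul_le_of_le_one_right (negBinKernel_pos j l).le (ih l).2) h
        (hasSum_negBinKernel j)⟩

open Filter Topology in
lemma tendsto_sqrt_mul_one_sub_exp (u : ℝ) :
    Tendsto (fun j : ℕ => (√j : ℂ) * (1 - Complex.exp ((u / √j : ℝ) * Complex.I)))
      atTop (𝓝 (-(u * Complex.I))) := by
  have hd : HasDerivAt (fun t : ℝ => 1 - Complex.exp (t * (u * Complex.I)))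
      (-(u * Complex.I)) 0 := by
    have h1 : HasDerivAt (fun t : ℝ => (t : ℂ) * (u * Complex.I)) (u * Complex.I) 0 := by
      simpa using (Complex.ofRealCLM.hasDerivAt (x := 0)).mul_const ((u : ℂ) * Complex.I)
    simpa using h1.cexp.const_sub 1
  have ht : Tendsto (fun j : ℕ => (√j)⁻¹) atTop (𝓝[>] (0 : ℝ)) :=
    tendsto_inv_atTop_nhdsGT_zero.comp
      (Real.tendsto_sqrt_atTop.comp tendsto_natCast_atTop_atTop)
  refine (hd.tendsto_slope_zero_right.comp ht).congr fun j => ?_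
  simp only [Function.comp, zero_add, Complex.ofReal_zero, zero_mul, Complex.exp_zero, sub_self,
    sub_zero, inv_inv, Complex.real_smul]
  have e : (((√j)⁻¹ : ℝ) : ℂ) * (u * Complex.I) = ((u / √j : ℝ) : ℂ) * Complex.I := by
    push_cast; ring
  rw [e]

lemma geomIter_mul_inv (m : ℕ) {z : ℂ} (hz : ‖z‖ = 1) :
    geomIter m z * z⁻¹ = 1 + m * (1 - z) ^ 2 / (geomDen m z * z) := by
  have h0 := geomDen_ne_zero m hz
  have hz0 : z ≠ 0 := by rintro rfl; simp at hz
  have h : geomIter m z * geomDen m z = 1 + (m - 1) * (1 - z) := by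
    rw [geomIter, sub_mul, div_mul_cancel₀ _ h0]
    simp only [geomDen]
    ring
  field_simp
  rw [h, geomDen]
  ring

open Filter Topology in
lemma tendsto_fourierIntegrand_div_sqrt (m : ℕ) (u : ℝ) :
    Tendsto (fun j : ℕ => fourierIntegrand m j j (u / √j)) atTop
      (𝓝 ((Real.exp (-m * u ^ 2) : ℝ) : ℂ)) := by
  set z : ℕ → ℂ := fun j => Complex.exp ((u / √j : ℝ) * Complex.I) with hzdef
  have hn (j : ℕ) : ‖z j‖ = 1 := Complex.norm_exp_ofReal_mul_I _
  have hz : Tendsto z atTop (𝓝 1) := by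
    have h0 : Tendsto (fun j : ℕ => u / √j) atTop (𝓝 0) :=
      (Real.tendsto_sqrt_atTop.comp tendsto_natCast_atTop_atTop).const_div_atTop u
    have hc : Continuous fun θ : ℝ => Complex.exp (θ * Complex.I) := by fun_prop
    have h : Tendsto z atTop (𝓝 (Complex.exp ((0 : ℝ) * Complex.I))) := (hc.tendsto 0).comp h0
    rwa [show Complex.exp ((0 : ℝ) * Complex.I) = 1 by simp] at h
  have hden : Tendsto (fun j => geomDen m (z j)) atTop (𝓝 1) := by
    have hc : Continuous (geomDen m) := by unfold geomDen; fun_prop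
    have h := (hc.tendsto 1).comp hz
    rwa [show geomDen m 1 = 1 by simp [geomDen]] at h
  have hpow : Tendsto (fun j => geomDen m (z j) ^ (-(1 / 2) : ℂ)) atTop (𝓝 1) := by
    have := hden.cpow (tendsto_const_nhds (x := (-(1 / 2) : ℂ))) (Or.inl (by simp))
    simpa using this
  have hg : Tendsto (fun j : ℕ => (j : ℂ) * (m * (1 - z j) ^ 2 / (geomDen m (z j) * z j)))
      atTop (𝓝 (-m * (u : ℂ) ^ 2)) := by
    have h := (((tendsto_sqrt_mul_one_sub_exp u).pow 2).const_mul (m : ℂ)).div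
      (hden.mul hz) (by simp)
    convert! h using 1
    · funext j
      have : (√j : ℂ) ^ 2 = j := by
        rw [← Complex.ofReal_pow, Real.sq_sqrt (Nat.cast_nonneg j)]; simp
      simp only [mul_pow, this, Pi.div_apply, hzdef]
      ring
    · congr 1
      rw [neg_sq, mul_pow, Complex.I_sq]
      simp
  have hE := Complex.tendsto_one_add_pow_exp_of_tendsto hg
  have := hE.mul hpow
  rw [mul_one] at this
  convert! this using 1
  · funext j
    rw [← geomIter_mul_inv m (hn j), fourierIntegrand, mul_pow]
    simp only [hzdef]
    ring
  · congr 1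
    push_cast
    rfl

lemma norm_geomIter_le_exp (m : ℕ) {θ : ℝ} (hθ : |θ| ≤ Real.pi) :
    ‖geomIter m (Complex.exp (θ * Complex.I))‖ ≤
      Real.exp (-(m / (2 * m + 1) ^ 2 * (2 / Real.pi) ^ 2) * θ ^ 2) := by
  have hpi := Real.pi_pos
  set z := Complex.exp (θ * Complex.I)
  have hz : ‖z‖ = 1 := Complex.norm_exp_ofReal_mul_I _
  have hlow : 2 / Real.pi * |θ| ≤ ‖1 - z‖ := by
    have h1 : ‖1 - z‖ = 2 * |Real.sin (θ / 2)| := by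
      rw [norm_sub_rev]
      have := Complex.norm_exp_I_mul_ofReal_sub_one θ
      rw [mul_comm Complex.I] at this
      rw [this, norm_mul, Real.norm_eq_abs, Real.norm_eq_abs, abs_two]
    have h2 := Real.mul_abs_le_abs_sin (x := θ / 2) (by
      rw [abs_div, abs_two]; linarith)
    rw [abs_div, abs_two] at h2
    rw [h1]
    linarith
  have hlow2 : (2 / Real.pi) ^ 2 * θ ^ 2 ≤ ‖1 - z‖ ^ 2 := by
    rw [← sq_abs θ, ← mul_pow]
    exact pow_le_pow_left₀ (by positivity) hlow 2
  have hup : ‖1 - z‖ ^ 2 ≤ 4 := by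
    have : ‖1 - z‖ ≤ 2 := (norm_sub_le _ _).trans (by rw [hz]; norm_num)
    nlinarith [norm_nonneg (1 - z)]
  refine (sq_le_sq₀ (norm_nonneg _) (Real.exp_nonneg _)).1 ?_
  rw [norm_geomIter_sq m hz, ← Real.exp_nat_mul]
  refine le_trans ?_ (Real.add_one_le_exp _)
  have hfrac : 2 * m * ‖1 - z‖ ^ 2 / (2 * m + 1) ^ 2 ≤
      2 * m * ‖1 - z‖ ^ 2 / (1 + (m + m ^ 2) * ‖1 - z‖ ^ 2) := by
    apply div_le_div_of_nonneg_left (by positivity) (by positivity)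
    have : 0 ≤ (m : ℝ) + m ^ 2 := by positivity
    nlinarith
  have hmono : 2 * m * ((2 / Real.pi) ^ 2 * θ ^ 2) / (2 * m + 1) ^ 2 ≤
      2 * m * ‖1 - z‖ ^ 2 / (2 * m + 1) ^ 2 := by gcongr
  have e : ((2 : ℕ) : ℝ) * (-(m / (2 * m + 1) ^ 2 * (2 / Real.pi) ^ 2) * θ ^ 2) =
      -(2 * m * ((2 / Real.pi) ^ 2 * θ ^ 2) / (2 * m + 1) ^ 2) := by
    push_cast; ring
  rw [e]
  linarith

open Filter Topology MeasureTheory in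
lemma tendsto_sqrt_mul_transProb {m : ℕ} (hm : 0 < m) :
    Tendsto (fun j : ℕ => √j * transProb m j j) atTop
      (𝓝 ((2 * Real.pi)⁻¹ * √(Real.pi / m))) := by
  have hpi := Real.pi_pos
  set κ : ℝ := m / (2 * m + 1) ^ 2 * (2 / Real.pi) ^ 2 with hκ
  have hκ0 : 0 < κ := by positivity
  have hlim : Tendsto (fun j : ℕ => ∫ u : ℝ,
      (Set.Ioc (-(Real.pi * √j)) (Real.pi * √j)).indicator
        (fun u => fourierIntegrand m j j (u / √j)) u) atTop
      (𝓝 (∫ u : ℝ, ((Real.exp (-m * u ^ 2) : ℝ) : ℂ))) := by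
    refine tendsto_integral_of_dominated_convergence (fun u => Real.exp (-κ * u ^ 2))
      (fun j => ?_) (integrable_exp_neg_mul_sq hκ0) (fun j => ?_) ?_
    · exact (((continuous_fourierIntegrand m j j).comp
        (continuous_id.div_const _)).aestronglyMeasurable).indicator measurableSet_Ioc
    · refine Eventually.of_forall fun u => ?_
      by_cases hu : u ∈ Set.Ioc (-(Real.pi * √j)) (Real.pi * √j)
      · rw [Set.indicator_of_mem hu]
        have hj : 0 < √(j : ℝ) := by
          by_contra h
          have : √(j : ℝ) = 0 := le_antisymm (not_lt.1 h) (Real.sqrt_nonneg _)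
          simp only [this, mul_zero, neg_zero, Set.Ioc_self] at hu
          exact hu
        have hθ : |u / √j| ≤ Real.pi := by
          rw [abs_div, abs_of_pos hj, div_le_iff₀ hj, abs_le]
          exact ⟨hu.1.le, hu.2⟩
        refine (norm_fourierIntegrand_le m j j _).trans
          ((pow_le_pow_left₀ (norm_nonneg _) (norm_geomIter_le_exp m hθ) j).trans_eq ?_)
        rw [← Real.exp_nat_mul]
        congr 1
        have : (j : ℝ) ≠ 0 := (Real.sqrt_pos.1 hj).ne'
        rw [← hκ, div_pow, Real.sq_sqrt (Nat.cast_nonneg j)]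
        field_simp
      · rw [Set.indicator_of_notMem hu, norm_zero]
        positivity
    · refine Eventually.of_forall fun u => ?_
      refine (tendsto_fourierIntegrand_div_sqrt m u).congr' ?_
      have h : Tendsto (fun j : ℕ => Real.pi * √j) atTop atTop :=
        (Real.tendsto_sqrt_atTop.comp tendsto_natCast_atTop_atTop).const_mul_atTop hpi
      filter_upwards [h.eventually_gt_atTop |u|] with j hj
      rw [Set.indicator_of_mem]
      exact ⟨by linarith [neg_abs_le u], by linarith [le_abs_self u]⟩
  rw [integral_complex_ofReal, integral_gaussian] at hlim
  have h2 := (Complex.continuous_re.tendsto _).comp (hlim.const_mul ((2 * Real.pi : ℂ)⁻¹))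
  have e : ((2 * Real.pi : ℂ)⁻¹ * ((√(Real.pi / m) : ℝ) : ℂ)).re =
      (2 * Real.pi)⁻¹ * √(Real.pi / m) := by
    rw [← Complex.ofReal_ofNat, ← Complex.ofReal_mul, ← Complex.ofReal_inv,
      ← Complex.ofReal_mul, Complex.ofReal_re]
  rw [e] at h2
  refine h2.congr' ?_
  filter_upwards [eventually_gt_atTop 0] with j hj
  have hj' : 0 < √(j : ℝ) := Real.sqrt_pos.2 (by exact_mod_cast hj)
  have hle : -(Real.pi * √j) ≤ Real.pi * √j := by nlinarith
  rw [Function.comp_apply, integral_indicator measurableSet_Ioc,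
    ← intervalIntegral.integral_of_le hle, intervalIntegral.integral_comp_div _ hj'.ne',
    neg_div, mul_div_cancel_right₀ _ hj'.ne', transProb, ← Complex.re_ofReal_mul,
    Complex.real_smul]
  congr 1
  ring

open Filter Topology in
lemma tendsto_sum_transProb_div_sqrt {m : ℕ} (hm : 0 < m) :
    Tendsto (fun n : ℕ => (∑ j ∈ Finset.range n, transProb m j j) / √n) atTop
      (𝓝 (1 / √(Real.pi * m))) := by
  have hpi := Real.pi_pos
  set L : ℝ := 1 / √(Real.pi * m) with hL
  have hm' : (0 : ℝ) < m := by exact_mod_cast hm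
  have hLc : L = (2 * Real.pi)⁻¹ * √(Real.pi / m) * 2 := by
    have h1 : √(Real.pi / m) = Real.pi / √(Real.pi * m) := by
      rw [eq_div_iff (by positivity), ← Real.sqrt_mul (by positivity),
        show Real.pi / m * (Real.pi * m) = Real.pi ^ 2 by field_simp, Real.sqrt_sq hpi.le]
    rw [h1, hL]
    field_simp
  set g : ℕ → ℝ := fun j => √((j + 1 : ℕ) : ℝ) - √j with hg
  have hg0 (j : ℕ) : 0 < g j :=
    sub_pos.2 (Real.sqrt_lt_sqrt (Nat.cast_nonneg j) (by push_cast; linarith))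
  have hginv (j : ℕ) : (g j)⁻¹ = √((j + 1 : ℕ) : ℝ) + √j := by
    refine inv_eq_of_mul_eq_one_right ?_
    have h1 := Real.sq_sqrt (Nat.cast_nonneg (α := ℝ) (j + 1))
    have h2 := Real.sq_sqrt (Nat.cast_nonneg (α := ℝ) j)
    push_cast at h1
    simp only [hg]
    push_cast
    linear_combination h1 - h2
  have hsum (n : ℕ) : ∑ j ∈ Finset.range n, g j = √n := by
    rw [hg, Finset.sum_range_sub (fun j : ℕ => √(j : ℝ))]
    simp
  have hsqrt : Tendsto (fun n : ℕ => √(n : ℝ)) atTop atTop :=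
    Real.tendsto_sqrt_atTop.comp tendsto_natCast_atTop_atTop
  have hratio : Tendsto (fun j : ℕ => transProb m j j / g j) atTop (𝓝 L) := by
    have h1 : Tendsto (fun j : ℕ => √(1 + 1 / (j : ℝ)) + 1) atTop (𝓝 2) := by
      have h := (Real.continuous_sqrt.tendsto _).comp
        (tendsto_one_div_atTop_nhds_zero_nat (𝕜 := ℝ) |>.const_add 1)
      have := h.add_const 1
      simpa [Function.comp_def, one_add_one_eq_two] using this
    have h2 := (tendsto_sqrt_mul_transProb hm).mul h1
    rw [← hLc] at h2
    refine h2.congr' ?_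
    filter_upwards [eventually_gt_atTop 0] with j hj
    have hj' : (0 : ℝ) < j := by exact_mod_cast hj
    have e : √((j + 1 : ℕ) : ℝ) = √j * √(1 + 1 / (j : ℝ)) := by
      rw [← Real.sqrt_mul hj'.le]
      congr 1
      push_cast
      field_simp
    rw [div_eq_mul_inv (transProb m j j), hginv, e]
    ring
  have ho : (fun j => transProb m j j - L * g j) =o[atTop] g := by
    rw [Asymptotics.isLittleO_iff_tendsto fun j hj => absurd hj (hg0 j).ne']
    have h := hratio.sub_const L
    rw [sub_self] at h
    refine h.congr fun j => ?_
    have := (hg0 j).ne'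
    field_simp
  have hS := ho.sum_range (fun j => (hg0 j).le) (by simpa only [hsum] using hsqrt)
  simp only [Finset.sum_sub_distrib, ← Finset.mul_sum, hsum] at hS
  have h := hS.tendsto_div_nhds_zero.add_const L
  rw [zero_add] at h
  refine h.congr' ?_
  filter_upwards [eventually_gt_atTop 0] with n hn
  have : √(n : ℝ) ≠ 0 := (Real.sqrt_pos.2 (by exact_mod_cast hn)).ne'
  field_simp
  ring

/-- The `m`-step weight from `j` to `k` of the paths of `negBinKernel` whose later positions all
lie below `n`. -/
noncomputable def truncProb (n : ℕ) : ℕ → ℕ → ℕ → ℝ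
  | 0, j, k => if j = k then 1 else 0
  | m + 1, j, k => ∑ l ∈ Finset.range n, negBinKernel j l * truncProb n m l k

lemma truncProb_nonneg (n m j k : ℕ) : 0 ≤ truncProb n m j k := by
  induction m generalizing j with
  | zero => rw [truncProb]; split_ifs <;> simp
  | succ m ih =>
    exact Finset.sum_nonneg fun l _ => mul_nonneg (negBinKernel_pos j l).le (ih l)

lemma truncProb_le_transProb (n m j k : ℕ) : truncProb n m j k ≤ transProb m j k := by
  induction m generalizing j with
  | zero => rw [truncProb, transProb_zero]
  | succ m ih =>
    have h := hasSum_negBinKernel_mul_transProb m j k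
    refine (Finset.sum_le_sum fun l _ =>
      mul_le_mul_of_nonneg_left (ih l) (negBinKernel_pos j l).le).trans ?_
    exact sum_le_hasSum _ (fun l _ => mul_nonneg (negBinKernel_pos j l).le
      (transProb_nonneg_and_le_one m l k).1) h

lemma transProb_sub_truncProb_le {n c : ℕ} (hc : c < n) (m k j : ℕ) (hj : j < n) :
    transProb m j k - truncProb n m j k ≤
      (((j : ℝ) - c) ^ 2 + 5 * n * m) / ((n : ℝ) - c) ^ 2 := by
  have hcn : (0 : ℝ) < (n : ℝ) - c := by
    have : (c : ℝ) < n := by exact_mod_cast hc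
    linarith
  induction m generalizing j with
  | zero => rw [truncProb, transProb_zero, sub_self]; positivity
  | succ m ih =>
    have h1 := hasSum_negBinKernel_mul_transProb m j k
    have h2 : HasSum (fun l => if l < n then negBinKernel j l * truncProb n m l k else 0)
        (truncProb n (m + 1) j k) := by
      rw [truncProb]
      convert! hasSum_sum_of_ne_finset_zero (s := Finset.range n)
        (f := fun l => if l < n then negBinKernel j l * truncProb n m l k else 0) ?_ using 1
      · exact Finset.sum_congr rfl fun l hl => by rw [if_pos (Finset.mem_range.1 hl)]
      · intro l hl
        rw [if_neg (by simpa using hl)]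
      · infer_instance
    have h3 := (((hasSum_negBinKernel_mul_sub_sq j c).add
      ((hasSum_negBinKernel j).mul_right (5 * (n : ℝ) * m))).div_const (((n : ℝ) - c) ^ 2))
    refine (hasSum_le (fun l => ?_) (h1.sub h2) h3).trans ?_
    · rw [← mul_add, mul_div_assoc]
      have hpos := (negBinKernel_pos j l).le
      split_ifs with hl
      · rw [← mul_sub]
        exact mul_le_mul_of_nonneg_left (ih l hl) hpos
      · rw [sub_zero]
        refine mul_le_mul_of_nonneg_left ((transProb_nonneg_and_le_one m l k).2.trans ?_) hpos
        rw [one_le_div (by positivity)]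
        have hl' : (n : ℝ) ≤ l := by exact_mod_cast not_lt.1 hl
        have : ((n : ℝ) - c) ^ 2 ≤ ((l : ℝ) - c) ^ 2 :=
          pow_le_pow_left₀ hcn.le (by linarith) 2
        have : (0 : ℝ) ≤ 5 * n * m := by positivity
        linarith
    · have hj' : (j : ℝ) + 1 ≤ n := by exact_mod_cast hj
      have : (0 : ℝ) ≤ c := by positivity
      refine div_le_div_of_nonneg_right ?_ (by positivity)
      push_cast
      nlinarith

lemma Gamma_two_mul_natCast_add_half (j : ℕ) :
    Real.Gamma (j + 1 / 2) * 4 ^ j * j.factorial = √Real.pi * (2 * j).factorial := by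
  have h := Real.Gamma_mul_Gamma_add_half ((j : ℝ) + 1 / 2)
  rw [show (j : ℝ) + 1 / 2 + 1 / 2 = j + 1 by ring, Real.Gamma_nat_eq_factorial,
    show 2 * ((j : ℝ) + 1 / 2) = ((2 * j : ℕ) : ℝ) + 1 by push_cast; ring,
    Real.Gamma_nat_eq_factorial, show 1 - (((2 * j : ℕ) : ℝ) + 1) = -((2 * j : ℕ) : ℝ) by ring,
    Real.rpow_neg (by norm_num), Real.rpow_natCast, pow_mul] at h
  rw [mul_right_comm, h]
  norm_num
  field_simp

/-- The diagonal weight which conjugates `negBinKernel` to a symmetric kernel. -/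
noncomputable def symmWeight (j : ℕ) : ℝ :=
  √(2 * j).factorial / (2 ^ j * j.factorial)

lemma symmWeight_pos (j : ℕ) : 0 < symmWeight j := by
  unfold symmWeight; positivity

lemma ginibreM_apply (n : ℕ) (j k : Fin n) :
    ginibreM n j k = symmWeight j * negBinKernel j k / symmWeight k := by
  have hA : Real.Gamma (((j : ℕ) + 1 : ℝ) + ((k : ℕ) + 1 : ℝ) - 3 / 2) =
      Real.Gamma ((j : ℕ) + (k : ℕ) + 1 / 2) := by congr 1; ring
  have hB (i : ℕ) : Real.Gamma (2 * ((i : ℕ) + 1 : ℝ) - 1) = (2 * i).factorial := by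
    rw [← Real.Gamma_nat_eq_factorial]; congr 1; push_cast; ring
  have hG : Real.Gamma ((j : ℕ) + 1 / 2) =
      √Real.pi * (2 * (j : ℕ)).factorial / (4 ^ (j : ℕ) * (j : ℕ).factorial) := by
    rw [eq_div_iff (by positivity), ← Gamma_two_mul_natCast_add_half]; ring
  have hj : (√((2 * (j : ℕ)).factorial : ℝ)) ^ 2 = (2 * (j : ℕ)).factorial :=
    Real.sq_sqrt (Nat.cast_nonneg _)
  have hf : (0 : ℝ) < √((2 * (j : ℕ)).factorial : ℝ) := by positivity
  have h4 : (4 : ℝ) ^ (j : ℕ) = (2 ^ (j : ℕ)) ^ 2 := by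
    rw [← pow_mul, mul_comm, pow_mul]; norm_num
  simp only [ginibreM, Matrix.of_apply, hA, hB, negBinKernel, symmWeight, hG]
  rw [Real.sqrt_mul (by positivity), Real.sqrt_mul (by positivity), ← hj, h4, pow_add,
    Real.sqrt_sq hf.le]
  field_simp

lemma ginibreM_pow_apply (n m : ℕ) (j k : Fin n) :
    (ginibreM n ^ m) j k = symmWeight j * truncProb n m j k / symmWeight k := by
  induction m generalizing j with
  | zero =>
    rw [pow_zero, Matrix.one_apply, truncProb]
    simp only [Fin.val_inj]
    split_ifs with h
    · subst h; rw [mul_one, div_self (symmWeight_pos _).ne']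
    · simp
  | succ m ih =>
    rw [pow_succ', Matrix.mul_apply, truncProb, Finset.mul_sum, Finset.sum_div,
      ← Fin.sum_univ_eq_sum_range
        (fun l => symmWeight j * (negBinKernel j l * truncProb n m l k) / symmWeight k)]
    refine Finset.sum_congr rfl fun l _ => ?_
    have := (symmWeight_pos l).ne'
    rw [ih, ginibreM_apply]
    field_simp

lemma trace_ginibreM_pow (n m : ℕ) :
    Matrix.trace (ginibreM n ^ m) = ∑ j ∈ Finset.range n, truncProb n m j j := by
  rw [Matrix.trace, ← Fin.sum_univ_eq_sum_range (fun j => truncProb n m j j)]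
  refine Finset.sum_congr rfl fun j _ => ?_
  rw [Matrix.diag_apply, ginibreM_pow_apply, mul_div_cancel_left₀ _ (symmWeight_pos _).ne']

lemma sum_transProb_sub_le_trace (n m d : ℕ) (hd : 0 < d) :
    ∑ j ∈ Finset.range (n - d), transProb m j j - 5 * m * n ^ 2 / d ^ 2 ≤
      Matrix.trace (ginibreM n ^ m) := by
  have hle : ∑ j ∈ Finset.range (n - d), truncProb n m j j ≤
      Matrix.trace (ginibreM n ^ m) := by
    rw [trace_ginibreM_pow]
    exact Finset.sum_le_sum_of_subset_of_nonneg (Finset.range_mono (Nat.sub_le n d))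
      fun j _ _ => truncProb_nonneg n m j j
  have hd' : (0 : ℝ) < d := by exact_mod_cast hd
  have hbound : ∑ j ∈ Finset.range (n - d), (transProb m j j - truncProb n m j j) ≤
      5 * m * n ^ 2 / d ^ 2 := by
    have hterm : ∀ j ∈ Finset.range (n - d),
        transProb m j j - truncProb n m j j ≤ 5 * n * m / d ^ 2 := by
      intro j hj
      have hjd : j + d < n := by have := Finset.mem_range.1 hj; omega
      have hjd' : (j : ℝ) + d ≤ n := by exact_mod_cast hjd.le
      refine (transProb_sub_truncProb_le (c := j) (by omega) m j j (by omega)).trans ?_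
      rw [sub_self, zero_pow two_ne_zero, zero_add]
      gcongr
      linarith
    refine (Finset.sum_le_card_nsmul _ _ _ hterm).trans ?_
    rw [Finset.card_range, nsmul_eq_mul]
    have : ((n - d : ℕ) : ℝ) ≤ n := by exact_mod_cast Nat.sub_le n d
    exact (mul_le_mul_of_nonneg_right this (by positivity)).trans_eq (by ring)
  rw [Finset.sum_sub_distrib] at hbound
  linarith

open Filter Topology in
lemma tendsto_trace_ginibreM_pow_div_sqrt {m : ℕ} (hm : 0 < m) :
    Tendsto (fun n : ℕ => Matrix.trace (ginibreM n ^ m) / √n) atTop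
      (𝓝 (1 / √(Real.pi * m))) := by
  set S : ℕ → ℝ := fun n => ∑ j ∈ Finset.range n, transProb m j j
  have hS := tendsto_sum_transProb_div_sqrt hm
  set d : ℕ → ℕ := fun n => ⌈(n : ℝ) ^ (7 / 8 : ℝ)⌉₊
  have hcast : Tendsto (fun n : ℕ => (n : ℝ)) atTop atTop := tendsto_natCast_atTop_atTop
  have hdn : Tendsto (fun n : ℕ => (d n : ℝ) / n) atTop (𝓝 0) := by
    have hup : Tendsto (fun n : ℕ => (n : ℝ) ^ (-(1 / 8) : ℝ) + 1 / n) atTop (𝓝 0) := by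
      simpa using ((tendsto_rpow_neg_atTop (y := 1 / 8) (by norm_num)).comp hcast).add
        (tendsto_one_div_atTop_nhds_zero_nat (𝕜 := ℝ))
    refine squeeze_zero' (Eventually.of_forall fun n => by positivity) ?_ hup
    filter_upwards [eventually_gt_atTop 0] with n hn
    have hn' : (0 : ℝ) < n := by exact_mod_cast hn
    rw [div_le_iff₀ hn', add_mul, ← Real.rpow_add_one hn'.ne', one_div_mul_cancel hn'.ne']
    refine (Nat.ceil_lt_add_one (by positivity)).le.trans_eq ?_
    norm_num
  have hsub : Tendsto (fun n : ℕ => ((n - d n : ℕ) : ℝ) / n) atTop (𝓝 1) := by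
    have h := hdn.const_sub 1
    rw [sub_zero] at h
    refine h.congr' ?_
    filter_upwards [eventually_gt_atTop 0, hdn.eventually_lt_const one_pos] with n hn hlt
    have hn' : (0 : ℝ) < n := by exact_mod_cast hn
    rw [div_lt_one hn'] at hlt
    rw [Nat.cast_sub (by exact_mod_cast hlt.le), sub_div, div_self hn'.ne']
  have hsub_top : Tendsto (fun n : ℕ => n - d n) atTop atTop := by
    rw [← tendsto_natCast_atTop_iff (R := ℝ)]
    refine (hsub.pos_mul_atTop one_pos hcast).congr' ?_
    filter_upwards [eventually_gt_atTop 0] with n hn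
    have hn' : (0 : ℝ) < n := by exact_mod_cast hn
    field_simp
  have herr : Tendsto (fun n : ℕ => 5 * (m : ℝ) * n ^ 2 / (d n) ^ 2 / √n) atTop (𝓝 0) := by
    have hup : Tendsto (fun n : ℕ => 5 * (m : ℝ) * (n : ℝ) ^ (-(1 / 4) : ℝ)) atTop (𝓝 0) := by
      simpa using ((tendsto_rpow_neg_atTop (y := 1 / 4) (by norm_num)).comp hcast).const_mul
        (5 * (m : ℝ))
    refine squeeze_zero' (Eventually.of_forall fun n => by positivity) ?_ hup
    filter_upwards [eventually_gt_atTop 0] with n hn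
    have hn' : (0 : ℝ) < n := by exact_mod_cast hn
    have hd2 : (n : ℝ) ^ (7 / 4 : ℝ) ≤ (d n : ℝ) ^ 2 := by
      have h := pow_le_pow_left₀ (by positivity) (Nat.le_ceil ((n : ℝ) ^ (7 / 8 : ℝ))) 2
      rw [← Real.rpow_mul_natCast hn'.le] at h
      norm_num at h ⊢
      exact h
    have e : (n : ℝ) ^ 2 = (n : ℝ) ^ (-(1 / 4) : ℝ) * √n * (n : ℝ) ^ (7 / 4 : ℝ) := by
      rw [Real.sqrt_eq_rpow, ← Real.rpow_add hn', ← Real.rpow_add hn', ← Real.rpow_natCast]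
      norm_num
    have hpos : (0 : ℝ) < (d n : ℝ) ^ 2 := lt_of_lt_of_le (by positivity) hd2
    rw [div_div, div_le_iff₀ (by positivity), e]
    calc 5 * (m : ℝ) * ((n : ℝ) ^ (-(1 / 4) : ℝ) * √n * (n : ℝ) ^ (7 / 4 : ℝ))
        ≤ 5 * (m : ℝ) * ((n : ℝ) ^ (-(1 / 4) : ℝ) * √n * (d n : ℝ) ^ 2) := by gcongr
      _ = _ := by ring
  have hlow : Tendsto (fun n : ℕ => S (n - d n) / √((n - d n : ℕ) : ℝ) *
      √(((n - d n : ℕ) : ℝ) / n) - 5 * (m : ℝ) * n ^ 2 / (d n) ^ 2 / √n) atTop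
      (𝓝 (1 / √(Real.pi * m))) := by
    have h := ((hS.comp hsub_top).mul ((Real.continuous_sqrt.tendsto _).comp hsub)).sub herr
    simpa [Function.comp_def] using h
  refine tendsto_of_tendsto_of_tendsto_of_le_of_le' hlow hS ?_ ?_
  · filter_upwards [eventually_gt_atTop 0, hsub_top.eventually_gt_atTop 0] with n hn hn2
    have hn2' : (0 : ℝ) < √((n - d n : ℕ) : ℝ) := Real.sqrt_pos.2 (by exact_mod_cast hn2)
    have hd : 0 < d n := Nat.ceil_pos.2 (by positivity)
    rw [Real.sqrt_div (Nat.cast_nonneg _), div_mul_div_cancel₀ hn2'.ne', ← sub_div]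
    exact div_le_div_of_nonneg_right (sum_transProb_sub_le_trace n m (d n) hd)
      (Real.sqrt_nonneg _)
  · refine Eventually.of_forall fun n => ?_
    rw [trace_ginibreM_pow]
    exact div_le_div_of_nonneg_right
      (Finset.sum_le_sum fun j _ => truncProb_le_transProb n m j j) (Real.sqrt_nonneg _)

theorem stmt5 (m : ℕ) (hm : 0 < m) :
    Filter.Tendsto
      (fun n : ℕ => (1 / Real.sqrt (2 * n)) * Matrix.trace (ginibreM n ^ m))
      Filter.atTop (nhds (1 / Real.sqrt (2 * Real.pi * m))) := by
  have h := (tendsto_trace_ginibreM_pow_div_sqrt hm).const_mul (1 / √2)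
  convert! h using 1
  · funext n
    rw [Real.sqrt_mul (by norm_num)]
    ring
  · rw [mul_assoc, Real.sqrt_mul (by norm_num), one_div_mul_one_div]
end

section
/- Let $M_n$ be the $n\times n$ real symmetric matrix with entries $M_n(j,k) = \frac{1}{\sqrt{2\pi}}\,\frac{\Gamma(j+k-3/2)}{\sqrt{\Gamma(2j-1)\Gamma(2k-1)}}$ for $1\le j,k\le n$. Then for all positive integers $m$ and $n$, $\mathrm{Tr}(M_n^m) \le \sqrt{\frac{n}{\pi m}}\,(1 + n^{-1}) + \frac{1}{4} + \frac{1}{8}\sqrt{\frac{m}{\pi n}}\,(1 + 2 n^{-1})$. -/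
open Polynomial MeasureTheory Real

/-- The probabilists' Hermite polynomial with real coefficients. -/
noncomputable def hermiteReal (a : ℕ) : ℝ[X] := (hermite a).map (Int.castRingHom ℝ)

theorem hermiteReal_succ (a : ℕ) :
    hermiteReal (a + 1) = X * hermiteReal a - derivative (hermiteReal a) := by
  simp [hermiteReal, hermite_succ, derivative_map]

theorem derivative_hermiteReal (a : ℕ) :
    derivative (hermiteReal a) = C (a : ℝ) * hermiteReal (a - 1) := by
  induction a with
  | zero => simp [hermiteReal]
  | succ a ih =>
    rw [hermiteReal_succ, derivative_sub, derivative_mul, derivative_X, ih, derivative_mul,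
      derivative_C]
    rcases a with _ | a
    · simp [hermiteReal]
    · simp only [Nat.add_sub_cancel, hermiteReal_succ a]
      push_cast
      simp only [C_add, C_1]
      ring

/-- The integral of the polynomial `P` against the weight `exp (-s x² / 2)`. -/
noncomputable def gaussInt (s : ℝ) (P : ℝ[X]) : ℝ := ∫ x : ℝ, P.eval x * exp (-(s / 2) * x ^ 2)

theorem integrable_eval_mul_exp {s : ℝ} (hs : 0 < s) (P : ℝ[X]) :
    Integrable fun x : ℝ => P.eval x * exp (-(s / 2) * x ^ 2) := by
  induction P using Polynomial.induction_on' with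
  | add p q hp hq =>
    simp only [eval_add, add_mul]
    exact hp.add hq
  | monomial n a =>
    have h := integrable_rpow_mul_exp_neg_mul_sq (half_pos hs) (s := (n : ℝ))
      (by have := n.cast_nonneg (α := ℝ); linarith)
    simpa [mul_assoc] using h.const_mul a

theorem gaussInt_add {s : ℝ} (hs : 0 < s) (P Q : ℝ[X]) :
    gaussInt s (P + Q) = gaussInt s P + gaussInt s Q := by
  simp only [gaussInt, eval_add, add_mul]
  exact integral_add (integrable_eval_mul_exp hs P) (integrable_eval_mul_exp hs Q)

theorem gaussInt_C_mul (s a : ℝ) (P : ℝ[X]) : gaussInt s (C a * P) = a * gaussInt s P := by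
  simp only [gaussInt, eval_mul, eval_C, mul_assoc]
  exact integral_const_mul a _

theorem gaussInt_sum {ι : Type*} {s : ℝ} (hs : 0 < s) (t : Finset ι) (P : ι → ℝ[X]) :
    gaussInt s (∑ i ∈ t, P i) = ∑ i ∈ t, gaussInt s (P i) := by
  simp only [gaussInt, eval_finsetSum, Finset.sum_mul]
  exact integral_finsetSum _ fun i _ => integrable_eval_mul_exp hs (P i)

theorem gaussInt_one (s : ℝ) : gaussInt s 1 = √(2 * π / s) := by
  simp only [gaussInt, eval_one, one_mul, integral_gaussian]
  congr 1
  rw [div_div_eq_mul_div, mul_comm]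

theorem gaussInt_X_mul {s : ℝ} (hs : 0 < s) (P : ℝ[X]) :
    s * gaussInt s (X * P) = gaussInt s (derivative P) := by
  have key : gaussInt s (derivative P + C (-s) * (X * P)) = 0 := by
    refine integral_eq_zero_of_hasDerivAt_of_integrable
      (f := fun x : ℝ => P.eval x * exp (-(s / 2) * x ^ 2)) (fun x => ?_)
      (integrable_eval_mul_exp hs _) (integrable_eval_mul_exp hs P)
    have h : HasDerivAt (fun x : ℝ => -(s / 2) * x ^ 2) (-s * x) x := by
      refine ((hasDerivAt_pow 2 x).const_mul (-(s / 2))).congr_deriv ?_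
      push_cast; ring
    refine ((P.hasDerivAt x).mul h.exp).congr_deriv ?_
    simp only [eval_add, eval_mul, eval_C, eval_X]
    ring
  rw [gaussInt_add hs, gaussInt_C_mul] at key
  linarith

/-- The integral of the product of two Hermite polynomials against `exp (-s x² / 2)`. -/
noncomputable def hermiteInt (s : ℝ) (a b : ℕ) : ℝ := gaussInt s (hermiteReal a * hermiteReal b)

theorem hermiteInt_comm (s : ℝ) (a b : ℕ) : hermiteInt s a b = hermiteInt s b a := by
  rw [hermiteInt, mul_comm, hermiteInt]

theorem hermiteInt_zero_zero (s : ℝ) : hermiteInt s 0 0 = √(2 * π / s) := by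
  simp [hermiteInt, hermiteReal, gaussInt_one]

theorem hermiteInt_succ {s : ℝ} (hs : 0 < s) (a b : ℕ) :
    s * hermiteInt s (a + 1) b =
      b * hermiteInt s a (b - 1) - (s - 1) * a * hermiteInt s (a - 1) b := by
  have h1 : hermiteReal (a + 1) * hermiteReal b = X * (hermiteReal a * hermiteReal b) +
      C (-(a : ℝ)) * (hermiteReal (a - 1) * hermiteReal b) := by
    rw [hermiteReal_succ, derivative_hermiteReal, C_neg]; ring
  have h2 := gaussInt_X_mul hs (hermiteReal a * hermiteReal b)
  have h3 : derivative (hermiteReal a * hermiteReal b) =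
      C (a : ℝ) * (hermiteReal (a - 1) * hermiteReal b) +
      C (b : ℝ) * (hermiteReal a * hermiteReal (b - 1)) := by
    rw [derivative_mul, derivative_hermiteReal, derivative_hermiteReal]; ring
  rw [h3, gaussInt_add hs, gaussInt_C_mul, gaussInt_C_mul] at h2
  simp only [hermiteInt]
  rw [h1, gaussInt_add hs, gaussInt_C_mul, mul_add, h2]
  ring

theorem hermiteInt_one (a b : ℕ) :
    hermiteInt 1 a b = if a = b then (a.factorial : ℝ) * √(2 * π) else 0 := by
  have hrec (a b : ℕ) : hermiteInt 1 (a + 1) b = b * hermiteInt 1 a (b - 1) := by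
    simpa using hermiteInt_succ one_pos a b
  induction a generalizing b with
  | zero =>
    rcases b with _ | b
    · simp [hermiteInt_zero_zero]
    · rw [hermiteInt_comm, hrec]; simp
  | succ a ih =>
    rw [hrec]
    rcases b with _ | b
    · simp
    · rw [Nat.add_sub_cancel, ih]
      by_cases h : a = b
      · subst h; simp [Nat.factorial_succ]; ring
      · simp [h]

theorem hermiteInt_two (d a b : ℕ) (h : a + b = 2 * d) :
    hermiteInt 2 a b = (-1) ^ (d + b) * Gamma (d + 1 / 2) := by
  have hrec (a b : ℕ) : 2 * hermiteInt 2 (a + 1) b =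
      b * hermiteInt 2 a (b - 1) - a * hermiteInt 2 (a - 1) b := by
    have := hermiteInt_succ two_pos a b
    rw [this]; ring
  induction d generalizing a b with
  | zero =>
    obtain ⟨rfl, rfl⟩ : a = 0 ∧ b = 0 := by omega
    rw [hermiteInt_zero_zero]
    simp [Gamma_one_half_eq, -one_div]
  | succ d ih =>
    have hG : Gamma ((d + 1 : ℕ) + 1 / 2 : ℝ) = (d + 1 / 2) * Gamma (d + 1 / 2) := by
      rw [← Gamma_add_one (by positivity)]; push_cast; ring_nf
    have main (a b : ℕ) (h : a + 1 + b = 2 * (d + 1)) :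
        hermiteInt 2 (a + 1) b = (-1) ^ (d + 1 + b) * Gamma ((d + 1 : ℕ) + 1 / 2) := by
      have e1 : (b : ℝ) * hermiteInt 2 a (b - 1) =
          b * ((-1) ^ (d + 1 + b) * Gamma (d + 1 / 2)) := by
        rcases b with _ | b
        · simp
        · rw [Nat.add_sub_cancel, ih a b (by omega)]; ring
      have e2 : (a : ℝ) * hermiteInt 2 (a - 1) b =
          a * ((-1) ^ (d + b) * Gamma (d + 1 / 2)) := by
        rcases a with _ | a
        · simp
        · rw [Nat.add_sub_cancel, ih a b (by omega)]
      have := hrec a b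
      rw [e1, e2] at this
      have hab : (a : ℝ) + b = 2 * d + 1 := by exact_mod_cast (by omega : a + b = 2 * d + 1)
      have ha : (a : ℝ) = 2 * d + 1 - b := by linarith
      rw [ha] at this
      rw [hG]
      linear_combination this / 2
    rcases a with _ | a
    · obtain rfl : b = 2 * d + 1 + 1 := by omega
      rw [hermiteInt_comm, main _ _ (by omega)]
      congr 1
      rw [show d + 1 + (2 * d + 1 + 1) = 2 * (d + 1) + (d + 1 + 0) by ring, pow_add _ (2 * (d + 1)),
        pow_mul]
      simp
    · exact main a b h

/-- The unnormalized moments of `1 / s + (s - 1) / s * cos θ` for `θ` uniform on `[0, π]`. -/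
noncomputable def cosMoment (s : ℝ) (a : ℕ) : ℝ :=
  ∫ θ in (0)..π, (1 / s + (s - 1) / s * cos θ) ^ a

/-- The moments of `cosMoment` weighted by `cos θ`. -/
noncomputable def cosMoment' (s : ℝ) (a : ℕ) : ℝ :=
  ∫ θ in (0)..π, (1 / s + (s - 1) / s * cos θ) ^ a * cos θ

theorem cosMoment_succ (s : ℝ) (a : ℕ) :
    cosMoment s (a + 1) = 1 / s * cosMoment s a + (s - 1) / s * cosMoment' s a := by
  simp only [cosMoment, cosMoment', ← intervalIntegral.integral_const_mul]
  rw [← intervalIntegral.integral_add (by apply Continuous.intervalIntegrable; fun_prop)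
    (by apply Continuous.intervalIntegrable; fun_prop)]
  congr 1; ext θ; ring

theorem cosMoment'_succ (s : ℝ) (a : ℕ) :
    (a + 2) * cosMoment' s (a + 1) =
      (a + 1) * (1 / s * cosMoment' s a + (s - 1) / s * cosMoment s a) := by
  set x : ℝ → ℝ := fun θ => 1 / s + (s - 1) / s * cos θ with hx
  have hd (θ : ℝ) : HasDerivAt (fun θ => x θ ^ (a + 1) * sin θ)
      ((a + 2) * (x θ ^ (a + 1) * cos θ) +
        (-((a + 1) / s) * (x θ ^ a * cos θ) + -((a + 1) * ((s - 1) / s)) * x θ ^ a)) θ := by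
    have h1 : HasDerivAt x ((s - 1) / s * (-sin θ)) θ :=
      ((hasDerivAt_cos θ).const_mul _).const_add _
    refine ((h1.pow (a + 1)).mul (hasDerivAt_sin θ)).congr_deriv ?_
    have := sin_sq θ
    simp only [Nat.add_sub_cancel, Nat.cast_add, Nat.cast_one, pow_succ, hx, Pi.pow_apply]
    linear_combination -(a + 1) * ((s - 1) / s) * (1 / s + (s - 1) / s * cos θ) ^ a * this
  have h := intervalIntegral.integral_eq_sub_of_hasDerivAt (a := 0) (b := π) (fun θ _ => hd θ)
    (by apply Continuous.intervalIntegrable; fun_prop)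
  rw [intervalIntegral.integral_add (by apply Continuous.intervalIntegrable; fun_prop)
    (by apply Continuous.intervalIntegrable; fun_prop),
    intervalIntegral.integral_add (by apply Continuous.intervalIntegrable; fun_prop)
    (by apply Continuous.intervalIntegrable; fun_prop)] at h
  simp only [intervalIntegral.integral_const_mul, sin_pi, sin_zero, mul_zero, sub_zero] at h
  simp only [cosMoment, cosMoment']
  linear_combination h

theorem cosMoment_zero (s : ℝ) : cosMoment s 0 = π := by simp [cosMoment]

theorem cosMoment'_zero (s : ℝ) : cosMoment' s 0 = 0 := by simp [cosMoment']

theorem sum_cosMoment {s : ℝ} (hs : s ≠ 0) (k : ℕ) :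
    ∑ a ∈ Finset.range (k + 1), cosMoment s a = (k + 1) * (cosMoment s k + cosMoment' s k) := by
  induction k with
  | zero => simp [cosMoment'_zero]
  | succ k ih =>
    rw [Finset.sum_range_succ, ih]
    have h1 := cosMoment_succ s k
    have h2 := cosMoment'_succ s k
    push_cast
    have : 1 / s + (s - 1) / s = 1 := by field_simp; ring
    linear_combination -(k + 1) * (cosMoment s k + cosMoment' s k) * this - h2 - (k + 1) * h1

theorem cosMoment_add_cosMoment'_le {s : ℝ} (hs : 1 < s) {k : ℕ} (hk : Odd k) :
    cosMoment s k + cosMoment' s k ≤ 2 * √(π / (2 * ((s - 1) / s) * k)) := by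
  set α := (s - 1) / s with hα
  have hα0 : 0 < α := div_pos (by linarith) (by linarith)
  have hβ : 1 / s = 1 - α := by rw [hα]; field_simp; ring
  set c := 2 * α * k with hc
  have hc0 : 0 < c := by have := hk.pos; positivity
  have hsub : ∫ θ in (0)..π, exp (-c * sin (θ / 2) ^ 2) * (cos (θ / 2) * (1 / 2)) =
      ∫ u in (0 : ℝ)..1, exp (-c * u ^ 2) := by
    have := intervalIntegral.integral_comp_mul_deriv (a := 0) (b := π)
      (f := fun θ => sin (θ / 2)) (f' := fun θ => cos (θ / 2) * (1 / 2))
      (g := fun u => exp (-c * u ^ 2))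
      (fun θ _ => ((hasDerivAt_id θ).div_const 2).sin) (by fun_prop) (by fun_prop)
    simpa using this
  have hle : ∫ u in (0 : ℝ)..1, exp (-c * u ^ 2) ≤ √(π / c) / 2 := by
    rw [← integral_gaussian_Ioi, intervalIntegral.integral_of_le zero_le_one]
    exact MeasureTheory.setIntegral_mono_set (integrable_exp_neg_mul_sq hc0).integrableOn
      (Filter.Eventually.of_forall fun _ => (exp_pos _).le)
      Set.Ioc_subset_Ioi_self.eventuallyLE
  have hsum : cosMoment s k + cosMoment' s k =
      ∫ θ in (0)..π, (1 / s + α * cos θ) ^ k * (1 + cos θ) := by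
    simp only [cosMoment, cosMoment']
    rw [← intervalIntegral.integral_add (by apply Continuous.intervalIntegrable; fun_prop)
      (by apply Continuous.intervalIntegrable; fun_prop)]
    congr 1; ext θ; ring
  have hmono : ∫ θ in (0)..π, (1 / s + α * cos θ) ^ k * (1 + cos θ) ≤
      ∫ θ in (0)..π, 4 * (exp (-c * sin (θ / 2) ^ 2) * (cos (θ / 2) * (1 / 2))) := by
    refine intervalIntegral.integral_mono_on pi_pos.le
      (by apply Continuous.intervalIntegrable; fun_prop)
      (by apply Continuous.intervalIntegrable; fun_prop) fun θ hθ => ?_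
    have hcos : cos θ = 2 * cos (θ / 2) ^ 2 - 1 := by rw [← cos_two_mul]; ring_nf
    have hs2 := sin_sq_add_cos_sq (θ / 2)
    have h0 : 0 ≤ cos (θ / 2) := cos_nonneg_of_mem_Icc ⟨by linarith [hθ.1, pi_pos], by linarith [hθ.2]⟩
    have h1 := cos_le_one (θ / 2)
    have hx : 1 / s + α * cos θ ≤ exp (-(2 * α) * sin (θ / 2) ^ 2) := by
      have := add_one_le_exp (-(2 * α) * sin (θ / 2) ^ 2)
      rw [hβ, hcos]
      linear_combination this + 2 * α * hs2
    have hpow : (1 / s + α * cos θ) ^ k ≤ exp (-c * sin (θ / 2) ^ 2) := by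
      refine (hk.strictMono_pow.monotone hx).trans_eq ?_
      rw [← exp_nat_mul, hc]; ring_nf
    have hcc : 1 + cos θ ≤ 2 * cos (θ / 2) := by rw [hcos]; nlinarith
    have hc1 : 0 ≤ 1 + cos θ := by linarith [neg_one_le_cos θ]
    calc _ ≤ exp (-c * sin (θ / 2) ^ 2) * (2 * cos (θ / 2)) :=
          mul_le_mul hpow hcc hc1 (exp_pos _).le
      _ = _ := by ring
  rw [intervalIntegral.integral_const_mul, hsub] at hmono
  linarith

theorem integral_inv_one_add_cos {s : ℝ} (hs : 1 < s) :
    ∫ θ in (0)..π, (1 + (1 / s + (s - 1) / s * cos θ))⁻¹ = π * √s / 2 := by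
  set σ := √s with hσ
  have hσ2 : s = σ ^ 2 := (sq_sqrt (by linarith)).symm
  have hσ1 : 1 < σ := by rw [hσ]; exact lt_sqrt_of_sq_lt (by simpa)
  have hden (θ : ℝ) : 0 < σ + 1 + (σ - 1) * cos θ := by nlinarith [neg_one_le_cos θ]
  have hden2 (θ : ℝ) : 0 < σ ^ 2 + 1 + (σ ^ 2 - 1) * cos θ := by nlinarith [neg_one_le_cos θ]
  have hx (θ : ℝ) : 1 + (1 / s + (s - 1) / s * cos θ) =
      (σ ^ 2 + 1 + (σ ^ 2 - 1) * cos θ) / σ ^ 2 := by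
    rw [hσ2]; field_simp; ring
  have hd (θ : ℝ) : HasDerivAt
      (fun θ => σ / 2 * (θ - 2 * arctan ((σ - 1) * sin θ / (σ + 1 + (σ - 1) * cos θ))))
      (1 + (1 / s + (s - 1) / s * cos θ))⁻¹ θ := by
    have h1 := ((hasDerivAt_sin θ).const_mul (σ - 1)).div
      (((hasDerivAt_cos θ).const_mul (σ - 1)).const_add (σ + 1)) (hden θ).ne'
    refine (((hasDerivAt_id θ).sub (h1.arctan.const_mul 2)).const_mul (σ / 2)).congr_deriv ?_
    rw [hx]
    have hu : 1 + ((σ - 1) * sin θ / (σ + 1 + (σ - 1) * cos θ)) ^ 2 =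
        2 * (σ ^ 2 + 1 + (σ ^ 2 - 1) * cos θ) / (σ + 1 + (σ - 1) * cos θ) ^ 2 := by
      have := (hden θ).ne'
      field_simp
      linear_combination (σ - 1) ^ 2 * sin_sq θ
    have e1 := (hden θ).ne'
    have e2 := (hden2 θ).ne'
    have hnum : (σ - 1) * cos θ * (σ + 1 + (σ - 1) * cos θ) - (σ - 1) * sin θ * ((σ - 1) * -sin θ) =
        (σ - 1) * (σ - 1 + (σ + 1) * cos θ) := by
      linear_combination (σ - 1) ^ 2 * sin_sq θ
    simp only [Pi.div_apply]
    rw [hu, hnum]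
    generalize σ + 1 + (σ - 1) * cos θ = D at e1
    generalize hE : σ ^ 2 + 1 + (σ ^ 2 - 1) * cos θ = E at e2
    field_simp
    rw [← hE]
    ring
  rw [intervalIntegral.integral_eq_sub_of_hasDerivAt (fun θ _ => hd θ)]
  · simp; ring
  · apply Continuous.intervalIntegrable
    refine Continuous.inv₀ (by fun_prop) fun θ => ?_
    rw [hx]
    have := hden2 θ
    positivity

theorem alternating_sum_cosMoment_le {s : ℝ} (hs : 1 < s) (n : ℕ) :
    ∑ a ∈ Finset.range (2 * n), (-1) ^ a * cosMoment s a ≤ π * √s / 2 := by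
  have hpos (θ : ℝ) : 0 < 1 + (1 / s + (s - 1) / s * cos θ) := by
    have : 1 + (1 / s + (s - 1) / s * cos θ) = 2 / s + (s - 1) / s * (1 + cos θ) := by
      field_simp; ring
    rw [this]
    have h1 : 0 ≤ 1 + cos θ := by linarith [neg_one_le_cos θ]
    have h2 : 0 < s - 1 := by linarith
    positivity
  rw [← integral_inv_one_add_cos hs]
  simp only [cosMoment, ← intervalIntegral.integral_const_mul]
  rw [← intervalIntegral.integral_finsetSum
    fun a _ => by apply Continuous.intervalIntegrable; fun_prop]
  refine intervalIntegral.integral_mono_on pi_pos.le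
    (by apply Continuous.intervalIntegrable; fun_prop) ?_ fun θ _ => ?_
  · apply Continuous.intervalIntegrable
    exact Continuous.inv₀ (by fun_prop) fun θ => (hpos θ).ne'
  · have hp := hpos θ
    set x := 1 / s + (s - 1) / s * cos θ
    have hgeom := geom_sum_mul (-x) (2 * n)
    rw [pow_mul, neg_sq] at hgeom
    simp only [← mul_pow, neg_one_mul]
    rw [← one_div, le_div_iff₀ hp]
    nlinarith [pow_nonneg (sq_nonneg x) n]

/-- The real Hermite polynomial `(-1) ^ j * He_{2j}`, normalized in `L²(exp (-x² / 2) dx)`. -/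
noncomputable def evenHermite (j : ℕ) : ℝ[X] :=
  C ((-1) ^ j / √((2 * j).factorial * √(2 * π))) * hermiteReal (2 * j)

theorem gaussInt_evenHermite_mul (s : ℝ) (j k : ℕ) :
    gaussInt s (evenHermite j * evenHermite k) =
      (-1) ^ j / √((2 * j).factorial * √(2 * π)) *
        ((-1) ^ k / √((2 * k).factorial * √(2 * π)) * hermiteInt s (2 * j) (2 * k)) := by
  rw [hermiteInt, ← gaussInt_C_mul, ← gaussInt_C_mul, evenHermite, evenHermite]
  congr 1; ring

theorem gaussInt_evenHermite_mul_self (s : ℝ) (j : ℕ) :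
    gaussInt s (evenHermite j * evenHermite j) =
      hermiteInt s (2 * j) (2 * j) / ((2 * j).factorial * √(2 * π)) := by
  have hpos : (0 : ℝ) < (2 * j).factorial * √(2 * π) := by positivity
  have h := mul_self_sqrt hpos.le
  have h0 : √((2 * j).factorial * √(2 * π)) ≠ 0 := (sqrt_pos.2 hpos).ne'
  have hsign : ((-1 : ℝ) ^ j) * (-1) ^ j = 1 := by rw [← mul_pow]; simp
  rw [gaussInt_evenHermite_mul, ← mul_assoc, div_mul_div_comm, h, hsign]
  ring

theorem gaussInt_one_evenHermite_mul (j k : ℕ) :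
    gaussInt 1 (evenHermite j * evenHermite k) = if j = k then 1 else 0 := by
  split_ifs with h
  · subst h
    rw [gaussInt_evenHermite_mul_self, hermiteInt_one, if_pos rfl]
    exact div_self (by positivity)
  · rw [gaussInt_evenHermite_mul, hermiteInt_one, if_neg (by omega)]
    simp

theorem gaussInt_two_evenHermite_mul {n : ℕ} (j k : Fin n) :
    gaussInt 2 (evenHermite j * evenHermite k) = ginibreM n j k := by
  have hG (i : ℕ) : Gamma (2 * ((i : ℝ) + 1) - 1) = (2 * i).factorial := by
    rw [← Gamma_nat_eq_factorial]; congr 1; push_cast; ring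
  have harg : ((j : ℕ) + 1 : ℝ) + ((k : ℕ) + 1) - 3 / 2 = ((j + k : ℕ) : ℝ) + 1 / 2 := by
    push_cast; ring
  have hsign : ((-1 : ℝ) ^ (j : ℕ)) * (-1) ^ (k : ℕ) * (-1) ^ (j + k + 2 * k : ℕ) = 1 := by
    rw [← pow_add, ← pow_add]
    exact Even.neg_one_pow ⟨j + 2 * k, by ring⟩
  rw [gaussInt_evenHermite_mul, hermiteInt_two (j + k) _ _ (by ring), ginibreM, Matrix.of_apply,
    hG, hG, harg, sqrt_mul (Nat.cast_nonneg _), sqrt_mul (Nat.cast_nonneg _),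
    sqrt_mul (Nat.cast_nonneg _)]
  have hq : √(2 * π) = √√(2 * π) ^ 2 := (sq_sqrt (sqrt_nonneg _)).symm
  have hq0 : √√(2 * π) ≠ 0 := by positivity
  generalize √√(2 * π) = q at hq hq0 ⊢
  rw [hq]
  field_simp
  linear_combination hsign

theorem pow_add_mul_pow_mul_sub_le_pow {t l : ℝ} (ht : 0 ≤ t) (hl : 0 ≤ l) (m : ℕ) :
    l ^ (m + 1) + (m + 1) * l ^ m * (t - l) ≤ t ^ (m + 1) := by
  induction m with
  | zero => simp
  | succ m ih =>
    have h1 := mul_le_mul_of_nonneg_left ih ht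
    have h2 : 0 ≤ (m + 1) * l ^ m * (t - l) ^ 2 := by positivity
    push_cast
    rw [pow_succ' t]
    refine le_trans ?_ h1
    linear_combination h2

/-- Jensen's inequality for the probability density `P² exp (-x² / 2)`. -/
theorem gaussInt_two_pow_le {P : ℝ[X]} (hP : gaussInt 1 (P * P) = 1) (m : ℕ) :
    gaussInt 2 (P * P) ^ (m + 1) ≤ gaussInt (m + 2) (P * P) := by
  set l := gaussInt 2 (P * P) with hl
  have hl0 : 0 ≤ l := integral_nonneg fun x => by
    simp only [eval_mul]
    exact mul_nonneg (mul_self_nonneg _) (exp_pos _).le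
  have i1 := (integrable_eval_mul_exp one_pos (P * P)).const_mul
    (l ^ (m + 1) - (m + 1) * l ^ m * l)
  have i2 := (integrable_eval_mul_exp two_pos (P * P)).const_mul ((m + 1) * l ^ m)
  have hmono := integral_mono (i1.add i2)
    (integrable_eval_mul_exp (by positivity : (0 : ℝ) < m + 2) (P * P)) fun x => ?_
  · rw [integral_add' i1 i2, integral_const_mul, integral_const_mul] at hmono
    rw [gaussInt] at hP hl ⊢
    rw [hP, ← hl] at hmono
    linarith
  · simp only [Pi.add_apply, eval_mul]
    have e1 : exp (-((2 : ℝ) / 2) * x ^ 2) =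
        exp (-(1 / 2) * x ^ 2) * exp (-(1 / 2) * x ^ 2) := by
      rw [← exp_add]; ring_nf
    have e2 : exp (-(((m : ℝ) + 2) / 2) * x ^ 2) =
        exp (-(1 / 2) * x ^ 2) * exp (-(1 / 2) * x ^ 2) ^ (m + 1) := by
      rw [← exp_nat_mul, ← exp_add]; push_cast; ring_nf
    rw [e1, e2]
    set w := exp (-((1 : ℝ) / 2) * x ^ 2)
    have hw : 0 ≤ w := (exp_pos _).le
    have := mul_le_mul_of_nonneg_left (pow_add_mul_pow_mul_sub_le_pow hw hl0 m)
      (mul_nonneg (mul_self_nonneg (P.eval x)) hw)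
    linear_combination this

/-- A Berezin-type trace inequality. -/
theorem trace_pow_le_of_forall_unit {ι : Type*} [Fintype ι] [DecidableEq ι] {A B : Matrix ι ι ℝ}
    (hA : A.IsHermitian) (m : ℕ)
    (h : ∀ v : ι → ℝ, v ⬝ᵥ v = 1 → (v ⬝ᵥ A.mulVec v) ^ m ≤ v ⬝ᵥ B.mulVec v) :
    (A ^ m).trace ≤ B.trace := by
  set U : Matrix ι ι ℝ := hA.eigenvectorUnitary.1
  have hUU : U * U.transpose = 1 := by
    have := Matrix.mem_unitaryGroup_iff.1 hA.eigenvectorUnitary.2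
    rwa [Matrix.star_eq_conjTranspose, Matrix.conjTranspose_eq_transpose_of_trivial] at this
  have hUU' : U.transpose * U = 1 := mul_eq_one_comm.1 hUU
  have htr (C : Matrix ι ι ℝ) :
      C.trace = ∑ i, (fun a => U a i) ⬝ᵥ C.mulVec (fun a => U a i) := by
    calc C.trace = (U.transpose * (C * U)).trace := by
          rw [Matrix.trace_mul_comm, Matrix.mul_assoc, hUU, Matrix.mul_one]
      _ = _ := rfl
  have hunit (i : ι) : (fun a => U a i) ⬝ᵥ (fun a => U a i) = 1 := by
    have := congrFun (congrFun hUU' i) i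
    rwa [Matrix.one_apply_eq] at this
  have heig (i : ι) : A.mulVec (fun a => U a i) = hA.eigenvalues i • fun a => U a i :=
    hA.mulVec_eigenvectorBasis i
  have hpow (i : ι) (k : ℕ) :
      (A ^ k).mulVec (fun a => U a i) = hA.eigenvalues i ^ k • fun a => U a i := by
    induction k with
    | zero => simp
    | succ k ih =>
      rw [pow_succ, ← Matrix.mulVec_mulVec, heig, Matrix.mulVec_smul, ih, smul_smul, pow_succ']
  rw [htr, htr]
  refine Finset.sum_le_sum fun i _ => ?_
  refine le_trans (le_of_eq ?_) (h _ (hunit i))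
  rw [hpow, heig, dotProduct_smul, dotProduct_smul, hunit]
  simp

theorem dotProduct_mulVec_gaussInt {n : ℕ} {s : ℝ} (hs : 0 < s) (v : Fin n → ℝ) :
    v ⬝ᵥ (Matrix.of fun j k : Fin n => gaussInt s (evenHermite j * evenHermite k)).mulVec v =
      gaussInt s ((∑ j : Fin n, C (v j) * evenHermite j) *
        ∑ j : Fin n, C (v j) * evenHermite j) := by
  rw [Finset.sum_mul_sum, gaussInt_sum hs]
  simp only [gaussInt_sum hs, dotProduct, Matrix.mulVec, Matrix.of_apply, Finset.mul_sum]
  refine Finset.sum_congr rfl fun j _ => Finset.sum_congr rfl fun k _ => ?_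
  rw [show C (v j) * evenHermite j * (C (v k) * evenHermite k) =
    C (v j) * (C (v k) * (evenHermite j * evenHermite k)) by ring, gaussInt_C_mul, gaussInt_C_mul]
  ring

theorem trace_ginibreM_pow_le (n m : ℕ) :
    (ginibreM n ^ (m + 1)).trace ≤
      ∑ j ∈ Finset.range n, gaussInt (m + 2) (evenHermite j * evenHermite j) := by
  have hM : ginibreM n =
      Matrix.of fun j k : Fin n => gaussInt 2 (evenHermite j * evenHermite k) := by
    ext j k; rw [Matrix.of_apply, gaussInt_two_evenHermite_mul]
  have hI : (1 : Matrix (Fin n) (Fin n) ℝ) =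
      Matrix.of fun j k : Fin n => gaussInt 1 (evenHermite j * evenHermite k) := by
    ext j k; simp [gaussInt_one_evenHermite_mul, Matrix.one_apply, Fin.ext_iff]
  have hherm : (ginibreM n).IsHermitian := by
    ext j k
    rw [hM]
    simp [mul_comm]
  rw [← Fin.sum_univ_eq_sum_range (fun j => gaussInt (m + 2) (evenHermite j * evenHermite j))]
  refine trace_pow_le_of_forall_unit (B := Matrix.of fun j k : Fin n =>
    gaussInt (m + 2) (evenHermite j * evenHermite k)) hherm (m + 1) fun v hv => ?_
  rw [hM, dotProduct_mulVec_gaussInt two_pos, dotProduct_mulVec_gaussInt (by positivity)]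
  refine gaussInt_two_pow_le ?_ m
  rw [← dotProduct_mulVec_gaussInt one_pos, ← hI, Matrix.one_mulVec, hv]

/-- The diagonal Hermite integrals are circular moments: both satisfy the same recurrences. -/
theorem hermiteInt_self_eq_cosMoment {s : ℝ} (hs : 0 < s) (a : ℕ) :
    hermiteInt s a a = √(2 * π / s) / π * (a.factorial * cosMoment s a) ∧
      a * hermiteInt s (a + 1) (a - 1) =
        -(√(2 * π / s) / π) * (a.factorial * ((a + 1) * cosMoment' s a)) := by
  induction a with
  | zero => simp [hermiteInt_zero_zero, cosMoment_zero, cosMoment'_zero]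
  | succ a ih =>
    obtain ⟨h1, h2⟩ := ih
    have r1 := hermiteInt_succ hs a (a + 1)
    have r2 := hermiteInt_succ hs (a + 1) a
    rw [hermiteInt_comm s (a - 1)] at r1
    have c1 := cosMoment_succ s a
    have c2 := cosMoment'_succ s a
    have e1 : s * cosMoment s (a + 1) = cosMoment s a + (s - 1) * cosMoment' s a := by
      rw [c1]; field_simp
    have e2 : s * ((a + 2) * cosMoment' s (a + 1)) =
        (a + 1) * (cosMoment' s a + (s - 1) * cosMoment s a) := by
      rw [c2]; field_simp
    simp only [Nat.add_sub_cancel, Nat.factorial_succ] at r1 r2 ⊢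
    push_cast at r1 r2 ⊢
    constructor
    · refine mul_left_cancel₀ hs.ne' ?_
      rw [r1, h1]
      linear_combination -(s - 1) * h2 - √(2 * π / s) / π * ((a + 1) * a.factorial) * e1
    · refine mul_left_cancel₀ hs.ne' ?_
      rw [mul_left_comm, r2, h1]
      linear_combination (a + 1) * h2 + √(2 * π / s) / π * ((a + 1) * a.factorial) * e2

theorem gaussInt_evenHermite_eq_cosMoment {s : ℝ} (hs : 0 < s) (j : ℕ) :
    gaussInt s (evenHermite j * evenHermite j) = cosMoment s (2 * j) / (π * √s) := by
  rw [gaussInt_evenHermite_mul_self, (hermiteInt_self_eq_cosMoment hs _).1, sqrt_div (by positivity)]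
  field_simp

theorem two_mul_sum_range_even (f : ℕ → ℝ) (n : ℕ) :
    2 * ∑ j ∈ Finset.range n, f (2 * j) =
      ∑ a ∈ Finset.range (2 * n), f a + ∑ a ∈ Finset.range (2 * n), (-1) ^ a * f a := by
  induction n with
  | zero => simp
  | succ n ih =>
    rw [Finset.sum_range_succ, mul_add, ih, show 2 * (n + 1) = 2 * n + 1 + 1 by ring]
    simp only [Finset.sum_range_succ, pow_succ, pow_mul]
    ring

theorem sum_cosMoment_even_le {s : ℝ} (hs : 1 < s) {n : ℕ} (hn : 0 < n) :
    ∑ j ∈ Finset.range n, cosMoment s (2 * j) ≤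
      2 * n * √(π / (2 * ((s - 1) / s) * (2 * n - 1))) + π * √s / 4 := by
  have h1 := two_mul_sum_range_even (cosMoment s) n
  have h2 := alternating_sum_cosMoment_le hs n
  obtain ⟨k, hk⟩ : ∃ k, 2 * n = k + 1 := ⟨2 * n - 1, by omega⟩
  have hkR : (2 * n : ℝ) = k + 1 := by exact_mod_cast hk
  have h3 : ∑ a ∈ Finset.range (2 * n), cosMoment s a ≤
      2 * n * (2 * √(π / (2 * ((s - 1) / s) * (2 * n - 1)))) := by
    rw [hk, sum_cosMoment (by linarith), hkR, add_sub_cancel_right]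
    exact mul_le_mul_of_nonneg_left
      (cosMoment_add_cosMoment'_le hs (by rw [← Nat.not_even_iff_odd, Nat.even_iff]; omega))
      (by positivity)
  linarith

theorem stmt6 (m n : ℕ) (hm : 0 < m) (hn : 0 < n) :
    Matrix.trace (ginibreM n ^ m) ≤
      Real.sqrt ((n : ℝ) / (Real.pi * m)) * (1 + (n : ℝ)⁻¹) + 1 / 4 +
        (1 / 8) * Real.sqrt ((m : ℝ) / (Real.pi * n)) * (1 + 2 * (n : ℝ)⁻¹) := by
  obtain ⟨m, rfl⟩ := Nat.exists_eq_add_of_le' hm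
  have hn1 : (1 : ℝ) ≤ n := by exact_mod_cast hn
  set s : ℝ := m + 2 with hs
  have hs1 : 1 < s := by rw [hs]; linarith [m.cast_nonneg (α := ℝ)]
  have hsm : s - 1 = ((m + 1 : ℕ) : ℝ) := by rw [hs]; push_cast; ring
  have htrace := trace_ginibreM_pow_le n m
  rw [← hs] at htrace
  simp only [gaussInt_evenHermite_eq_cosMoment (zero_lt_one.trans hs1), ← Finset.sum_div] at htrace
  have hbound := div_le_div_of_nonneg_right (sum_cosMoment_even_le hs1 hn)
    (by positivity : 0 ≤ π * √s)
  have hmain : 2 * n * √(π / (2 * ((s - 1) / s) * (2 * n - 1))) / (π * √s) ≤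
      √(n / (π * (m + 1 : ℕ))) * (1 + (n : ℝ)⁻¹) := by
    rw [← hsm]
    have h0 : 0 < s - 1 := by linarith
    have h2 : (0 : ℝ) < 2 * n - 1 := by linarith
    refine abs_le_of_sq_le_sq' ?_ (by positivity) |>.2
    rw [div_pow, mul_pow (2 * (n : ℝ)), mul_pow π, mul_pow √_, sq_sqrt (by positivity), sq_sqrt (by positivity),
      sq_sqrt (by positivity)]
    have e1 : (2 * (n : ℝ)) ^ 2 * (π / (2 * ((s - 1) / s) * (2 * n - 1))) / (π ^ 2 * s) =
        2 * n ^ 2 / (2 * n - 1) / (π * (s - 1)) := by field_simp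
    have e2 : (n : ℝ) / (π * (s - 1)) * (1 + (n : ℝ)⁻¹) ^ 2 =
        (n + 1) ^ 2 / n / (π * (s - 1)) := by field_simp
    rw [e1, e2]
    refine div_le_div_of_nonneg_right ?_ (by positivity)
    rw [div_le_div_iff₀ h2 (by linarith)]
    nlinarith
  have hlast : 0 ≤ 1 / 8 * √(((m + 1 : ℕ) : ℝ) / (π * n)) * (1 + 2 * (n : ℝ)⁻¹) := by positivity
  have hquarter : π * √s / 4 / (π * √s) = 1 / 4 := by field_simp
  rw [add_div, hquarter] at hbound
  linarith
end

section
/- Let $M_n$ be the $n\times n$ real symmetric matrix with entries $M_n(j,k) = \frac{1}{\sqrt{2\pi}}\,\frac{\Gamma(j+k-3/2)}{\sqrt{\Gamma(2j-1)\Gamma(2k-1)}}$ for $1\le j,k\le n$, and let $\lambda_1 \ge \lambda_2 \ge \cdots \ge \lambda_n$ denote its eigenvalues in decreasing order. Then for every $\epsilon > 0$ there exists $N_\epsilon$ such that for all $n > N_\epsilon$ and all integers $k$ with $1 \le k \le n$, $\lambda_k \ge \frac{\sqrt{n/\pi}\,(1-\epsilon) - k + 1}{n - k + 1}$. -/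
/-- One half of the Schur test: a nonnegative matrix with a positive subinvariant vector
has all its real eigenvalues at most `1`. -/
theorem Matrix.eigenvalue_le_one_of_mulVec_le {ι : Type*} [Fintype ι]
    (A : Matrix ι ι ℝ) (hA : ∀ i j, 0 ≤ A i j) (w : ι → ℝ) (hw : ∀ i, 0 < w i)
    (hAw : ∀ i, ∑ j, A i j * w j ≤ w i) (μ : ℝ) (v : ι → ℝ) (hv : v ≠ 0)
    (h : A.mulVec v = μ • v) : μ ≤ 1 := by
  obtain ⟨i₀, hi₀⟩ : ∃ i, v i ≠ 0 := Function.ne_iff.mp hv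
  obtain ⟨i, -, hi⟩ := Finset.exists_max_image Finset.univ (fun i => |v i| / w i)
    ⟨i₀, Finset.mem_univ _⟩
  set c := |v i| / w i with hc
  have hvi : |v i| = c * w i := by rw [hc, div_mul_cancel₀ _ (hw i).ne']
  have hcpos : 0 < c :=
    (div_pos (abs_pos.mpr hi₀) (hw i₀)).trans_le (hi i₀ (Finset.mem_univ _))
  have hbound : ∀ j, |v j| ≤ c * w j := fun j =>
    (div_le_iff₀ (hw j)).mp (hi j (Finset.mem_univ _))
  have hμ : μ * |v i| ≤ |v i| := by
    calc μ * |v i| ≤ |μ| * |v i| := by gcongr; exact le_abs_self μ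
      _ = |∑ j, A i j * v j| := by
        have : ∑ j, A i j * v j = μ * v i := congrFun h i
        rw [this, abs_mul]
      _ ≤ ∑ j, |A i j * v j| := Finset.abs_sum_le_sum_abs _ _
      _ ≤ ∑ j, c * (A i j * w j) := by
        refine Finset.sum_le_sum fun j _ => ?_
        rw [abs_mul, abs_of_nonneg (hA i j)]
        calc A i j * |v j| ≤ A i j * (c * w j) :=
              mul_le_mul_of_nonneg_left (hbound j) (hA i j)
          _ = c * (A i j * w j) := by ring
      _ ≤ c * w i := by
        rw [← Finset.mul_sum]
        exact mul_le_mul_of_nonneg_left (hAw i) hcpos.le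
      _ = |v i| := hvi.symm
  have hpos : 0 < |v i| := hvi ▸ mul_pos hcpos (hw i)
  exact le_of_mul_le_mul_right (by simpa using hμ) hpos

/-- Partial sums of the binomial series `∑ Γ(a + q) (1/2)^q / q! = 2^a Γ(a)`. -/
theorem Real.sum_Gamma_add_div_le (a : ℝ) (ha : 0 < a) (n : ℕ) :
    ∑ q ∈ Finset.range n, Real.Gamma (a + q) / (2 ^ q * q.factorial) ≤ 2 ^ a * Real.Gamma a := by
  have hterm : ∀ q : ℕ, Real.Gamma (a + q) / (2 ^ q * q.factorial) =
      ∫ x in Set.Ioi (0 : ℝ), Real.exp (-x) * x ^ (a + q - 1) / (2 ^ q * q.factorial) := by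
    intro q
    rw [MeasureTheory.integral_div, Real.Gamma_eq_integral (by positivity)]
  have hint : ∀ q : ℕ, MeasureTheory.IntegrableOn
      (fun x : ℝ => Real.exp (-x) * x ^ (a + q - 1) / (2 ^ q * q.factorial)) (Set.Ioi 0) :=
    fun q => (Real.GammaIntegral_convergent (by positivity)).div_const _
  have hrhs : (2 : ℝ) ^ a * Real.Gamma a =
      ∫ x in Set.Ioi (0 : ℝ), x ^ (a - 1) * Real.exp (-((1 / 2) * x)) := by
    rw [Real.integral_rpow_mul_exp_neg_mul_Ioi ha (by norm_num)]
    norm_num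
  have hpos : (0 : ℝ) < 2 ^ a * Real.Gamma a := mul_pos (by positivity) (Real.Gamma_pos_of_pos ha)
  simp_rw [hterm]
  rw [← MeasureTheory.integral_finsetSum _ fun q _ => hint q, hrhs]
  refine MeasureTheory.setIntegral_mono_on (MeasureTheory.integrable_finsetSum _ fun q _ => hint q)
    (MeasureTheory.Integrable.of_integral_ne_zero (hrhs ▸ hpos.ne')) measurableSet_Ioi ?_
  intro x hx
  have hx : 0 < x := hx
  calc ∑ q ∈ Finset.range n, Real.exp (-x) * x ^ (a + q - 1) / (2 ^ q * q.factorial)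
      = x ^ (a - 1) * Real.exp (-x) * ∑ q ∈ Finset.range n, (x / 2) ^ q / q.factorial := by
        rw [Finset.mul_sum]
        refine Finset.sum_congr rfl fun q _ => ?_
        rw [show a + q - 1 = (a - 1) + q by ring, Real.rpow_add hx, Real.rpow_natCast, div_pow]
        field_simp
    _ ≤ x ^ (a - 1) * Real.exp (-x) * Real.exp (x / 2) := by
        gcongr
        exact Real.sum_le_exp_of_nonneg (by positivity) n
    _ = x ^ (a - 1) * Real.exp (-((1 / 2) * x)) := by
        rw [mul_assoc, ← Real.exp_add]
        ring_nf

/-- Log-convexity of `Γ` gives a lower bound on the ratio `Γ(x + 1/2) / Γ(x + 1)`. -/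
theorem Real.one_div_sqrt_le_Gamma_add_half_div (x : ℝ) (hx : 0 ≤ x) :
    1 / √(x + 1 / 2) ≤ Real.Gamma (x + 1 / 2) / Real.Gamma (x + 1) := by
  have hG : 0 < Real.Gamma (x + 1 / 2) := Real.Gamma_pos_of_pos (by positivity)
  have hG' : 0 < Real.Gamma (x + 1) := Real.Gamma_pos_of_pos (by positivity)
  have hs : (0 : ℝ) < x + 1 / 2 := by positivity
  have key := Real.Gamma_mul_add_mul_le_rpow_Gamma_mul_rpow_Gamma (s := x + 1 / 2)
    (t := x + 1 / 2 + 1) (a := 1 / 2) (b := 1 / 2) hs (by positivity) (by norm_num)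
    (by norm_num) (by norm_num)
  rw [Real.Gamma_add_one hs.ne', ← Real.sqrt_eq_rpow, ← Real.sqrt_eq_rpow,
    Real.sqrt_mul hs.le, mul_left_comm, Real.mul_self_sqrt hG.le,
    show 1 / 2 * (x + 1 / 2) + 1 / 2 * (x + 1 / 2 + 1) = x + 1 by ring] at key
  rw [div_le_div_iff₀ (Real.sqrt_pos.mpr hs) hG']
  linarith

theorem ginibreM_apply_s17 {n : ℕ} (p q : Fin n) :
    ginibreM n p q = Real.Gamma ((p : ℕ) + 1 / 2 + (q : ℕ)) /
      (√(2 * Real.pi) * √((2 * (p : ℕ)).factorial) * √((2 * (q : ℕ)).factorial)) := by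
  have h : ∀ m : ℕ, Real.Gamma (2 * ((m : ℝ) + 1) - 1) = (2 * m).factorial := fun m => by
    rw [← Real.Gamma_nat_eq_factorial]
    push_cast
    ring_nf
  simp only [ginibreM, Matrix.of_apply, h]
  rw [Real.sqrt_mul (Nat.cast_nonneg _)]
  rw [show ((p : ℕ) + 1 : ℝ) + ((q : ℕ) + 1 : ℝ) - 3 / 2 = (p : ℕ) + 1 / 2 + (q : ℕ) by ring]
  field_simp

theorem Real.Gamma_nat_add_half_eq_factorial (p : ℕ) :
    Real.Gamma (p + 1 / 2) = (2 * p).factorial * √Real.pi / (4 ^ p * p.factorial) := by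
  induction p with
  | zero => simpa using Real.Gamma_one_half_eq
  | succ p ih =>
    rw [show ((p + 1 : ℕ) : ℝ) + 1 / 2 = (p + 1 / 2 : ℝ) + 1 by push_cast; ring,
      Real.Gamma_add_one (by positivity), ih, show 2 * (p + 1) = 2 * p + 1 + 1 by ring,
      Nat.factorial_succ, Nat.factorial_succ, Nat.factorial_succ]
    push_cast
    field_simp
    ring

theorem ginibreM_subinvariant {n : ℕ} (p : Fin n) :
    ∑ q : Fin n, ginibreM n p q *
      (√((2 * (q : ℕ)).factorial) / (2 ^ (q : ℕ) * (q : ℕ).factorial)) ≤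
        √((2 * (p : ℕ)).factorial) / (2 ^ (p : ℕ) * (p : ℕ).factorial) := by
  have hf : ∀ m : ℕ, 0 < √((m.factorial : ℕ) : ℝ) := fun m => by positivity
  have hterm : ∀ q : Fin n, ginibreM n p q *
      (√((2 * (q : ℕ)).factorial) / (2 ^ (q : ℕ) * (q : ℕ).factorial)) =
      (1 / (√(2 * Real.pi) * √((2 * (p : ℕ)).factorial))) *
        (Real.Gamma ((p : ℕ) + 1 / 2 + (q : ℕ)) / (2 ^ (q : ℕ) * (q : ℕ).factorial)) := by
    intro q
    rw [ginibreM_apply_s17]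
    have := hf (2 * q)
    field_simp
  simp_rw [hterm]
  rw [← Finset.mul_sum, Fin.sum_univ_eq_sum_range (fun q : ℕ =>
    Real.Gamma ((p : ℕ) + 1 / 2 + q) / (2 ^ q * q.factorial)) n]
  calc _ ≤ (1 / (√(2 * Real.pi) * √((2 * (p : ℕ)).factorial))) *
        ((2 : ℝ) ^ (((p : ℕ) : ℝ) + 1 / 2) * Real.Gamma ((p : ℕ) + 1 / 2)) := by
        gcongr
        exact Real.sum_Gamma_add_div_le _ (by positivity) n
    _ = _ := by
        rw [Real.Gamma_nat_add_half_eq_factorial, Real.rpow_add (by norm_num), Real.rpow_natCast,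
          ← Real.sqrt_eq_rpow, Real.sqrt_mul (by norm_num)]
        have h1 := hf (2 * p)
        have h2 : √(((2 * (p : ℕ)).factorial : ℕ) : ℝ) ^ 2 = (2 * (p : ℕ)).factorial :=
          Real.sq_sqrt (Nat.cast_nonneg _)
        rw [show (4 : ℝ) ^ (p : ℕ) = 2 ^ (p : ℕ) * 2 ^ (p : ℕ) by rw [← mul_pow]; norm_num]
        have : 0 < √Real.pi := Real.sqrt_pos.mpr Real.pi_pos
        field_simp
        exact h2.symm

theorem ginibreM_eigenvalues_le_one {n : ℕ} (h : (ginibreM n).IsHermitian) (i : Fin n) :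
    h.eigenvalues i ≤ 1 := by
  refine Matrix.eigenvalue_le_one_of_mulVec_le (ginibreM n) (fun p q => ?_)
    (fun q => √((2 * (q : ℕ)).factorial) / (2 ^ (q : ℕ) * (q : ℕ).factorial))
    (fun q => by positivity) ginibreM_subinvariant _ _ ?_ (h.mulVec_eigenvectorBasis i)
  · rw [ginibreM_apply_s17]
    have : 0 < Real.Gamma (((p : ℕ) : ℝ) + 1 / 2 + (q : ℕ)) := Real.Gamma_pos_of_pos (by positivity)
    positivity
  · intro h0
    exact h.eigenvectorBasis.orthonormal.ne_zero i (by ext j; exact congrFun h0 j)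

theorem ginibreM_trace_ge (n : ℕ) : (√n - 1 / 2) / √Real.pi ≤ (ginibreM n).trace := by
  have hdiag : ∀ p : Fin n, (√(((p : ℕ) + 1 : ℕ) + 1 / 4 : ℝ) - √((p : ℕ) + 1 / 4)) / √Real.pi ≤
      ginibreM n p p := by
    intro p
    have hx := Real.one_div_sqrt_le_Gamma_add_half_div (2 * (p : ℕ)) (by positivity)
    have hG : Real.Gamma (2 * ((p : ℕ) : ℝ) + 1) = (2 * (p : ℕ)).factorial := by
      rw [← Real.Gamma_nat_eq_factorial]
      push_cast
      rfl
    have happ : ginibreM n p p =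
        Real.Gamma (2 * (p : ℕ) + 1 / 2) / Real.Gamma (2 * (p : ℕ) + 1) / √(2 * Real.pi) := by
      rw [ginibreM_apply_s17, hG, mul_assoc, Real.mul_self_sqrt (Nat.cast_nonneg _),
        show ((p : ℕ) : ℝ) + 1 / 2 + (p : ℕ) = 2 * (p : ℕ) + 1 / 2 by ring, div_div,
        mul_comm (√(2 * Real.pi))]
    rw [happ]
    refine le_trans ?_ (div_le_div_of_nonneg_right hx (Real.sqrt_nonneg _))
    rw [show (2 * ((p : ℕ) : ℝ) + 1 / 2) = 2 * ((p : ℕ) + 1 / 4) by ring,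
      Real.sqrt_mul (by norm_num), Real.sqrt_mul (by norm_num)]
    set s := √(((p : ℕ) : ℝ) + 1 / 4) with hs
    have hspos : 0 < s := Real.sqrt_pos.mpr (by positivity)
    have hs2 : s ^ 2 = (p : ℕ) + 1 / 4 := Real.sq_sqrt (by positivity)
    set t := √(((p : ℕ) + 1 : ℕ) + 1 / 4 : ℝ) with ht
    have ht2 : t ^ 2 = (p : ℕ) + 1 + 1 / 4 := by
      rw [ht, Real.sq_sqrt (by positivity)]
      push_cast
      ring
    have hpi : 0 < √Real.pi := Real.sqrt_pos.mpr Real.pi_pos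
    have h2 : √(2 : ℝ) * √2 = 2 := Real.mul_self_sqrt (by norm_num)
    rw [div_div, show √2 * s * (√2 * √Real.pi) = (√2 * √2) * s * √Real.pi by ring, h2,
      ← div_div]
    gcongr
    rw [le_div_iff₀ (by positivity)]
    nlinarith [sq_nonneg (t - s)]
  have hsum : ∑ p : Fin n, (√(((p : ℕ) + 1 : ℕ) + 1 / 4 : ℝ) - √((p : ℕ) + 1 / 4)) / √Real.pi =
      (√((n : ℝ) + 1 / 4) - 1 / 2) / √Real.pi := by
    rw [← Finset.sum_div, Fin.sum_univ_eq_sum_range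
      (fun p : ℕ => √((p + 1 : ℕ) + 1 / 4 : ℝ) - √((p : ℝ) + 1 / 4)) n,
      Finset.sum_range_sub (fun p : ℕ => √((p : ℝ) + 1 / 4))]
    rw [show (((0 : ℕ) : ℝ) + 1 / 4) = (1 / 2) ^ 2 by norm_num, Real.sqrt_sq (by norm_num)]
  calc (√n - 1 / 2) / √Real.pi ≤ (√((n : ℝ) + 1 / 4) - 1 / 2) / √Real.pi := by
        gcongr
        linarith
    _ ≤ (ginibreM n).trace := hsum ▸ Finset.sum_le_sum fun p _ => hdiag p

theorem stmt17 :
    ∀ ε : ℝ, 0 < ε → ∃ Nε : ℕ, ∀ n : ℕ, Nε < n →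
      ∀ (h : (ginibreM n).IsHermitian) (σ : Equiv.Perm (Fin n)),
        Antitone (fun i : Fin n => h.eigenvalues (σ i)) →
        ∀ k : Fin n,
          h.eigenvalues (σ k) ≥
            (Real.sqrt ((n : ℝ) / Real.pi) * (1 - ε) - (k : ℕ)) / ((n : ℝ) - (k : ℕ)) := by
  intro ε hε
  refine ⟨⌈(1 / ε) ^ 2⌉₊, fun n hn h σ hanti k => ?_⟩
  have hn' : 1 / ε ≤ √n := Real.le_sqrt_of_sq_le ((Nat.le_ceil _).trans (by exact_mod_cast hn.le))
  have htrace : √((n : ℝ) / Real.pi) * (1 - ε) ≤ (ginibreM n).trace := by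
    refine le_trans ?_ (ginibreM_trace_ge n)
    rw [Real.sqrt_div (Nat.cast_nonneg _), div_mul_eq_mul_div]
    gcongr
    rw [div_le_iff₀ hε] at hn'
    linarith
  have hk : ((k : ℕ) : ℝ) < n := by exact_mod_cast k.2
  have hsum : (ginibreM n).trace ≤ (k : ℕ) + (n - (k : ℕ)) * h.eigenvalues (σ k) := by
    calc (ginibreM n).trace = ∑ i, h.eigenvalues (σ i) := by
          rw [h.trace_eq_sum_eigenvalues, Equiv.sum_comp σ (fun i => h.eigenvalues i)]
          simp
      _ ≤ ∑ i, if i < k then 1 else h.eigenvalues (σ k) := by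
          refine Finset.sum_le_sum fun i _ => ?_
          split_ifs with hik
          · exact ginibreM_eigenvalues_le_one h _
          · exact hanti (not_lt.mp hik)
      _ = _ := by
          have hIio : (Finset.univ.filter fun i : Fin n => i < k) = Finset.Iio k := by ext; simp
          have hIci : (Finset.univ.filter fun i : Fin n => ¬ i < k) = Finset.Ici k := by ext; simp
          rw [Finset.sum_ite, hIio, hIci]
          simp [Nat.cast_sub k.2.le]
  rw [ge_iff_le, div_le_iff₀ (by linarith)]
  linarith
end
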